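/- There exists a compact set S ⊆ ℝ³ homeomorphic to the unit sphere {x ∈ ℝ³ : ‖x‖ = 1} which is not an attractor for any discrete dynamical system: for every open set U ⊆ ℝ³ containing S and every injective continuous map f : U → U, S is not an attractor for f. (Such a set is the Alexander horned sphere.) -/

import Mathlib

open Set

noncomputable section

/-- Euclidean 3-space. -/
abbrev R3 := EuclideanSpace ℝ (Fin 3)

/-- The image in `ℝ³` of a set `P ⊆ ℝ³` under the `n`-th iterate of a map `f : U → U`
defined on (the subtype of) an open set `U ⊆ ℝ³`. -/
def imgIter {U : Set R3} (f : U → U) (n : ℕ) (P : Set R3) : Set R3 :=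
  Subtype.val '' (f^[n] '' (Subtype.val ⁻¹' P))

/-- A compact set `P` is attracted by `K` under `f : U → U` if for every neighbourhood `V`
of `K` there is `n₀` such that `fⁿ(P) ⊆ V` for all `n ≥ n₀`. -/
def IsAttracted {U : Set R3} (f : U → U) (K P : Set R3) : Prop :=
  ∀ V : Set R3, K ⊆ interior V → ∃ n₀ : ℕ, ∀ n ≥ n₀, imgIter f n P ⊆ V

/-- `K` is an attractor for the discrete dynamical system `f : U → U`: it is compact,
invariant (`f(K) = K`), and has a neighbourhood `A ⊆ U` all of whose compact subsets
are attracted by `K`. -/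
def IsAttractor {U : Set R3} (f : U → U) (K : Set R3) : Prop :=
  IsCompact K ∧ K ⊆ U ∧ imgIter f 1 K = K ∧
    ∃ A : Set R3, A ⊆ U ∧ K ⊆ interior A ∧
      ∀ P : Set R3, IsCompact P → P ⊆ A → IsAttracted f K P

section LocalSystem

open Topology Filter

variable {α β F : Type*} [TopologicalSpace α] [TopologicalSpace β] [Group F]

/-- A nonabelian Alexander–Spanier cocycle: near each point of `X`, `g` is the coboundary of a
potential. -/
def IsFlat (g : α → α → F) (X : Set α) : Prop :=
  ∀ x ∈ X, ∃ N ∈ 𝓝[X] x, ∃ s : α → F, ∀ p ∈ N, ∀ q ∈ N, g p q = (s p)⁻¹ * s q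

/-- The cocycle `g` is, near the diagonal of `X`, the coboundary of a global potential. -/
def IsTriv (g : α → α → F) (X : Set α) : Prop :=
  ∃ h : α → F, ∀ x ∈ X, ∃ N ∈ 𝓝[X] x, ∀ p ∈ N, ∀ q ∈ N, g p q = (h p)⁻¹ * h q

/-- Gauge equivalence of cocycles near the diagonal of `X`. -/
def FlatEquiv (g g' : α → α → F) (X : Set α) : Prop :=
  ∃ h : α → F, ∀ x ∈ X, ∃ N ∈ 𝓝[X] x, ∀ p ∈ N, ∀ q ∈ N, g' p q = (h p)⁻¹ * g p q * h q

/-- The pullback of a cocycle. -/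
def pull (φ : β → α) (g : α → α → F) : β → β → F := fun p q => g (φ p) (φ q)

theorem IsFlat.self {g : α → α → F} {X : Set α} (hg : IsFlat g X) {x : α} (hx : x ∈ X) :
    g x x = 1 := by
  obtain ⟨N, hN, s, hs⟩ := hg x hx
  have := mem_of_mem_nhdsWithin hx hN
  simp [hs x this x this]

theorem IsFlat.pull {g : α → α → F} {X : Set α} (hg : IsFlat g X) {φ : β → α} {Y : Set β}
    (hφ : ContinuousOn φ Y) (hm : MapsTo φ Y X) : IsFlat (pull φ g) Y := by
  intro y hy
  obtain ⟨N, hN, s, hs⟩ := hg (φ y) (hm hy)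
  exact ⟨φ ⁻¹' N, (hφ y hy).tendsto_nhdsWithin hm hN, s ∘ φ, fun p hp q hq => hs _ hp _ hq⟩

theorem IsFlat.mono {g : α → α → F} {X Y : Set α} (hg : IsFlat g X) (h : Y ⊆ X) :
    IsFlat g Y := hg.pull continuousOn_id h

theorem FlatEquiv.isTriv {g g' : α → α → F} {X : Set α} (e : FlatEquiv g g' X)
    (hg : IsTriv g X) : IsTriv g' X := by
  obtain ⟨h, hh⟩ := e
  obtain ⟨k, hk⟩ := hg
  refine ⟨fun p => k p * h p, fun x hx => ?_⟩
  obtain ⟨N, hN, hs⟩ := hh x hx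
  obtain ⟨M, hM, ht⟩ := hk x hx
  refine ⟨N ∩ M, inter_mem hN hM, fun p hp q hq => ?_⟩
  rw [hs p hp.1 q hq.1, ht p hp.2 q hq.2]
  group

theorem eq_of_local_potential {g : α → α → F} {J : Set α} (hJ : IsPreconnected J) {k ν : α → F}
    (hk : ∀ x ∈ J, ∃ N ∈ 𝓝[J] x, ∀ p ∈ N, ∀ q ∈ N, g p q = (k p)⁻¹ * k q)
    (hν : ∀ p ∈ J, ∀ q ∈ J, g p q = (ν p)⁻¹ * ν q) {p q : α} (hp : p ∈ J) (hq : q ∈ J) :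
    g p q = (k p)⁻¹ * k q := by
  have key : ν p * (k p)⁻¹ = ν q * (k q)⁻¹ := by
    refine hJ.induction₂ (fun p q => ν p * (k p)⁻¹ = ν q * (k q)⁻¹) (fun x hx => ?_)
      (fun _ _ _ _ _ _ h h' => h.trans h') (fun _ _ _ _ h => h.symm) hp hq
    obtain ⟨N, hN, hs⟩ := hk x hx
    filter_upwards [hN, self_mem_nhdsWithin] with y hy hyJ
    have h1 := hs x (mem_of_mem_nhdsWithin hx hN) y hy
    rw [hν x hx y hyJ] at h1
    have : ν y = ν x * ((k x)⁻¹ * k y) := by rw [← h1]; group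
    rw [this]; group
  rw [hν p hp q hq]
  have : ν p = ν q * (k q)⁻¹ * k p := by rw [← key]; group
  rw [this]; group

open unitInterval in
theorem isFlat_unitInterval {g : I → I → F} (hg : IsFlat g univ) :
    ∃ k : I → F, k 0 = 1 ∧ ∀ x, ∃ N ∈ 𝓝 x, ∀ p ∈ N, ∀ q ∈ N, g p q = (k p)⁻¹ * k q := by
  choose! N hN s hs using hg
  simp only [mem_univ, nhdsWithin_univ, forall_const] at hN hs
  obtain ⟨t, ht0, htm, ⟨n, hn⟩, ht⟩ := exists_monotone_Icc_subset_open_cover_unitInterval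
    (c := fun i => interior (N i)) (fun i => isOpen_interior)
    (fun x _ => mem_iUnion.2 ⟨x, mem_interior_iff_mem_nhds.2 (hN x)⟩)
  have key : ∀ m, ∃ k : I → F, k 0 = 1 ∧
      ∀ x ≤ t m, ∃ N ∈ 𝓝 x, ∀ p ∈ N, p ≤ t m → ∀ q ∈ N, q ≤ t m → g p q = (k p)⁻¹ * k q := by
    intro m
    induction m with
    | zero =>
      refine ⟨fun _ => 1, rfl, fun x hx => ⟨N 0, ?_, ?_⟩⟩
      · rw [ht0] at hx
        rw [le_antisymm hx nonneg']; exact hN 0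
      · intro p _ hp' q _ hq'
        rw [ht0] at hp' hq'
        rw [le_antisymm hp' nonneg', le_antisymm hq' nonneg',
          hs 0 0 (mem_of_mem_nhds (hN 0)) 0 (mem_of_mem_nhds (hN 0))]
        simp
    | succ m ih =>
      obtain ⟨k, hk0, hk⟩ := ih
      obtain ⟨i, hi⟩ := ht m
      set a := t m
      set b := t (m + 1)
      have hab : a ≤ b := htm (Nat.le_succ m)
      have hmem : ∀ x, a ≤ x → x ≤ b → interior (N i) ∈ 𝓝 x := fun x h1 h2 =>
        isOpen_interior.mem_nhds (hi ⟨h1, h2⟩)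
      have hsi : ∀ p ∈ interior (N i), ∀ q ∈ interior (N i), g p q = (s i p)⁻¹ * s i q :=
        fun p hp q hq => hs i p (interior_subset hp) q (interior_subset hq)
      refine ⟨fun p => if p ≤ a then k p else k a * (s i a)⁻¹ * s i p, ?_, fun x hx => ?_⟩
      · simp only [if_pos (show (0 : I) ≤ a from nonneg'), hk0]
      rcases lt_trichotomy x a with h | h | h
      · obtain ⟨M, hM, hkM⟩ := hk x h.le
        refine ⟨M ∩ Iio a, inter_mem hM (Iio_mem_nhds h), fun p hp _ q hq _ => ?_⟩
        simp only [if_pos (le_of_lt (mem_Iio.1 hp.2)), if_pos (le_of_lt (mem_Iio.1 hq.2))]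
        exact hkM p hp.1 (le_of_lt (mem_Iio.1 hp.2)) q hq.1 (le_of_lt (mem_Iio.1 hq.2))
      · rw [← h]
        rw [← h] at hk hab hmem
        obtain ⟨M, hM, hkM⟩ := hk x le_rfl
        refine ⟨M ∩ interior (N i), inter_mem hM (hmem x le_rfl hab), ?_⟩
        have hxM := mem_of_mem_nhds hM
        have hxN := mem_of_mem_nhds (hmem x le_rfl hab)
        have hpot : ∀ p ∈ M ∩ interior (N i),
            (if p ≤ x then k p else k x * (s i x)⁻¹ * s i p) = k x * (s i x)⁻¹ * s i p := by
          intro p hp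
          split_ifs with hpx
          · have h1 := hkM p hp.1 hpx x hxM le_rfl
            rw [hsi p hp.2 x hxN] at h1
            have : k x = k p * ((s i p)⁻¹ * s i x) := by rw [h1]; group
            rw [this]; group
          · rfl
        intro p hp _ q hq _
        simp only [hpot p hp, hpot q hq, hsi p hp.2 q hq.2]
        group
      · refine ⟨interior (N i) ∩ Ioi a, inter_mem (hmem x h.le hx) (Ioi_mem_nhds h),
          fun p hp _ q hq _ => ?_⟩
        simp only [if_neg (not_le.2 (mem_Ioi.1 hp.2)), if_neg (not_le.2 (mem_Ioi.1 hq.2)),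
          hsi p hp.1 q hq.1]
        group
  obtain ⟨k, hk0, hk⟩ := key n
  refine ⟨k, hk0, fun x => ?_⟩
  have h1 : t n = 1 := hn n le_rfl
  rw [h1] at hk
  obtain ⟨M, hM, h⟩ := hk x le_one'
  exact ⟨M, hM, fun p hp q hq => h p hp le_one' q hq le_one'⟩

open unitInterval in
/-- Homotopy invariance of cocycles. -/
theorem flatEquiv_of_homotopy {G : α × I → α × I → F} (hG : IsFlat G univ) :
    FlatEquiv (pull (fun x => (x, 0)) G) (pull (fun x => (x, 1)) G) univ := by
  have hk : ∀ x : α, ∃ k : I → F, k 0 = 1 ∧ ∀ t, ∃ N ∈ 𝓝 t, ∀ p ∈ N, ∀ q ∈ N,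
      G (x, p) (x, q) = (k p)⁻¹ * k q := fun x =>
    isFlat_unitInterval (hG.pull (φ := fun t => (x, t)) (by fun_prop) (mapsTo_univ _ _))
  choose k hk0 hk using hk
  refine ⟨fun x => k x 1, fun x₀ _ => ?_⟩
  rw [nhdsWithin_univ]
  set C : I → Prop := fun t => ∃ U ∈ 𝓝 x₀, ∀ x ∈ U, ∀ y ∈ U,
    G (x, t) (y, t) = (k x t)⁻¹ * G (x, 0) (y, 0) * k y t with hC
  have hstep : ∀ t, ∃ J ∈ 𝓝 t, ∀ t₁ ∈ J, ∀ t₂ ∈ J, C t₁ → C t₂ := by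
    intro t
    obtain ⟨N, hN, s, hs⟩ := hG (x₀, t) trivial
    rw [nhdsWithin_univ, mem_nhds_prod_iff] at hN
    obtain ⟨U, hU, J, hJ, hUJ⟩ := hN
    obtain ⟨c, d, -, hJ', hJJ⟩ := exists_Icc_mem_subset_of_mem_nhds hJ
    have hJ'c : IsPreconnected (Icc c d) := isPreconnected_Icc
    set J' := Icc c d
    refine ⟨J', hJ', fun t₁ h₁ t₂ h₂ ⟨U₁, hU₁, hc⟩ => ⟨U ∩ U₁, inter_mem hU hU₁, ?_⟩⟩
    have hkG : ∀ x ∈ U, ∀ p ∈ J', ∀ q ∈ J', G (x, p) (x, q) = (k x p)⁻¹ * k x q := by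
      intro x hx p hp q hq
      refine eq_of_local_potential (g := fun p q => G (x, p) (x, q)) hJ'c (fun t _ => ?_)
        (ν := fun t => s (x, t)) (fun p hp q hq => hs _ (hUJ ⟨hx, hJJ hp⟩) _ (hUJ ⟨hx, hJJ hq⟩))
        hp hq
      obtain ⟨M, hM, h⟩ := hk x t
      exact ⟨M, mem_nhdsWithin_of_mem_nhds hM, h⟩
    intro x hx y hy
    have mem : ∀ x ∈ U, ∀ t ∈ J', (x, t) ∈ N := fun x hx t ht => hUJ ⟨hx, hJJ ht⟩
    have e1 := hkG x hx.1 t₂ h₂ t₁ h₁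
    have e2 := hkG y hy.1 t₁ h₁ t₂ h₂
    have e3 := hc x hx.2 y hy.2
    have e : G (x, t₂) (y, t₂) = G (x, t₂) (x, t₁) * G (x, t₁) (y, t₁) * G (y, t₁) (y, t₂) := by
      rw [hs _ (mem x hx.1 t₂ h₂) _ (mem y hy.1 t₂ h₂), hs _ (mem x hx.1 t₂ h₂) _ (mem x hx.1 t₁ h₁),
        hs _ (mem x hx.1 t₁ h₁) _ (mem y hy.1 t₁ h₁), hs _ (mem y hy.1 t₁ h₁) _ (mem y hy.1 t₂ h₂)]
      group
    rw [e, e1, e2, e3]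
    group
  have hC0 : C 0 := ⟨univ, univ_mem, fun x _ y _ => by simp [hk0]⟩
  have hC1 : C 0 ↔ C 1 := by
    refine isPreconnected_univ.induction₂ (fun a b => C a ↔ C b) (fun t _ => ?_)
      (fun _ _ _ _ _ _ h h' => h.trans h') (fun _ _ _ _ h => h.symm) (mem_univ _) (mem_univ _)
    obtain ⟨J, hJ, h⟩ := hstep t
    rw [nhdsWithin_univ]
    filter_upwards [hJ] with u hu
    exact ⟨h t (mem_of_mem_nhds hJ) u hu, h u hu t (mem_of_mem_nhds hJ)⟩
  exact hC1.1 hC0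

open unitInterval in
theorem IsFlat.isTriv_of_convex {E : Type*} [NormedAddCommGroup E] [NormedSpace ℝ E]
    {g : E → E → F} {B : Set E} (hg : IsFlat g B) (hB : Convex ℝ B) : IsTriv g B := by
  classical
  rcases B.eq_empty_or_nonempty with rfl | ⟨c, hc⟩
  · exact ⟨fun _ => 1, by simp⟩
  let H : B × I → E := fun p => AffineMap.lineMap c (p.1 : E) (p.2 : ℝ)
  have hH : Continuous H := by
    simp only [H, AffineMap.lineMap_apply_module]
    fun_prop
  have hm : ∀ p, H p ∈ B := fun p =>
    hB.segment_subset hc p.1.2 (by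
      rw [segment_eq_image_lineMap]
      exact ⟨_, p.2.2, rfl⟩)
  obtain ⟨h, hh⟩ := flatEquiv_of_homotopy (hg.pull hH.continuousOn (fun p _ => hm p) (Y := univ))
  refine ⟨fun p => if hp : p ∈ B then h ⟨p, hp⟩ else 1, fun x hx => ?_⟩
  obtain ⟨N, hN, h1⟩ := hh ⟨x, hx⟩ trivial
  rw [nhdsWithin_univ] at hN
  refine ⟨Subtype.val '' N, ?_, ?_⟩
  · rw [nhdsWithin_eq_map_subtype_coe hx]
    exact image_mem_map hN
  · rintro _ ⟨p, hp, rfl⟩ _ ⟨q, hq, rfl⟩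
    have := h1 p hp q hq
    simp only [_root_.pull, H, Icc.coe_zero, Icc.coe_one, AffineMap.lineMap_apply_zero,
      AffineMap.lineMap_apply_one, hg.self hc, mul_one] at this
    simpa using this

/-- On a compact subset of an open set, cocycles with values in a finite group fall into finitely
many gauge equivalence classes. -/
theorem exists_finite_code {E : Type} [NormedAddCommGroup E] [NormedSpace ℝ E] {F : Type}
    [Group F] [Finite F] {X Q : Set E} (hX : IsOpen X) (hQ : IsCompact Q) (hQX : Q ⊆ X) :
    ∃ (D : Type) (_ : Finite D) (code : (E → E → F) → D), ∀ g g', IsFlat g X → IsFlat g' X →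
      code g = code g' → FlatEquiv g g' Q := by
  classical
  have h0 : ∀ x ∈ Q, ∃ r > 0, Metric.ball x r ⊆ X := fun x hx =>
    Metric.isOpen_iff.1 hX x (hQX hx)
  choose! r hr hrX using h0
  obtain ⟨t, htQ, ht⟩ := hQ.elim_nhds_subcover (fun x => Metric.ball x (r x))
    (fun x hx => Metric.ball_mem_nhds x (hr x hx))
  have hpot : ∀ (g : E → E → F) (a : t), ∃ h : E → F, IsFlat g X →
      ∀ x ∈ Metric.ball (a : E) (r a), ∃ N ∈ 𝓝 x, ∀ p ∈ N, ∀ q ∈ N, g p q = (h p)⁻¹ * h q := by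
    intro g a
    by_cases hg : IsFlat g X
    · obtain ⟨h, hh⟩ := (hg.mono (hrX a (htQ a a.2))).isTriv_of_convex (convex_ball _ _)
      refine ⟨h, fun _ x hx => ?_⟩
      have := hh x hx
      rwa [Metric.isOpen_ball.nhdsWithin_eq hx] at this
    · exact ⟨fun _ => 1, fun h => absurd h hg⟩
  choose h hh using hpot
  let P : t → t → E := fun a b =>
    if hne : (Metric.ball (a : E) (r a) ∩ Metric.ball (b : E) (r b)).Nonempty then hne.some else 0
  refine ⟨t × t → F, inferInstance,
    fun g ab => h g ab.2 (P ab.1 ab.2) * (h g ab.1 (P ab.1 ab.2))⁻¹, fun g g' hg hg' hcode => ?_⟩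
  have hconst : ∀ g, IsFlat g X → ∀ a b : t, ∀ p ∈ Metric.ball (a : E) (r a),
      p ∈ Metric.ball (b : E) (r b) →
      h g b p * (h g a p)⁻¹ = h g b (P a b) * (h g a (P a b))⁻¹ := by
    intro g hg a b p hpa hpb
    have hne : (Metric.ball (a : E) (r a) ∩ Metric.ball (b : E) (r b)).Nonempty := ⟨p, hpa, hpb⟩
    have hP : P a b ∈ Metric.ball (a : E) (r a) ∩ Metric.ball (b : E) (r b) := by
      simp only [P, dif_pos hne]
      exact hne.some_mem
    refine (((convex_ball (a : E) (r a)).inter (convex_ball (b : E) (r b))).isPreconnected).induction₂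
      (fun p q => h g b p * (h g a p)⁻¹ = h g b q * (h g a q)⁻¹) (fun x hx => ?_)
      (fun _ _ _ _ _ _ h h' => h.trans h') (fun _ _ _ _ h => h.symm) ⟨hpa, hpb⟩ hP
    obtain ⟨N, hN, hs⟩ := hh g a hg x hx.1
    obtain ⟨M, hM, hs'⟩ := hh g b hg x hx.2
    filter_upwards [mem_nhdsWithin_of_mem_nhds hN, mem_nhdsWithin_of_mem_nhds hM] with y h1 h2
    have e1 := hs x (mem_of_mem_nhds hN) y h1
    rw [hs' x (mem_of_mem_nhds hM) y h2] at e1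
    have : h g b y = h g b x * ((h g a x)⁻¹ * h g a y) := by rw [← e1]; group
    rw [this]; group
  have hcov : ∀ x ∈ Q, ∃ a : t, x ∈ Metric.ball (a : E) (r a) := by
    intro x hx
    obtain ⟨a, ha, hxa⟩ := mem_iUnion₂.1 (ht hx)
    exact ⟨⟨a, ha⟩, hxa⟩
  rcases Q.eq_empty_or_nonempty with rfl | ⟨x₁, hx₁⟩
  · exact ⟨fun _ => 1, by simp⟩
  have : Nonempty t := ⟨(hcov x₁ hx₁).choose⟩
  choose! A hA using hcov
  refine ⟨fun p => (h g (A p) p)⁻¹ * h g' (A p) p, fun x hx => ?_⟩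
  have key : ∀ p ∈ Q, p ∈ Metric.ball (A x : E) (r (A x)) →
      (h g (A p) p)⁻¹ * h g' (A p) p = (h g (A x) p)⁻¹ * h g' (A x) p := by
    intro p hp hpx
    have e1 := hconst g hg (A x) (A p) p hpx (hA p hp)
    have e2 := hconst g' hg' (A x) (A p) p hpx (hA p hp)
    have e3 := congrFun hcode (A x, A p)
    simp only at e3
    rw [← e1, ← e2] at e3
    have e4 : h g' (A p) p = h g (A p) p * (h g (A x) p)⁻¹ * h g' (A x) p := by rw [e3]; group
    rw [e4]; group
  obtain ⟨N, hN, hs⟩ := hh g (A x) hg x (hA x hx)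
  obtain ⟨M, hM, hs'⟩ := hh g' (A x) hg' x (hA x hx)
  refine ⟨(N ∩ M ∩ Metric.ball (A x : E) (r (A x))) ∩ Q, inter_mem (mem_nhdsWithin_of_mem_nhds
    (inter_mem (inter_mem hN hM) (Metric.isOpen_ball.mem_nhds (hA x hx)))) self_mem_nhdsWithin, ?_⟩
  intro p hp q hq
  simp only [key p hp.2 hp.1.2, key q hq.2 hq.1.2, hs p hp.1.1.1 q hq.1.1.1, hs' p hp.1.1.2 q hq.1.1.2]
  group

end LocalSystem

section InvarianceOfDomain

open Topology Filter Metric MeasureTheory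

variable {E : Type*} [NormedAddCommGroup E] [InnerProductSpace ℝ E]

theorem exists_interpolation_weights (n : ℕ) {t₀ : ℝ} (ht₀ : 0 < t₀) :
    ∃ v w : Fin (n + 1) → ℝ, (∀ i, 0 < v i ∧ v i < t₀) ∧ ∑ i, w i = 1 ∧
      ∀ p : Polynomial ℝ, p.natDegree ≤ n → p.eval 1 = ∑ i, p.eval (v i) * w i := by
  classical
  let v : Fin (n + 1) → ℝ := fun i => t₀ * ((i + 1 : ℝ) / (n + 2))
  have hv : Function.Injective v := by
    intro i j hij
    have h1 : t₀ ≠ 0 := ht₀.ne'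
    have h2 : (n + 2 : ℝ) ≠ 0 := by positivity
    simp only [v] at hij
    field_simp at hij
    exact Fin.ext (by exact_mod_cast add_right_cancel hij)
  refine ⟨v, fun i => (Lagrange.basis Finset.univ v i).eval 1, fun i => ⟨by positivity, ?_⟩, ?_, ?_⟩
  · have hi : (i : ℝ) + 1 ≤ n + 1 := by exact_mod_cast i.2
    have : ((i + 1 : ℝ) / (n + 2)) < 1 := by rw [div_lt_one (by positivity)]; linarith
    simp only [v]
    nlinarith
  · rw [← Polynomial.eval_finsetSum, Lagrange.sum_basis hv.injOn Finset.univ_nonempty,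
      Polynomial.eval_one]
  · intro p hp
    have := Lagrange.eq_interpolate (s := Finset.univ) (f := p) hv.injOn (by
      rw [Finset.card_univ, Fintype.card_fin]
      exact (Polynomial.degree_le_natDegree).trans_lt (by exact_mod_cast Nat.lt_succ_of_le hp))
    conv_lhs => rw [this]
    simp [Lagrange.interpolate_apply, Polynomial.eval_finsetSum]

theorem exists_polynomial_det_one_add_smul [FiniteDimensional ℝ E] (M : E →L[ℝ] E) :
    ∃ p : Polynomial ℝ, p.natDegree ≤ Module.finrank ℝ E ∧
      ∀ t : ℝ, p.eval t = (ContinuousLinearMap.id ℝ E + t • M).det := by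
  classical
  let b := Module.finBasis ℝ E
  let A := LinearMap.toMatrix b b (M : E →ₗ[ℝ] E)
  refine ⟨((Polynomial.X : Polynomial ℝ) • A.map Polynomial.C +
    (1 : Matrix _ _ ℝ).map Polynomial.C).det, ?_, fun t => ?_⟩
  · simpa using Polynomial.natDegree_det_X_add_C_le A 1
  · rw [← Polynomial.coe_evalRingHom, RingHom.map_det, ContinuousLinearMap.det,
      ← LinearMap.det_toMatrix b]
    congr 1
    have : LinearMap.toMatrix b b ((ContinuousLinearMap.id ℝ E + t • M : E →L[ℝ] E) : E →ₗ[ℝ] E) =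
        1 + t • A := by
      rw [← LinearMap.toMatrix_id b, ← map_smul, ← map_add]
      rfl
    rw [this]
    ext i j
    by_cases hij : i = j <;> simp [hij, mul_comm t, add_comm (1 : ℝ)]

theorem exists_lipschitz_extension_of_eq_zero_on_sphere {u : E → E} {R : ℝ} {C : NNReal}
    (hu : LipschitzOnWith C u (closedBall 0 R)) (h0 : ∀ x, ‖x‖ = R → u x = 0) :
    LipschitzWith C (fun x => if ‖x‖ ≤ R then u x else 0) := by
  have key : ∀ x y : E, ‖x‖ ≤ R → ¬ ‖y‖ ≤ R → dist (u x) 0 ≤ C * dist x y := by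
    intro x y hx hy
    have hc : ContinuousOn (fun s : ℝ => ‖AffineMap.lineMap x y s‖) (Icc 0 1) := by
      simp only [AffineMap.lineMap_apply_module]
      fun_prop
    obtain ⟨s, hs, hsR⟩ := intermediate_value_Icc zero_le_one hc
      (show R ∈ Icc _ _ by simpa using ⟨hx, (not_le.1 hy).le⟩)
    set z : E := AffineMap.lineMap x y s
    have h1 := hu.dist_le_mul x (by simpa using hx) z (by simpa using hsR.le)
    rw [h0 z hsR] at h1
    refine h1.trans (mul_le_mul_of_nonneg_left ?_ C.2)
    rw [dist_left_lineMap, Real.norm_of_nonneg hs.1]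
    exact mul_le_of_le_one_left dist_nonneg hs.2
  refine LipschitzWith.of_dist_le_mul fun x y => ?_
  split_ifs with hx hy hy
  · exact hu.dist_le_mul x (by simpa using hx) y (by simpa using hy)
  · exact key x y hx hy
  · rw [dist_comm, dist_comm x]; exact key y x hy hx
  · simpa using by positivity

/-- There is no `C¹` retraction of a closed ball onto its boundary sphere. -/
theorem no_contDiff_retraction [FiniteDimensional ℝ E] [Nontrivial E] {r : E → E} (hr : ContDiff ℝ 1 r) {R : ℝ}
    (hR : 0 < R) (hn : ∀ x, ‖r x‖ = R) (hid : ∀ x, ‖x‖ = R → r x = x) : False := by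
  borelize E
  set B := closedBall (0 : E) R
  have hB : IsCompact B := isCompact_closedBall _ _
  let v : E → E := fun x => r x - x
  have hv : ContDiff ℝ 1 v := hr.sub contDiff_id
  have hvd : Differentiable ℝ v := hv.differentiable one_ne_zero
  have hv' : Continuous (fderiv ℝ v) := hv.continuous_fderiv one_ne_zero
  obtain ⟨C, hC⟩ : ∃ C : NNReal, LipschitzOnWith C v B := by
    obtain ⟨C, hC⟩ := (hB.image hv'.nnnorm).bddAbove
    exact ⟨C, (convex_closedBall _ _).lipschitzOnWith_of_nnnorm_fderiv_le
      (fun x _ => hvd x) (fun x hx => hC ⟨x, hx, rfl⟩)⟩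
  set u : E → E := fun x => if ‖x‖ ≤ R then v x else 0 with hu
  have huL : LipschitzWith C u :=
    exists_lipschitz_extension_of_eq_zero_on_sphere hC (fun x hx => by simp [v, hid x hx])
  let D : ℝ → E → ℝ := fun t x => (ContinuousLinearMap.id ℝ E + t • fderiv ℝ v x).det
  have hDc : Continuous fun z : ℝ × E => D z.1 z.2 :=
    ContinuousLinearMap.continuous_det.comp (by fun_prop)
  obtain ⟨t₁, ht₁, hpos⟩ : ∃ t₁ > 0, ∀ t, 0 < t → t < t₁ → ∀ x ∈ B, 0 < D t x := by
    have : ∀ᶠ t in 𝓝 (0 : ℝ), ∀ x ∈ B, 0 < D t x :=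
      hB.eventually_forall_of_forall_eventually fun x _ =>
        (hDc.tendsto (0, x)).eventually (lt_mem_nhds (by simp [D, ContinuousLinearMap.det]))
    obtain ⟨t₁, ht₁, h⟩ := Metric.eventually_nhds_iff.1 this
    refine ⟨t₁, ht₁, fun t h0 h1 => h ?_⟩
    simpa [abs_of_pos h0] using h1
  set t₀ := min t₁ (1 / (C + 1))
  have ht₀ : 0 < t₀ := lt_min ht₁ (by positivity)
  have hvol : ∀ t, 0 < t → t < t₀ → ∫ x in B, D t x = volume.real B := by
    intro t h0 ht
    have htC : t * C < 1 := by
      have h1 : t < 1 / (C + 1) := ht.trans_le (min_le_right _ _)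
      rw [lt_div_iff₀ (by positivity)] at h1
      nlinarith
    obtain ⟨a, ha⟩ : ∃ a : NNReal, (a : ℝ) = t := ⟨⟨t, h0.le⟩, rfl⟩
    let h : E → E := fun x => x + t • u x
    have hlip : LipschitzWith (a * C) fun x => t • u x := by
      refine LipschitzWith.of_dist_le_mul fun x y => ?_
      rw [dist_smul₀, Real.norm_of_nonneg h0.le]
      have := huL.dist_le_mul x y
      simp only [NNReal.coe_mul, ha]
      rw [mul_assoc]
      gcongr
    have hlt : (a * C) < 1 := by
      rw [← NNReal.coe_lt_coe]; simpa [ha] using htC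
    have hinj : Function.Injective h := by
      intro x y hxy
      have h1 := hlip.dist_le_mul x y
      have h2 : dist (t • u x) (t • u y) = dist x y := by
        rw [dist_comm, dist_eq_norm, dist_eq_norm]
        congr 1
        have h3 : x + t • u x = y + t • u y := hxy
        rw [sub_eq_sub_iff_add_eq_add, add_comm, ← h3]

      rw [h2] at h1
      by_contra hne
      have := dist_pos.2 hne
      have h4 : ((a * C : NNReal) : ℝ) < 1 := by exact_mod_cast hlt
      nlinarith
    have hsurj : Function.Surjective h := by
      intro y
      have hcon : ContractingWith (a * C) fun x => y - t • u x := by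
        refine ⟨hlt, LipschitzWith.of_dist_le_mul fun x z => ?_⟩
        rw [dist_sub_left]
        exact hlip.dist_le_mul x z
      refine ⟨hcon.fixedPoint, ?_⟩
      have := hcon.fixedPoint_isFixedPt
      have h3 : y - t • u hcon.fixedPoint = hcon.fixedPoint := this
      exact (sub_eq_iff_eq_add.1 h3).symm
    have hout : ∀ x, x ∉ B → h x = x := fun x hx => by
      have : ¬ ‖x‖ ≤ R := by simpa [B] using hx
      simp [h, hu, this]
    have himg : h '' B = B := by
      ext y
      constructor
      · rintro ⟨x, hx, rfl⟩
        by_contra hy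
        exact hy ((hinj (hout _ hy)).symm ▸ hx)
      · intro hy
        obtain ⟨x, rfl⟩ := hsurj y
        refine ⟨x, ?_, rfl⟩
        by_contra hx
        exact hx (hout x hx ▸ hy)
    have hder : ∀ x ∈ B, HasFDerivWithinAt h (ContinuousLinearMap.id ℝ E + t • fderiv ℝ v x) B x := by
      intro x hx
      have h1 : HasFDerivWithinAt (fun x => x + t • v x)
          (ContinuousLinearMap.id ℝ E + t • fderiv ℝ v x) B x :=
        ((hasFDerivAt_id x).add ((hvd x).hasFDerivAt.const_smul t)).hasFDerivWithinAt
      refine h1.congr (fun y hy => ?_) ?_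
      · have : ‖y‖ ≤ R := by simpa [B] using hy
        simp [h, hu, this]
      · have : ‖x‖ ≤ R := by simpa [B] using hx
        simp [h, hu, this]
    have := integral_image_eq_integral_abs_det_fderiv_smul volume isClosed_closedBall.measurableSet
      hder hinj.injOn (fun _ => (1 : ℝ))
    rw [himg] at this
    simp only [smul_eq_mul, mul_one, integral_const, MeasurableSet.univ, measureReal_restrict_apply,
      univ_inter] at this
    rw [this]
    refine setIntegral_congr_fun isClosed_closedBall.measurableSet fun x hx => ?_
    exact (abs_of_pos (hpos t h0 (ht.trans_le (min_le_left _ _)) x hx)).symm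
  obtain ⟨τ, w, hτ, hw, hp⟩ := exists_interpolation_weights (Module.finrank ℝ E) ht₀
  have h1 : ∫ x in B, D 1 x = volume.real B := by
    have : ∀ x, D 1 x = ∑ i, D (τ i) x * w i := by
      intro x
      obtain ⟨p, hpd, hpe⟩ := exists_polynomial_det_one_add_smul (fderiv ℝ v x)
      have := hp p hpd
      simpa only [hpe] using this
    simp only [this]
    rw [integral_finsetSum]
    · simp only [integral_mul_const]
      rw [Finset.sum_congr rfl fun i _ => by rw [hvol (τ i) (hτ i).1 (hτ i).2], ← Finset.mul_sum,
        hw, mul_one]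
    · intro i _
      have : Continuous fun x => D (τ i) x * w i :=
        (hDc.comp (by fun_prop : Continuous fun x : E => (τ i, x))).mul_const _
      exact this.continuousOn.integrableOn_compact hB
  have h2 : ∀ x, D 1 x = 0 := by
    intro x
    have hrd : HasFDerivAt r (fderiv ℝ r x) x := (hr.differentiable one_ne_zero x).hasFDerivAt
    have hfd : ContinuousLinearMap.id ℝ E + (1 : ℝ) • fderiv ℝ v x = fderiv ℝ r x := by
      have : HasFDerivAt v (fderiv ℝ r x - ContinuousLinearMap.id ℝ E) x := hrd.sub (hasFDerivAt_id x)
      rw [this.fderiv]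
      simp
    by_contra hne
    simp only [D, hfd] at hne
    let e := ContinuousLinearMap.toContinuousLinearEquivOfDetNeZero _ hne
    have hsq := hrd.norm_sq
    have hcst : HasFDerivAt (fun x => ‖r x‖ ^ 2) (0 : E →L[ℝ] ℝ) x := by
      simp only [hn]
      exact hasFDerivAt_const _ _
    have h3 := congrArg (fun L : E →L[ℝ] ℝ => L (e.symm (r x))) (hsq.unique hcst)
    have h4 : fderiv ℝ r x (e.symm (r x)) = r x := e.apply_symm_apply (r x)
    simp [h4, hn, hR.ne'] at h3
  have h3 : volume.real B = 0 := by
    rw [← h1]; simp [h2]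
  have h4 : 0 < volume.real B :=
    ENNReal.toReal_pos (measure_closedBall_pos _ _ hR).ne' hB.measure_lt_top.ne
  exact h4.ne' h3

end InvarianceOfDomain

section InvarianceOfDomain

open Topology Filter Metric MeasureTheory

variable {E : Type*} [NormedAddCommGroup E] [InnerProductSpace ℝ E]

theorem radialRetraction_continuous :
    Continuous fun x : E => (max 1 ‖x‖)⁻¹ • x := by
  have : ∀ x : E, max 1 ‖x‖ ≠ 0 := fun x => (zero_lt_one.trans_le (le_max_left _ _)).ne'
  fun_prop (disch := exact this _)

/-- A map of the closed unit ball which is close to the identity has a zero. -/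
theorem exists_zero_of_norm_sub_le [FiniteDimensional ℝ E] [Nontrivial E] {H : E → E}
    (hH : ContinuousOn H (closedBall 0 1)) (hd : ∀ x ∈ closedBall 0 1, ‖H x - x‖ ≤ 1 / 2) :
    ∃ x ∈ closedBall 0 1, H x = 0 := by
  by_contra! hne
  have hcpt : IsCompact (closedBall (0 : E) 1) := isCompact_closedBall _ _
  obtain ⟨c, hc, hcH⟩ : ∃ c > 0, ∀ x ∈ closedBall (0 : E) 1, c ≤ ‖H x‖ := by
    obtain ⟨x, hx, h⟩ := hcpt.exists_isMinOn ⟨0, by simp⟩ hH.norm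
    exact ⟨‖H x‖, norm_pos_iff.2 (hne x hx), fun y hy => h hy⟩
  let π : E → E := fun x => (max 1 ‖x‖)⁻¹ • x
  have hπ : ∀ x, π x ∈ closedBall (0 : E) 1 := fun x => by
    have h1 : 0 < max 1 ‖x‖ := zero_lt_one.trans_le (le_max_left _ _)
    simp only [π, mem_closedBall_zero_iff, norm_smul, norm_inv, Real.norm_of_nonneg h1.le]
    rw [inv_mul_le_one₀ h1]
    exact le_max_right _ _
  have hπd : ∀ x, 1 ≤ ‖x‖ → ‖π x - x‖ = ‖x‖ - 1 := fun x hx => by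
    have h0 : 0 < ‖x‖ := by linarith
    have : π x - x = (‖x‖⁻¹ - 1) • x := by simp only [π, max_eq_right hx]; module
    have h1 : ‖x‖⁻¹ - 1 ≤ 0 := by linarith [inv_le_one_of_one_le₀ hx]
    rw [this, norm_smul, Real.norm_of_nonpos h1]
    field_simp
    ring
  have hπ1 : ∀ x ∈ closedBall (0 : E) 1, π x = x := fun x hx => by
    simp only [π, max_eq_left (mem_closedBall_zero_iff.1 hx), inv_one, one_smul]
  obtain ⟨G, hG, hGd, -⟩ := (hH.comp_continuous radialRetraction_continuous hπ).exists_contDiff_approx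
    (ε := fun _ => min (c / 2) (1 / 4)) 1 continuous_const (fun _ => by positivity)
  have hGc : ∀ x, ‖G x - H (π x)‖ < c / 2 := fun x => by
    rw [← dist_eq_norm]; exact (hGd x).trans_le (min_le_left _ _)
  have hG4 : ∀ x, ‖G x - H (π x)‖ < 1 / 4 := fun x => by
    rw [← dist_eq_norm]; exact (hGd x).trans_le (min_le_right _ _)
  let χ : ContDiffBump (0 : E) := ⟨1, 2, one_pos, one_lt_two⟩
  let K : E → E := fun x => x + χ x • (G x - x)
  have hK : ContDiff ℝ 1 K := contDiff_id.add (χ.contDiff.smul (hG.sub contDiff_id))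
  have hK0 : ∀ x, K x ≠ 0 := by
    intro x h0
    rcases le_total ‖x‖ 1 with hx | hx
    · have hx' : x ∈ closedBall (0 : E) 1 := mem_closedBall_zero_iff.2 hx
      have h1 : χ x = 1 := χ.one_of_mem_closedBall hx'
      simp only [K, h1, one_smul, add_sub_cancel] at h0
      have h2 := hGc x
      rw [h0, hπ1 x hx', zero_sub, norm_neg] at h2
      linarith [hcH x hx']
    · have h1 : ‖G x - x‖ < ‖x‖ := by
        have h2 : G x - x = (G x - H (π x)) + ((H (π x) - π x) + (π x - x)) := by abel
        have h3 := norm_add_le (G x - H (π x)) ((H (π x) - π x) + (π x - x))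
        have h4 := norm_add_le (H (π x) - π x) (π x - x)
        rw [h2]
        linarith [hG4 x, hd _ (hπ x), hπd x hx]
      have h2 : x = -(χ x • (G x - x)) := eq_neg_of_add_eq_zero_left h0
      have h3 : ‖x‖ ≤ ‖G x - x‖ := by
        calc ‖x‖ = ‖χ x • (G x - x)‖ := by conv_lhs => rw [h2, norm_neg]
          _ = χ x * ‖G x - x‖ := by rw [norm_smul, Real.norm_of_nonneg χ.nonneg]
          _ ≤ ‖G x - x‖ := mul_le_of_le_one_left (norm_nonneg _) χ.le_one
      linarith
  have hKn : ∀ x, ‖K x‖ ≠ 0 := fun x => norm_ne_zero_iff.2 (hK0 x)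
  refine no_contDiff_retraction (r := fun x => (2 * ‖K x‖⁻¹) • K x) (R := 2)
    ((contDiff_const.mul ((hK.norm ℝ hK0).inv hKn)).smul hK) two_pos (fun x => ?_) (fun x hx => ?_)
  · rw [norm_smul, norm_mul, norm_inv, norm_norm, Real.norm_of_nonneg two_pos.le, mul_assoc,
      inv_mul_cancel₀ (hKn x), mul_one]
  · have h1 : χ x = 0 := χ.zero_of_le_dist (by simp [χ, hx])
    have h2 : K x = x := by simp [K, h1]
    simp only [h2, hx]
    norm_num

theorem image_closedBall_mem_nhds [FiniteDimensional ℝ E] [Nontrivial E] {f : E → E}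
    (hf : ContinuousOn f (closedBall 0 1)) (hi : InjOn f (closedBall 0 1)) :
    f '' closedBall 0 1 ∈ 𝓝 (f 0) := by
  borelize E
  set B := closedBall (0 : E) 1
  have hB : IsCompact B := isCompact_closedBall _ _
  set K := f '' B
  have hK : IsCompact K := hB.image_of_continuousOn hf
  by_contra hnot
  obtain ⟨G, hG, hGf⟩ : ∃ G : E → E, Continuous G ∧ ∀ x ∈ B, G (f x) = x := by
    have : CompactSpace B := isCompact_iff_compactSpace.1 hB
    have he : IsClosedEmbedding (B.domRestrict f) :=
      (continuousOn_iff_continuous_domRestrict.1 hf).isClosedEmbedding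
        (injOn_iff_injective.1 hi)
    obtain ⟨G, hG⟩ := ContinuousMap.exists_extension he ⟨Subtype.val, continuous_subtype_val⟩
    exact ⟨G, G.continuous, fun x hx => congrArg (fun k => k ⟨x, hx⟩) hG⟩
  have h0B : (0 : E) ∈ B := by simp [B]
  obtain ⟨δ, hδ, hGδ⟩ : ∃ δ > 0, ∀ y ∈ ball (f 0) δ, ‖G y‖ < 1 / 10 := by
    have : ∀ᶠ y in 𝓝 (f 0), ‖G y‖ < 1 / 10 :=
      hG.norm.continuousAt.eventually (gt_mem_nhds (by simp [hGf 0 h0B]))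
    exact Metric.eventually_nhds_iff_ball.1 this
  set ε := δ / 2 with hε
  have hε0 : 0 < ε := by positivity
  obtain ⟨c, hcε, hcK⟩ : ∃ c, dist c (f 0) < ε ∧ c ∉ K := by
    by_contra! h
    exact hnot (mem_of_superset (ball_mem_nhds _ hε0) fun y hy => h y hy)
  have hnear : ∀ y, dist y c ≤ ε → ‖G y‖ < 1 / 10 := fun y hy => hGδ y (by
    rw [mem_ball]
    linarith [dist_triangle y c (f 0)])
  have hcy : ∀ y ∈ K, 0 < ‖y - c‖ := fun y hy =>
    norm_pos_iff.2 (sub_ne_zero.2 fun h => hcK (h ▸ hy))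
  let Φ : E → E := fun y => c + max (ε / ‖y - c‖) 1 • (y - c)
  have hΦ : ContinuousOn Φ K := by
    have : ∀ y ∈ K, ‖y - c‖ ≠ 0 := fun y hy => (hcy y hy).ne'
    fun_prop (disch := assumption)
  set S₁ := K ∩ {y | ε ≤ dist y c}
  have hS₁ : IsCompact S₁ := hK.inter_right (isClosed_le continuous_const (by fun_prop))
  have hG1 : ∀ y ∈ S₁, G y ≠ 0 := by
    rintro _ ⟨⟨x, hx, rfl⟩, hy⟩ h
    rw [hGf x hx] at h
    subst h
    rw [dist_comm] at hcε
    exact absurd hy (not_le.2 hcε)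
  obtain ⟨η, hη, hη1, hηG⟩ : ∃ η > 0, η ≤ 1 / 10 ∧ ∀ y ∈ S₁, 2 * η ≤ ‖G y‖ := by
    rcases S₁.eq_empty_or_nonempty with h | h
    · exact ⟨1 / 10, by norm_num, le_rfl, by simp [h]⟩
    · obtain ⟨y, hy, hmin⟩ := hS₁.exists_isMinOn h hG.norm.continuousOn
      have := norm_pos_iff.2 (hG1 y hy)
      refine ⟨min (1 / 10) (‖G y‖ / 2), by positivity, min_le_left _ _, fun z hz => ?_⟩
      have h1 : ‖G y‖ ≤ ‖G z‖ := hmin hz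
      linarith [min_le_right (1 / 10) (‖G y‖ / 2)]
  obtain ⟨P, hP, hPG, -⟩ := hG.exists_contDiff_approx (ε := fun _ => η) 1 continuous_const
    (fun _ => hη)
  have hnull : volume (P '' sphere c ε) = 0 :=
    addHaar_image_eq_zero_of_differentiableOn_of_addHaar_eq_zero volume
      (hP.differentiable one_ne_zero).differentiableOn (Measure.addHaar_sphere _ _ _)
  obtain ⟨v, hv, hvP⟩ : ∃ v : E, ‖v‖ < η ∧ v ∉ P '' sphere c ε := by
    by_contra! h
    have h1 : ball (0 : E) η ⊆ P '' sphere c ε := fun v hv => h v (by simpa using hv)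
    exact (measure_ball_pos volume (0 : E) hη).ne' (measure_mono_null h1 hnull)
  have hPd : ∀ y, ‖P y - v - G y‖ < 2 * η := fun y => by
    have h1 := hPG y
    rw [dist_eq_norm] at h1
    have h2 := norm_sub_le (P y - G y) v
    rw [show P y - v - G y = P y - G y - v by abel]
    linarith
  have hd : ∀ x ∈ B, ‖P (Φ (f x)) - v - x‖ ≤ 1 / 2 := by
    intro x hx
    have hy : f x ∈ K := mem_image_of_mem f hx
    have hpos := hcy _ hy
    have h3 := hPd (Φ (f x))
    rcases le_total ε ‖f x - c‖ with h | h
    · have h1 : Φ (f x) = f x := by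
        simp only [Φ, max_eq_right ((div_le_one hpos).2 h), one_smul, add_sub_cancel]
      rw [h1, hGf x hx] at h3
      simp only [h1]
      linarith
    · have h1 : dist (Φ (f x)) c = ε := by
        simp only [Φ, max_eq_left ((one_le_div hpos).2 h), dist_eq_norm,
          add_sub_cancel_left, norm_smul, norm_div, norm_norm, Real.norm_of_nonneg hε0.le]
        field_simp
      have h4 := hnear _ h1.le
      have h5 := hnear (f x) (by simpa [dist_eq_norm] using h)
      rw [hGf x hx] at h5
      have h6 := norm_add_le (P (Φ (f x)) - v - G (Φ (f x))) (G (Φ (f x)) - x)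
      have h7 := norm_sub_le (G (Φ (f x))) x
      rw [sub_add_sub_cancel] at h6
      linarith
  obtain ⟨x, hx, hx0⟩ := exists_zero_of_norm_sub_le (H := fun x => P (Φ (f x)) - v)
    ((hP.continuous.comp_continuousOn (hΦ.comp hf (mapsTo_image f B))).sub continuousOn_const)
    hd
  have hy : f x ∈ K := mem_image_of_mem f hx
  have hpos := hcy _ hy
  rcases le_total ε ‖f x - c‖ with h | h
  · have h1 : Φ (f x) = f x := by
      simp only [Φ, max_eq_right ((div_le_one hpos).2 h), one_smul, add_sub_cancel]
    simp only [h1] at hx0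
    have h2 := hPd (f x)
    rw [hx0, zero_sub, norm_neg] at h2
    exact absurd (hηG _ ⟨hy, by simpa [dist_eq_norm] using h⟩) (not_le.2 h2)
  · refine hvP ⟨Φ (f x), ?_, sub_eq_zero.1 hx0⟩
    simp only [Φ, max_eq_left ((one_le_div hpos).2 h), mem_sphere, dist_eq_norm,
      add_sub_cancel_left, norm_smul, norm_div, norm_norm, Real.norm_of_nonneg hε0.le]
    field_simp

/-- Invariance of domain. -/
theorem isOpen_image_of_continuousOn_injOn [FiniteDimensional ℝ E] [Nontrivial E] {U : Set E}
    (hU : IsOpen U) {φ : E → E} (hc : ContinuousOn φ U) (hi : InjOn φ U) : IsOpen (φ '' U) := by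
  rw [isOpen_iff_mem_nhds]
  rintro _ ⟨x, hx, rfl⟩
  obtain ⟨r, hr, hrU⟩ := nhds_basis_closedBall.mem_iff.1 (hU.mem_nhds hx)
  let a : E → E := fun y => x + r • y
  have ha : MapsTo a (closedBall 0 1) U := fun y hy => hrU (by
    simp only [a, mem_closedBall, dist_self_add_left, norm_smul, Real.norm_of_nonneg hr.le]
    exact mul_le_of_le_one_right hr.le (by simpa using hy))
  have h := image_closedBall_mem_nhds (f := φ ∘ a) (hc.comp (by fun_prop) ha)
    (hi.comp (fun y _ z _ hyz => smul_right_injective E hr.ne' (add_left_cancel hyz)) ha)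
  have h0 : (φ ∘ a) 0 = φ x := by simp [a]
  rw [h0, image_comp] at h
  exact mem_of_superset h (image_mono ha.image_subset)

end InvarianceOfDomain

section Obstruction

open Topology Filter Metric

open unitInterval in
theorem isTriv_of_flatEquiv_annulus {F : Type} [Group F] {T : Type} [TopologicalSpace T]
    [CompactSpace T] {S U : Set R3} (hS : IsCompact S) {ε : ℝ} (hε : 0 < ε)
    (hεU : cthickening ε S ⊆ U) {φ : R3 → R3} (hφ : ContinuousOn φ U) (hi : InjOn φ U)
    (hφS : φ '' S = S) {g g' : R3 → R3 → F} (hg : IsFlat g Sᶜ) (hg' : IsFlat g' Sᶜ)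
    (e : FlatEquiv (pull φ g) (pull φ g') (cthickening ε S \ thickening (ε / 2) S))
    {m : T × I → R3} (hm : Continuous m) (hm0 : ∀ x, m (x, 0) ∈ S)
    (hmS : ∀ x s, s ≠ 0 → m (x, s) ∉ S) (hm1 : ∀ x, m (x, 1) ∉ φ '' cthickening ε S)
    (ht : ∀ s, s ≠ 0 → IsTriv (pull (fun x => m (x, s)) g') univ) :
    IsTriv (pull (fun x => m (x, 1)) g) univ := by
  classical
  obtain ⟨h, hh⟩ := e
  have hopen : ∀ W : Set R3, IsOpen W → W ⊆ cthickening ε S → IsOpen (φ '' W) := fun W hW hWS =>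
    isOpen_image_of_continuousOn_injOn hW (hφ.mono (hWS.trans hεU)) (hi.mono (hWS.trans hεU))
  set N₁ := cthickening (3 * ε / 4) S with hN₁
  have hN₁ε : N₁ ⊆ cthickening ε S := cthickening_mono (by linarith) _
  set K := φ '' N₁ with hK
  have hKc : IsClosed K :=
    (hS.cthickening.image_of_continuousOn (hφ.mono (hN₁ε.trans hεU))).isClosed
  set W₁ := thickening (3 * ε / 4) S
  have hW₁ : W₁ ⊆ N₁ := thickening_subset_cthickening _ _
  have hW₁o : IsOpen (φ '' W₁) := hopen _ isOpen_thickening (hW₁.trans hN₁ε)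
  have hSW₁ : S ⊆ φ '' W₁ := by
    have : φ '' S ⊆ φ '' W₁ := image_mono (self_subset_thickening (by positivity) S)
    rwa [hφS] at this
  let k : R3 → F := fun y => h (Function.invFunOn φ U y)
  have hkφ : ∀ x ∈ U, k (φ x) = h x := fun x hx => by
    simp only [k, hi.leftInvOn_invFunOn hx]
  let η : R3 → R3 → F := fun p q => if p ∈ K ∨ q ∈ K then k p * g' p q * (k q)⁻¹ else g p q
  have hη : IsFlat η Sᶜ := by
    intro y hy
    have hSo : IsOpen Sᶜ := hS.isClosed.isOpen_compl
    rw [hSo.nhdsWithin_eq hy]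
    have hgy := hg y hy
    have hgy' := hg' y hy
    rw [hSo.nhdsWithin_eq hy] at hgy hgy'
    obtain ⟨N, hN, s, hs⟩ := hgy
    obtain ⟨N', hN', s', hs'⟩ := hgy'
    by_cases hyK : y ∈ K
    · obtain ⟨x, hx, rfl⟩ := hyK
      by_cases hx2 : x ∈ cthickening (ε / 2) S
      · have hxW : x ∈ W₁ := cthickening_subset_thickening' (by positivity) (by linarith) _ hx2
        refine ⟨N' ∩ φ '' W₁, inter_mem hN' (hW₁o.mem_nhds ⟨x, hxW, rfl⟩),
          fun p => s' p * (k p)⁻¹, fun p hp q hq => ?_⟩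
        have hpK : p ∈ K := image_mono hW₁ hp.2
        simp only [η, if_pos (Or.inl hpK), hs' p hp.1 q hq.1]
        group
      · set W := thickening ε S \ cthickening (ε / 2) S
        have hWo : IsOpen W := isOpen_thickening.sdiff isClosed_cthickening
        have hWQ : W ⊆ cthickening ε S \ thickening (ε / 2) S :=
          sdiff_subset_sdiff (thickening_subset_cthickening _ _) (thickening_subset_cthickening _ _)
        have hxW : x ∈ W := ⟨cthickening_subset_thickening' hε (by linarith) _ hx, hx2⟩
        obtain ⟨M, hM, hMe⟩ := hh x (hWQ hxW)
        have hM' : M ∈ 𝓝 x := by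
          rw [← hWo.nhdsWithin_eq hxW]
          exact nhdsWithin_mono _ hWQ hM
        obtain ⟨M', hM'M, hM'o, hxM'⟩ := _root_.mem_nhds_iff.1 (inter_mem hM' (hWo.mem_nhds hxW))
        have hM'N : M' ⊆ cthickening ε S :=
          (hM'M.trans inter_subset_right).trans (hWQ.trans sdiff_subset)
        refine ⟨N ∩ φ '' M', inter_mem hN ((hopen _ hM'o hM'N).mem_nhds ⟨x, hxM', rfl⟩), s, ?_⟩
        rintro _ ⟨hpN, p, hp, rfl⟩ _ ⟨hqN, q, hq, rfl⟩
        rw [← hs _ hpN _ hqN]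
        simp only [η]
        split_ifs
        · have := hMe p (hM'M hp).1 q (hM'M hq).1
          simp only [pull] at this
          rw [this, hkφ p (hεU (hM'N hp)), hkφ q (hεU (hM'N hq))]
          group
        · rfl
    · refine ⟨N ∩ Kᶜ, inter_mem hN (hKc.isOpen_compl.mem_nhds hyK), s, fun p hp q hq => ?_⟩
      rw [← hs p hp.1 q hq.1]
      exact if_neg (not_or.2 ⟨hp.2, hq.2⟩)
  obtain ⟨δ, hδ0, hδ⟩ : ∃ δ : I, δ ≠ 0 ∧ ∀ x, m (x, δ) ∈ φ '' W₁ := by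
    have h1 : ∀ᶠ s in 𝓝 (0 : I), ∀ x ∈ (univ : Set T), m (x, s) ∈ φ '' W₁ := by
      refine isCompact_univ.eventually_forall_of_forall_eventually fun x _ => ?_
      have : ContinuousAt (fun z : I × T => m (z.2, z.1)) (0, x) := by fun_prop
      exact this (hW₁o.mem_nhds (hSW₁ (hm0 x)))
    have h2 : ∃ᶠ s in 𝓝 (0 : I), s ≠ 0 := by
      have : (𝓝[≠] (0 : I)).NeBot := inferInstance
      exact frequently_iff_neBot.2 this
    obtain ⟨s, hs, hs'⟩ := (h2.and_eventually h1).exists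
    exact ⟨s, hs, fun x => hs' x trivial⟩
  have hmax : ∀ t : I, max δ t ≠ 0 := fun t ht =>
    hδ0 (le_antisymm (ht ▸ le_max_left δ t) nonneg')
  have key := flatEquiv_of_homotopy (hη.pull (φ := fun z : T × I => m (z.1, max δ z.2))
    (Y := univ) (by fun_prop) (fun z _ => hmS _ _ (hmax z.2)))
  have h1 : pull (fun x : T => (x, (1 : I))) (pull (fun z : T × I => m (z.1, max δ z.2)) η) =
      pull (fun x => m (x, 1)) g := by
    funext x y
    have h2 : ∀ x, m (x, 1) ∉ K := fun x hx => hm1 x (image_mono hN₁ε hx)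
    simp only [pull, max_eq_right (show δ ≤ 1 from le_one'), η]
    exact if_neg (not_or.2 ⟨h2 x, h2 y⟩)
  rw [← h1]
  refine key.isTriv ?_
  obtain ⟨u, hu⟩ := ht δ hδ0
  refine ⟨fun x => u x * (k (m (x, δ)))⁻¹, fun x hx => ?_⟩
  obtain ⟨N, hN, hs⟩ := hu x hx
  refine ⟨N, hN, fun p hp q hq => ?_⟩
  have := hs p hp q hq
  simp only [pull] at this
  simp only [pull, max_eq_left (show 0 ≤ δ from nonneg'), η,
    if_pos (Or.inl (image_mono hW₁ (hδ p)) : m (p, δ) ∈ K ∨ m (q, δ) ∈ K), this]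
  group

theorem imgIter_of_invariant {U : Set R3} {f : U → U} {S : Set R3} (hSU : S ⊆ U)
    (h : imgIter f 1 S = S) (n : ℕ) : imgIter f n S = S := by
  induction n with
  | zero => simp [imgIter, Subtype.image_preimage_coe, inter_eq_right.2 hSU]
  | succ n ih =>
    have h' : f '' (Subtype.val ⁻¹' S) = Subtype.val ⁻¹' S := by
      apply Subtype.val_injective.image_injective
      rw [Subtype.image_preimage_coe, inter_eq_right.2 hSU]
      simpa [imgIter] using h
    rw [imgIter, Function.iterate_succ, image_comp, h']
    exact ih

open unitInterval in
theorem not_isAttractor_of_cocycles {F : Type} [Group F] [Finite F] {T : Type}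
    [TopologicalSpace T] [CompactSpace T] {S : Set R3} {g : ℕ → R3 → R3 → F}
    (hg : ∀ n, IsFlat (g n) Sᶜ) {m : ℕ → T × I → R3} (hm : ∀ n, Continuous (m n))
    (hm0 : ∀ n x, m n (x, 0) ∈ S) (hmS : ∀ n x s, s ≠ 0 → m n (x, s) ∉ S)
    (hnt : ∀ n, ¬ IsTriv (pull (fun x => m n (x, 1)) (g n)) univ)
    (ht : ∀ i j, i < j → ∀ s, s ≠ 0 → IsTriv (pull (fun x => m i (x, s)) (g j)) univ)
    {U : Set R3} (hU : IsOpen U) {f : U → U} (hf : Continuous f) (hfi : Function.Injective f) :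
    ¬ IsAttractor f S := by
  classical
  rintro ⟨hS, hSU, hinv, A, hAU, hSA, hA⟩
  obtain ⟨ε, hε, hεA⟩ := hS.exists_cthickening_subset_open isOpen_interior hSA
  have hεU : cthickening ε S ⊆ U := (hεA.trans interior_subset).trans hAU
  set Q := cthickening ε S \ thickening (ε / 2) S
  have hQ : IsCompact Q := hS.cthickening.diff isOpen_thickening
  have hQX : Q ⊆ U \ S := fun x hx =>
    ⟨hεU hx.1, fun h => hx.2 (self_subset_thickening (by positivity) S h)⟩
  obtain ⟨D, _, code, hcode⟩ := exists_finite_code (F := F) (hU.sdiff hS.isClosed) hQ hQX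
  have := Fintype.ofFinite D
  set L := Fintype.card D + 1
  set V : Set R3 := (⋃ i : Fin L, range fun x => m i (x, 1))ᶜ
  have hVo : IsOpen V := (isClosed_iUnion_of_finite fun i : Fin L =>
    (isCompact_range (f := fun x => m i (x, 1)) (by have := hm i; fun_prop)).isClosed).isOpen_compl
  have hSV : S ⊆ V := by
    intro x hx hx'
    obtain ⟨i, y, rfl⟩ := mem_iUnion.1 hx'
    exact hmS i y 1 one_ne_zero hx
  obtain ⟨n, hn⟩ := hA _ hS.cthickening (hεA.trans interior_subset) V (by rwa [hVo.interior_eq])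
  specialize hn n le_rfl
  let φ : R3 → R3 := fun x => if hx : x ∈ U then (f^[n] ⟨x, hx⟩ : R3) else 0
  have hφv : ∀ x : U, φ x = f^[n] x := fun x => dif_pos x.2
  have hφ : ContinuousOn φ U := by
    rw [continuousOn_iff_continuous_domRestrict]
    have : U.domRestrict φ = fun x => (f^[n] x : R3) := funext hφv
    rw [this]
    exact continuous_subtype_val.comp (hf.iterate n)
  have hi : InjOn φ U := fun x hx y hy hxy => by
    have := hφv ⟨x, hx⟩ ▸ hφv ⟨y, hy⟩ ▸ hxy
    exact congrArg Subtype.val (hfi.iterate n (Subtype.val_injective this))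
  have himg : ∀ P ⊆ U, φ '' P = imgIter f n P := by
    intro P hP
    ext y
    constructor
    · rintro ⟨x, hx, rfl⟩
      exact ⟨_, ⟨⟨x, hP hx⟩, hx, rfl⟩, (hφv ⟨x, hP hx⟩).symm⟩
    · rintro ⟨_, ⟨x, hx, rfl⟩, rfl⟩
      exact ⟨x, hx, hφv x⟩
  have hφS : φ '' S = S := by rw [himg S hSU, imgIter_of_invariant hSU hinv n]
  have hmaps : MapsTo φ (U \ S) Sᶜ := by
    intro x hx hxS
    rw [← hφS] at hxS
    obtain ⟨y, hy, hyx⟩ := hxS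
    exact hx.2 (hi (hSU hy) hx.1 hyx ▸ hy)
  have hflat : ∀ i, IsFlat (pull φ (g i)) (U \ S) := fun i =>
    (hg i).pull (hφ.mono sdiff_subset) hmaps
  obtain ⟨i, j, hij, hc⟩ := Fintype.exists_ne_map_eq_of_card_lt
    (fun i : Fin L => code (pull φ (g i))) (by simp [L])
  obtain ⟨i, j, hij, hc⟩ : ∃ i j : Fin L, i < j ∧ code (pull φ (g i)) = code (pull φ (g j)) := by
    rcases lt_or_gt_of_ne hij with h | h
    · exact ⟨i, j, h, hc⟩
    · exact ⟨j, i, h, hc.symm⟩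
  refine hnt i (isTriv_of_flatEquiv_annulus hS hε hεU hφ hi hφS (hg i) (hg j)
    (hcode _ _ (hflat i) (hflat j) hc) (hm i) (hm0 i) (hmS i) (fun x hx => ?_) (ht i j hij))
  rw [himg _ hεU] at hx
  exact hn hx (mem_iUnion.2 ⟨i, x, rfl⟩)

end Obstruction

section HornGeometry

open Topology Filter

/-- Coordinate 3-space with the sup norm. -/
abbrev V3 := ℝ × ℝ × ℝ

/-- The affine contraction carrying the box onto the small box at the tip of a pair of horns. -/
def tipMap (p : V3) : V3 := (12 - p.2.2 / 10, -4 + p.1 / 10, p.2.1 / 20)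

/-- The inverse of `tipMap`. -/
def tipInv (p : V3) : V3 := (10 * (p.2.1 + 4), 20 * p.2.2, -10 * (p.1 - 12))

/-- The symmetry of the box exchanging its two clasped halves. -/
def flip3 (p : V3) : V3 := (-p.1, p.2.2, p.2.1)

/-- The box. -/
def box : Set V3 := {p | -20 ≤ p.1 ∧ p.1 ≤ 20 ∧ -20 ≤ p.2.1 ∧ p.2.1 ≤ 20 ∧ -20 ≤ p.2.2 ∧ p.2.2 ≤ 20}

/-- The face of the box carrying the horns. -/
def face : Set V3 := {p | p.1 = -20 ∧ -20 ≤ p.2.1 ∧ p.2.1 ≤ 20 ∧ -20 ≤ p.2.2 ∧ p.2.2 ≤ 20}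

/-- The first solid horn. -/
def horn₀ : Set V3 := {p | -20 ≤ p.1 ∧ p.2.1 ≤ -6 ∧ 15 / 2 ≤ (-6 - p.2.1) + (p.1 + 20) / 4 ∧
  (-6 - p.2.1) + (p.1 + 20) / 4 ≤ 17 / 2 ∧ -1 ≤ p.2.2 ∧ p.2.2 ≤ 1}

/-- The second solid horn. -/
def horn₁ : Set V3 := {p | -20 ≤ p.1 ∧ -2 ≤ p.2.1 ∧ 15 ≤ (p.2.1 + 2) + (p.1 + 20) / 2 ∧
  (p.2.1 + 2) + (p.1 + 20) / 2 ≤ 17 ∧ -1 ≤ p.2.2 ∧ p.2.2 ≤ 1}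

/-- The union of the two solid horns. -/
def horns : Set V3 := horn₀ ∪ horn₁

/-- The stages of the construction of the obstacle inside the box. -/
def stage : ℕ → Set V3
  | 0 => box
  | n + 1 => face ∪ flip3 ⁻¹' face ∪ (horns ∪ flip3 ⁻¹' horns) ∪
      (tipInv ⁻¹' stage n ∪ (fun p => tipInv (flip3 p)) ⁻¹' stage n)

theorem tipMap_tipInv (p : V3) : tipMap (tipInv p) = p := by
  simp only [tipMap, tipInv]
  ext <;> dsimp only <;> ring

theorem tipInv_tipMap (p : V3) : tipInv (tipMap p) = p := by
  simp only [tipMap, tipInv]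
  ext <;> dsimp only <;> ring

theorem flip3_flip3 (p : V3) : flip3 (flip3 p) = p := by
  simp [flip3]

theorem continuous_tipMap : Continuous tipMap := by unfold tipMap; fun_prop

theorem continuous_tipInv : Continuous tipInv := by unfold tipInv; fun_prop

theorem continuous_flip3 : Continuous flip3 := by unfold flip3; fun_prop

theorem isClosed_box : IsClosed box := by
  simp only [box, ofPred_and]
  repeat' apply IsClosed.inter
  all_goals exact isClosed_le (by fun_prop) (by fun_prop)

theorem isClosed_face : IsClosed face := by
  simp only [face, ofPred_and]
  refine (isClosed_eq (by fun_prop) (by fun_prop)).inter ?_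
  repeat' apply IsClosed.inter
  all_goals exact isClosed_le (by fun_prop) (by fun_prop)

theorem isClosed_horns : IsClosed horns := by
  refine IsClosed.union ?_ ?_
  · simp only [horn₀, ofPred_and]
    repeat' apply IsClosed.inter
    all_goals exact isClosed_le (by fun_prop) (by fun_prop)
  · simp only [horn₁, ofPred_and]
    repeat' apply IsClosed.inter
    all_goals exact isClosed_le (by fun_prop) (by fun_prop)

theorem isClosed_stage (n : ℕ) : IsClosed (stage n) := by
  induction n with
  | zero => exact isClosed_box
  | succ n ih =>
    exact ((isClosed_face.union (isClosed_face.preimage continuous_flip3)).union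
      (isClosed_horns.union (isClosed_horns.preimage continuous_flip3))).union
      ((ih.preimage continuous_tipInv).union
        (ih.preimage (continuous_tipInv.comp continuous_flip3)))

theorem mem_stage_succ {n : ℕ} {p : V3} : p ∈ stage (n + 1) ↔
    p ∈ face ∨ flip3 p ∈ face ∨ p ∈ horns ∨ flip3 p ∈ horns ∨ tipInv p ∈ stage n ∨
      tipInv (flip3 p) ∈ stage n := by
  simp only [stage, mem_union, mem_preimage]
  tauto

theorem mem_box_of_mem_stage {n : ℕ} {p : V3} (hp : p ∈ stage n) : p ∈ box := by
  induction n generalizing p with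
  | zero => exact hp
  | succ n ih =>
    obtain ⟨x, y, z⟩ := p
    rcases mem_stage_succ.1 hp with h | h | (h | h) | (h | h) | h | h
    all_goals try replace h := ih h
    all_goals
      simp only [face, box, horn₀, horn₁, flip3, tipInv, mem_ofPred_eq] at h ⊢
      refine ⟨?_, ?_, ?_, ?_, ?_, ?_⟩ <;> linarith

theorem stage_succ_subset (n : ℕ) : stage (n + 1) ⊆ stage n := by
  induction n with
  | zero => exact fun p hp => mem_box_of_mem_stage hp
  | succ n ih =>
    intro p hp
    rw [mem_stage_succ] at hp ⊢
    have := @ih (tipInv p)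
    have := @ih (tipInv (flip3 p))
    tauto

theorem flip3_mem_stage {n : ℕ} {p : V3} (hp : p ∈ stage n) : flip3 p ∈ stage n := by
  cases n with
  | zero =>
    obtain ⟨x, y, z⟩ := p
    simp only [stage, box, flip3, mem_ofPred_eq] at hp ⊢
    refine ⟨?_, ?_, ?_, ?_, ?_, ?_⟩ <;> linarith
  | succ n =>
    rw [mem_stage_succ] at hp ⊢
    rw [flip3_flip3]
    tauto

end HornGeometry

section HornCocycle

open Topology Filter

variable {F : Type} [Group F]

/-- The cocycle `g` is a coboundary near `x`. -/
def FlatAt {α : Type*} [TopologicalSpace α] (g : α → α → F) (x : α) : Prop :=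
  ∃ N ∈ 𝓝 x, ∃ s : α → F, ∀ p ∈ N, ∀ q ∈ N, g p q = (s p)⁻¹ * s q

theorem FlatAt.intro {α : Type*} [TopologicalSpace α] {g : α → α → F} {x : α} {P : α → Prop}
    (hP : ∀ᶠ p in 𝓝 x, P p) (s : α → F) (h : ∀ p q, P p → P q → g p q = (s p)⁻¹ * s q) :
    FlatAt g x :=
  ⟨{p | P p}, hP, s, fun p hp q hq => h p q hp hq⟩

theorem FlatAt.congr {α : Type*} [TopologicalSpace α] {g g' : α → α → F} {x : α} {P : α → Prop}
    (hg : FlatAt g x) (hP : ∀ᶠ p in 𝓝 x, P p) (h : ∀ p q, P p → P q → g' p q = g p q) :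
    FlatAt g' x := by
  obtain ⟨N, hN, s, hs⟩ := hg
  refine ⟨N ∩ {p | P p}, inter_mem hN hP, s, fun p hp q hq => ?_⟩
  rw [h p q hp.2 hq.2, hs p hp.1 q hq.1]

theorem FlatAt.comp {α β : Type*} [TopologicalSpace α] [TopologicalSpace β] {g : α → α → F}
    {φ : β → α} {x : β} (hg : FlatAt g (φ x)) (hφ : ContinuousAt φ x) : FlatAt (pull φ g) x := by
  obtain ⟨N, hN, s, hs⟩ := hg
  exact ⟨φ ⁻¹' N, hφ hN, s ∘ φ, fun p hp q hq => hs _ hp _ hq⟩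

theorem eventually_lt_iff {α : Type*} [TopologicalSpace α] {f g : α → ℝ} {x : α}
    (hf : Continuous f) (hg : Continuous g) (h : f x ≠ g x) :
    ∀ᶠ p in 𝓝 x, (f p < g p ↔ f x < g x) := by
  rcases lt_or_gt_of_ne h with h | h
  · filter_upwards [hf.continuousAt.eventually_lt hg.continuousAt h] with p hp
    simp [hp, h]
  · filter_upwards [hg.continuousAt.eventually_lt hf.continuousAt h] with p hp
    simp only [hp.not_gt, h.not_gt]

open Classical in
/-- The factor picked up when the truth value `s` changes to `t`. -/
def cross (s t : Prop) (c : F) : F := if t ∧ ¬s then c else if s ∧ ¬t then c⁻¹ else 1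

theorem cross_of_iff {s t : Prop} (h : s ↔ t) (c : F) : cross s t c = 1 := by
  by_cases s <;> simp_all [cross]

theorem cross_one (s t : Prop) : cross s t (1 : F) = 1 := by
  simp [cross]

open Classical in
theorem cross_eq (s t : Prop) (c : F) :
    cross s t c = (if s then c else 1)⁻¹ * (if t then c else 1) := by
  by_cases hs : s <;> by_cases ht : t <;> simp [cross, hs, ht]

/-- The profile of the core of the pair of horns. -/
def profile (y : ℝ) : ℝ := min 12 (min (36 + 4 * y) (8 - 2 * y))

theorem continuous_profile : Continuous profile := by unfold profile; fun_prop

/-- The transition factor across `y = 0`. -/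
def factorY (b d : F) (x z : ℝ) : F := if -x < profile z then b else if z < 0 then 1 else d

/-- The transition factor across `z = 0`. -/
def factorZ (a a' : F) (x y : ℝ) : F := if x < profile y then (if y < 0 then a else a') else 1

/-- The cocycle with labels `a` and `b` on the complement of the clasped horns. -/
def claspRule (a b : F) (p q : V3) : F :=
  cross (0 ≤ p.2.1) (0 ≤ q.2.1) (factorY b (a⁻¹ * b⁻¹ * a * b) p.1 p.2.2) *
    cross (0 ≤ p.2.2) (0 ≤ q.2.2) (factorZ a (b⁻¹ * a * b) q.1 q.2.1)

open Classical in
theorem cross_mul_cross (s₁ t₁ s₂ t₂ : Prop) (l₀ l₁ k₀ k₁ : F) (h : l₀ * k₁ = k₀ * l₁) :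
    cross s₁ t₁ (if s₂ then l₁ else l₀) * cross s₂ t₂ (if t₁ then k₁ else k₀) =
      (if s₁ then (if s₂ then l₀ * k₁ else l₀) else (if s₂ then k₀ else 1))⁻¹ *
      (if t₁ then (if t₂ then l₀ * k₁ else l₀) else (if t₂ then k₀ else 1)) := by
  have h1 : k₁ = l₀⁻¹ * k₀ * l₁ := by rw [mul_assoc, ← h]; group
  subst h1
  by_cases s₁ <;> by_cases s₂ <;> by_cases t₁ <;> by_cases t₂ <;> simp_all [cross] <;> group

theorem flatAt_of_iff {g : V3 → V3 → F} {x : V3} {P : V3 → Prop} {f : V3 → Prop} {c : F}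
    (hP : ∀ᶠ p in 𝓝 x, P p) (h : ∀ p q, P p → P q → g p q = cross (f p) (f q) c) :
    FlatAt g x := by
  classical
  exact FlatAt.intro hP (fun p => if f p then c else 1) fun p q hp hq => by
    rw [h p q hp hq, cross_eq]

theorem eventually_nonneg_iff {α : Type*} [TopologicalSpace α] {f : α → ℝ} {x : α}
    (hf : Continuous f) (h : f x ≠ 0) : ∀ᶠ p in 𝓝 x, (0 ≤ f p ↔ 0 ≤ f x) := by
  filter_upwards [eventually_lt_iff hf continuous_const h] with p hp
  rw [← not_lt, ← not_lt, hp]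

theorem flatAt_claspRule (a b : F) {x : V3} (h1 : -20 < x.1) (h2 : x.1 < 20) (hh : x ∉ horns)
    (hh' : flip3 x ∉ horns) (hZ : tipInv x ∉ box) (hZ' : tipInv (flip3 x) ∉ box) :
    FlatAt (claspRule a b) x := by
  have hy0 : x.2.2 = 0 → x.1 ≠ profile x.2.1 := by
    intro hz hx
    simp only [horns, horn₀, horn₁, box, tipInv, mem_union, mem_ofPred_eq, not_or, hz] at hh hZ
    rcases lt_or_ge x.2.1 (-6) with hy | hy
    · rw [profile, min_eq_left (by linarith : 36 + 4 * x.2.1 ≤ 8 - 2 * x.2.1),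
        min_eq_right (by linarith)] at hx
      exact hh.1 ⟨by linarith, by linarith, by linarith, by linarith, by norm_num, by norm_num⟩
    rcases lt_or_ge (-2) x.2.1 with hy' | hy'
    · rw [profile, min_eq_right (by linarith : 8 - 2 * x.2.1 ≤ 36 + 4 * x.2.1),
        min_eq_right (by linarith)] at hx
      exact hh.2 ⟨by linarith, by linarith, by linarith, by linarith, by norm_num, by norm_num⟩
    · rw [profile, min_eq_left (le_min (by linarith) (by linarith))] at hx
      exact hZ ⟨by linarith, by linarith, by linarith, by linarith, by linarith, by linarith⟩
  have hz0 : x.2.1 = 0 → -x.1 ≠ profile x.2.2 := by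
    intro hz hx
    simp only [horns, horn₀, horn₁, box, tipInv, flip3, mem_union, mem_ofPred_eq, not_or, hz]
      at hh' hZ'
    rcases lt_or_ge x.2.2 (-6) with hy | hy
    · rw [profile, min_eq_left (by linarith : 36 + 4 * x.2.2 ≤ 8 - 2 * x.2.2),
        min_eq_right (by linarith)] at hx
      exact hh'.1 ⟨by linarith, by linarith, by linarith, by linarith, by norm_num, by norm_num⟩
    rcases lt_or_ge (-2) x.2.2 with hy' | hy'
    · rw [profile, min_eq_right (by linarith : 8 - 2 * x.2.2 ≤ 36 + 4 * x.2.2),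
        min_eq_right (by linarith)] at hx
      exact hh'.2 ⟨by linarith, by linarith, by linarith, by linarith, by norm_num, by norm_num⟩
    · rw [profile, min_eq_left (le_min (by linarith) (by linarith))] at hx
      exact hZ' ⟨by linarith, by linarith, by linarith, by linarith, by linarith, by linarith⟩
  have cY : Continuous fun p : V3 => p.2.1 := by fun_prop
  have cZ : Continuous fun p : V3 => p.2.2 := by fun_prop
  have cX : Continuous fun p : V3 => p.1 := by fun_prop
  have cmZ : Continuous fun p : V3 => profile p.2.2 := continuous_profile.comp cZ
  have cmY : Continuous fun p : V3 => profile p.2.1 := continuous_profile.comp cY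
  by_cases hy : x.2.1 = 0
  · have e1 : ∀ᶠ p : V3 in 𝓝 x, (-p.1 < profile p.2.2 ↔ -x.1 < profile x.2.2) :=
      eventually_lt_iff cX.neg cmZ (hz0 hy)
    by_cases hz : x.2.2 = 0
    · have e2 := eventually_lt_iff cX cmY (hy0 hz)
      have hP := e1.and e2
      have hmu : profile 0 = 8 := by norm_num [profile]
      rw [hy, hz] at hP
      simp only [hmu] at hP
      have key : ∀ l₀ l₁ k₀ k₁ : F, l₀ * k₁ = k₀ * l₁ →
          (∀ p : V3, (-p.1 < profile p.2.2 ↔ -x.1 < 8) →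
            factorY b (a⁻¹ * b⁻¹ * a * b) p.1 p.2.2 = if 0 ≤ p.2.2 then l₁ else l₀) →
          (∀ p : V3, (p.1 < profile p.2.1 ↔ x.1 < 8) →
            factorZ a (b⁻¹ * a * b) p.1 p.2.1 = if 0 ≤ p.2.1 then k₁ else k₀) →
          FlatAt (claspRule a b) x := by
        intro l₀ l₁ k₀ k₁ h H1 H2
        refine FlatAt.intro hP (fun p => if 0 ≤ p.2.1 then (if 0 ≤ p.2.2 then l₀ * k₁ else l₀)
          else (if 0 ≤ p.2.2 then k₀ else 1)) fun p q hp hq => ?_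
        rw [claspRule, H1 p hp.1, H2 q hq.2]
        convert cross_mul_cross _ _ _ _ l₀ l₁ k₀ k₁ h
      replace hy0 := hy0 hz
      replace hz0 := hz0 hy
      rw [hy, hmu] at hy0
      rw [hz, hmu] at hz0
      rcases lt_or_gt_of_ne hy0 with h8 | h8
      · rcases lt_or_gt_of_ne hz0 with h8' | h8'
        · refine key b b a (b⁻¹ * a * b) (by group) (fun p hp => ?_) (fun p hp => ?_)
          · simp [factorY, hp, h8']
          · simp only [factorZ, hp, h8, if_true]
            split_ifs <;> first | rfl | (exfalso; linarith)
        · refine key 1 (a⁻¹ * b⁻¹ * a * b) a (b⁻¹ * a * b) (by group) (fun p hp => ?_)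
            (fun p hp => ?_)
          · simp only [factorY, hp, h8'.not_gt, if_false]
            split_ifs <;> first | rfl | (exfalso; linarith)
          · simp only [factorZ, hp, h8, if_true]
            split_ifs <;> first | rfl | (exfalso; linarith)
      · refine key b b 1 1 (by group) (fun p hp => ?_) (fun p hp => ?_)
        · have : -x.1 < 8 := by linarith
          simp [factorY, hp, this]
        · simp [factorZ, hp, h8.le]
    · refine flatAt_of_iff (e1.and (eventually_nonneg_iff cZ hz)) (f := fun p => 0 ≤ p.2.1)
        (c := factorY b (a⁻¹ * b⁻¹ * a * b) x.1 x.2.2) fun p q hp hq => ?_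
      rw [claspRule, cross_of_iff (hp.2.trans hq.2.symm), mul_one]
      have h3 : p.2.2 < 0 ↔ x.2.2 < 0 := by rw [← not_le, ← not_le, hp.2]
      simp only [factorY, hp.1, h3]
  · have e1 := eventually_nonneg_iff cY hy
    by_cases hz : x.2.2 = 0
    · have e2 := eventually_lt_iff cX cmY (hy0 hz)
      refine flatAt_of_iff (e2.and e1) (f := fun p => 0 ≤ p.2.2)
        (c := factorZ a (b⁻¹ * a * b) x.1 x.2.1) fun p q hp hq => ?_
      rw [claspRule, cross_of_iff (hp.2.trans hq.2.symm), one_mul]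
      have h3 : q.2.1 < 0 ↔ x.2.1 < 0 := by rw [← not_le, ← not_le, hq.2]
      simp only [factorZ, hq.1, h3]
    · refine FlatAt.intro (e1.and (eventually_nonneg_iff cZ hz)) (fun _ => 1) fun p q hp hq => ?_
      rw [claspRule, cross_of_iff (hp.1.trans hq.1.symm), cross_of_iff (hp.2.trans hq.2.symm)]
      simp

end HornCocycle

section HornRecursion

open Topology Filter

variable {F : Type} [Group F] {St : Type}

open Classical in
/-- The cocycles on the complements of the stages. -/
def stageRule (lab : St → F) (c₀ c₁ : St → St) : ℕ → St → V3 → V3 → F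
  | 0, s, p, q => claspRule (lab (c₀ s)) (lab (c₁ s)) p q
  | n + 1, s, p, q =>
    if tipInv p ∈ box then stageRule lab c₀ c₁ n (c₀ s) (tipInv p) (tipInv q)
    else if tipInv (flip3 p) ∈ box then
      stageRule lab c₀ c₁ n (c₁ s) (tipInv (flip3 p)) (tipInv (flip3 q))
    else claspRule (lab (c₀ s)) (lab (c₁ s)) p q

variable {lab : St → F} {c₀ c₁ : St → St}

theorem stageRule_of_notMem (n : ℕ) (s : St) {p : V3} (q : V3) (h : tipInv p ∉ box)
    (h' : tipInv (flip3 p) ∉ box) :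
    stageRule lab c₀ c₁ n s p q = claspRule (lab (c₀ s)) (lab (c₁ s)) p q := by
  cases n with
  | zero => rfl
  | succ n => rw [stageRule, if_neg h, if_neg h']

theorem profile_le {y : ℝ} (h : 19 ≤ |y|) : profile y ≤ -20 := by
  rcases le_abs.1 h with h | h
  · exact (min_le_right _ _).trans ((min_le_right _ _).trans (by linarith))
  · exact (min_le_right _ _).trans ((min_le_left _ _).trans (by linarith))

theorem notMem_tip_of_far {p : V3} (h : 19 ≤ |p.2.1| ∨ 19 ≤ |p.2.2|) :
    tipInv p ∉ box ∧ tipInv (flip3 p) ∉ box := by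
  simp only [box, tipInv, flip3, mem_ofPred_eq]
  rcases h with h | h <;> rcases le_abs.1 h with h | h <;>
    exact ⟨fun h => by linarith [h.1, h.2.1, h.2.2.1, h.2.2.2.1],
      fun h => by linarith [h.1, h.2.1, h.2.2.1, h.2.2.2.1]⟩

theorem stageRule_of_far_y (n : ℕ) (s : St) {p q : V3} (hq : q.1 < 20 ∧ -20 < q.1)
    (hpy : 19 ≤ |p.2.1|) (hqy : 19 ≤ |q.2.1|) (h : 0 ≤ p.2.1 ↔ 0 ≤ q.2.1) :
    stageRule lab c₀ c₁ n s p q = 1 := by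
  obtain ⟨h1, h2⟩ := notMem_tip_of_far (Or.inl hpy)
  rw [stageRule_of_notMem _ _ _ h1 h2, claspRule, cross_of_iff h, factorZ, if_neg, cross_one,
    mul_one]
  linarith [profile_le hqy, hq.2]

theorem stageRule_of_far_z (hlab : ∀ s, lab s = (lab (c₀ s))⁻¹ * (lab (c₁ s))⁻¹ * lab (c₀ s) *
    lab (c₁ s)) (n : ℕ) (s : St) {p q : V3} (hp : p.1 < 20 ∧ -20 < p.1)
    (hpy : 19 ≤ |p.2.2|) (h : 0 ≤ p.2.2 ↔ 0 ≤ q.2.2) :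
    stageRule lab c₀ c₁ n s p q =
      cross (0 ≤ p.2.1) (0 ≤ q.2.1) (if p.2.2 < 0 then 1 else lab s) := by
  obtain ⟨h1, h2⟩ := notMem_tip_of_far (Or.inr hpy)
  rw [stageRule_of_notMem _ _ _ h1 h2, claspRule, cross_of_iff h, factorY, if_neg, mul_one,
    ← hlab]
  linarith [profile_le hpy, hp.1]

theorem mem_interior_box {p : V3} (h1 : -20 < p.1) (h2 : p.1 < 20) (h3 : |p.2.1| < 20)
    (h4 : |p.2.2| < 20) : ∀ᶠ q in 𝓝 p, q ∈ box := by
  have c1 : Continuous fun p : V3 => p.1 := by fun_prop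
  have c2 : Continuous fun p : V3 => |p.2.1| := by fun_prop
  have c3 : Continuous fun p : V3 => |p.2.2| := by fun_prop
  filter_upwards [c1.continuousAt.eventually (lt_mem_nhds h1),
    c1.continuousAt.eventually (gt_mem_nhds h2), c2.continuousAt.eventually (gt_mem_nhds h3),
    c3.continuousAt.eventually (gt_mem_nhds h4)] with q h1 h2 h3 h4
  rw [abs_lt] at h3 h4
  exact ⟨h1.le, h2.le, h3.1.le, h3.2.le, h4.1.le, h4.2.le⟩

/-- Near a lateral side of the box, a point either stays away from `y = 0` or from `z = 0`. -/
theorem eventually_far {x : V3} (h1 : -20 < x.1) (h2 : x.1 < 20)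
    {φ : V3 → V3} {w : V3} (hφ : Continuous φ) (hw : φ w = x) :
    (∀ᶠ p in 𝓝 w, φ p ∈ box ∧ (φ p).1 < 20 ∧ -20 < (φ p).1) ∨
    (∀ᶠ p in 𝓝 w, (19 ≤ |(φ p).2.1| ∧ (0 ≤ (φ p).2.1 ↔ 0 ≤ x.2.1)) ∧
      (φ p).1 < 20 ∧ -20 < (φ p).1) ∨
    (∀ᶠ p in 𝓝 w, (19 ≤ |(φ p).2.2| ∧ (0 ≤ (φ p).2.2 ↔ 0 ≤ x.2.2)) ∧
      (φ p).1 < 20 ∧ -20 < (φ p).1) := by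
  have c1 : Continuous fun p : V3 => (φ p).1 := by fun_prop
  have c2 : Continuous fun p : V3 => (φ p).2.1 := by fun_prop
  have c3 : Continuous fun p : V3 => (φ p).2.2 := by fun_prop
  have e1 : ∀ᶠ p in 𝓝 w, (φ p).1 < 20 ∧ -20 < (φ p).1 :=
    (c1.continuousAt.eventually (gt_mem_nhds (by simp only [hw]; exact h2))).and
      (c1.continuousAt.eventually (lt_mem_nhds (by simp only [hw]; exact h1)))
  rcases lt_or_ge |x.2.1| 20 with h3 | h3
  · rcases lt_or_ge |x.2.2| 20 with h4 | h4
    · left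
      have := hφ.continuousAt.eventually (hw ▸ mem_interior_box h1 h2 h3 h4)
      exact this.and e1
    · right; right
      have h0 : (φ w).2.2 ≠ 0 := by
        rw [hw]; intro h; rw [h] at h4; norm_num at h4
      have e2 := eventually_nonneg_iff c3 h0
      rw [hw] at e2
      have e3 := c3.abs.continuousAt.eventually (lt_mem_nhds (show (19:ℝ) < |(φ w).2.2| by
        rw [hw]; linarith))
      filter_upwards [e1, e2, e3] with p h1 h2 h3 using ⟨⟨h3.le, h2⟩, h1⟩
  · right; left
    have h0 : (φ w).2.1 ≠ 0 := by
      rw [hw]; intro h; rw [h] at h3; norm_num at h3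
    have e2 := eventually_nonneg_iff c2 h0
    rw [hw] at e2
    have e3 := c2.abs.continuousAt.eventually (lt_mem_nhds (show (19:ℝ) < |(φ w).2.1| by
      rw [hw]; linarith))
    filter_upwards [e1, e2, e3] with p h1 h2 h3 using ⟨⟨h3.le, h2⟩, h1⟩

theorem tip_side {x : V3} (hx : tipInv x ∈ box) (hh : x ∉ horns) :
    -20 < (tipInv x).1 ∧ (tipInv x).1 < 20 := by
  obtain ⟨x, y, z⟩ := x
  simp only [horns, horn₀, horn₁, box, tipInv, mem_union, mem_ofPred_eq, not_or] at hx hh ⊢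
  obtain ⟨h1, h2, h3, h4, h5, h6⟩ := hx
  constructor
  · refine lt_of_le_of_ne h1 fun h => hh.1 ⟨?_, ?_, ?_, ?_, ?_, ?_⟩ <;> linarith
  · refine lt_of_le_of_ne h2 fun h => hh.2 ⟨?_, ?_, ?_, ?_, ?_, ?_⟩ <;> linarith

theorem horns_union_subset_box {x : V3} (hx : x ∉ box) : x ∉ horns ∧ flip3 x ∉ horns ∧
    tipInv x ∉ box ∧ tipInv (flip3 x) ∉ box := by
  have := fun h => hx (mem_box_of_mem_stage (n := 1) (p := x) h)
  rw [mem_stage_succ] at this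
  simp only [stage] at this
  tauto

theorem profile_of_mid {y : ℝ} (h : -6 ≤ y) (h' : y ≤ -2) : profile y = 12 :=
  min_eq_left (le_min (by linarith) (by linarith))

theorem flatAt_stageRule (hlab : ∀ s, lab s = (lab (c₀ s))⁻¹ * (lab (c₁ s))⁻¹ * lab (c₀ s) *
    lab (c₁ s)) (n : ℕ) (s : St) {x : V3} (h1 : -20 < x.1) (h2 : x.1 < 20) (hx : x ∉ stage n) :
    FlatAt (stageRule lab c₀ c₁ n s) x := by
  induction n generalizing s x with
  | zero =>
    obtain ⟨h3, h4, h5, h6⟩ := horns_union_subset_box hx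
    exact flatAt_claspRule _ _ h1 h2 h3 h4 h5 h6
  | succ n ih =>
    rw [mem_stage_succ] at hx
    simp only [not_or] at hx
    obtain ⟨-, -, hh, hh', hn, hn'⟩ := hx
    have cf : Continuous fun p => tipInv (flip3 p) := continuous_tipInv.comp continuous_flip3
    have hc : ∀ {x : V3}, tipInv x ∉ box → ∀ᶠ p in 𝓝 x, tipInv p ∉ box := fun h =>
      (isClosed_box.preimage continuous_tipInv).isOpen_compl.mem_nhds h
    have hc' : ∀ {x : V3}, tipInv (flip3 x) ∉ box → ∀ᶠ p in 𝓝 x, tipInv (flip3 p) ∉ box :=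
      fun h => (isClosed_box.preimage cf).isOpen_compl.mem_nhds h
    by_cases hZ : tipInv x ∈ box
    · have hZ' : tipInv (flip3 x) ∉ box := fun h => by
        simp only [box, tipInv, flip3, mem_ofPred_eq] at h hZ
        linarith [h.2.2.2.2.1, hZ.2.2.2.2.1, h.2.2.2.2.2, hZ.2.2.2.2.2]
      obtain ⟨h3, h4⟩ := tip_side hZ hh
      have hfl := ih (c₀ s) h3 h4 hn
      rcases eventually_far h3 h4 continuous_tipInv rfl with h | h | h
      · refine (hfl.comp continuous_tipInv.continuousAt).congr h fun p q hp hq => ?_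
        rw [stageRule, if_pos hp.1]; rfl
      · refine FlatAt.intro (h.and (hc' hZ')) (fun _ => 1) fun p q hp hq => ?_
        obtain ⟨⟨⟨hp1, hp2⟩, hp3⟩, hp4⟩ := hp
        obtain ⟨⟨⟨hq1, hq2⟩, hq3⟩, hq4⟩ := hq
        rw [stageRule]
        split_ifs
        · rw [stageRule_of_far_y n _ hq3 hp1 hq1 (hp2.trans hq2.symm)]; simp
        · have e : 0 ≤ p.2.2 ↔ 0 ≤ q.2.2 := by
            have := hp2.trans hq2.symm
            simpa [tipInv] using this
          rw [claspRule, cross_of_iff e, cross_of_iff]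
          · simp
          · simp only [tipInv] at hp3 hq3
            constructor <;> intro <;> linarith
      · have key : ∀ p : V3, (0 ≤ (tipInv p).2.2 ↔ 0 ≤ (tipInv x).2.2) →
            ((tipInv p).2.2 < 0 ↔ (tipInv x).2.2 < 0) := fun p hp => by
          rw [← not_le, ← not_le, hp]
        refine flatAt_of_iff (h.and (hc' hZ')) (f := fun p => 0 ≤ p.2.2)
          (c := if (tipInv x).2.2 < 0 then 1 else lab (c₀ s)) fun p q hp hq => ?_
        obtain ⟨⟨⟨hp1, hp2⟩, hp3⟩, hp4⟩ := hp
        obtain ⟨⟨⟨hq1, hq2⟩, hq3⟩, hq4⟩ := hq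
        rw [stageRule]
        split_ifs with hb hneg hneg
        · rw [stageRule_of_far_z hlab n _ hp3 hp1 (hp2.trans hq2.symm),
            if_pos ((key p hp2).2 hneg), cross_one, cross_one]
        · rw [stageRule_of_far_z hlab n _ hp3 hp1 (hp2.trans hq2.symm),
            if_neg (fun h => hneg ((key p hp2).1 h))]
          simp [tipInv]
        · have e := (key q hq2).2 hneg
          simp only [tipInv] at hp3 hq3 e
          have e1 : 0 ≤ p.2.1 ↔ 0 ≤ q.2.1 := by constructor <;> intro <;> linarith
          rw [claspRule, cross_of_iff e1, factorZ,
            profile_of_mid (by linarith) (by linarith), if_neg (by linarith)]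
          simp [cross_one]
        · have e : ¬ (tipInv q).2.2 < 0 := fun h => hneg ((key q hq2).1 h)
          have e2 := hq1
          rw [abs_of_nonneg (not_lt.1 e)] at e2
          simp only [tipInv] at hp3 hq3 e2
          have e1 : 0 ≤ p.2.1 ↔ 0 ≤ q.2.1 := by constructor <;> intro <;> linarith
          rw [claspRule, cross_of_iff e1, factorZ,
            profile_of_mid (by linarith) (by linarith), if_pos (by linarith),
            if_pos (by linarith), one_mul]
    · by_cases hZ' : tipInv (flip3 x) ∈ box
      · obtain ⟨h3, h4⟩ := tip_side hZ' hh'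
        have hfl := ih (c₁ s) h3 h4 hn'
        rcases eventually_far h3 h4 cf rfl with h | h | h
        · refine (hfl.comp (φ := fun p => tipInv (flip3 p)) cf.continuousAt).congr (h.and (hc hZ)) fun p q hp hq => ?_
          rw [stageRule, if_neg hp.2, if_pos hp.1.1]; rfl
        · refine FlatAt.intro (h.and (hc hZ)) (fun _ => 1) fun p q hp hq => ?_
          obtain ⟨⟨⟨hp1, hp2⟩, hp3⟩, hp4⟩ := hp
          obtain ⟨⟨⟨hq1, hq2⟩, hq3⟩, hq4⟩ := hq
          rw [stageRule, if_neg hp4]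
          split_ifs
          · rw [stageRule_of_far_y n _ hq3 hp1 hq1 (hp2.trans hq2.symm)]; simp
          · have e : 0 ≤ p.2.1 ↔ 0 ≤ q.2.1 := by
              have := hp2.trans hq2.symm
              simpa [tipInv, flip3] using this
            rw [claspRule, cross_of_iff e, cross_of_iff]
            · simp
            · simp only [tipInv, flip3] at hp3 hq3
              constructor <;> intro <;> linarith
        · have key : ∀ p : V3, (0 ≤ (tipInv (flip3 p)).2.2 ↔ 0 ≤ (tipInv (flip3 x)).2.2) →
              ((tipInv (flip3 p)).2.2 < 0 ↔ (tipInv (flip3 x)).2.2 < 0) := fun p hp => by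
            rw [← not_le, ← not_le, hp]
          refine flatAt_of_iff (h.and (hc hZ)) (f := fun p => 0 ≤ p.2.1)
            (c := if (tipInv (flip3 x)).2.2 < 0 then 1 else lab (c₁ s)) fun p q hp hq => ?_
          obtain ⟨⟨⟨hp1, hp2⟩, hp3⟩, hp4⟩ := hp
          obtain ⟨⟨⟨hq1, hq2⟩, hq3⟩, hq4⟩ := hq
          rw [stageRule, if_neg hp4]
          split_ifs with hb hneg hneg
          · rw [stageRule_of_far_z hlab n _ hp3 hp1 (hp2.trans hq2.symm),
              if_pos ((key p hp2).2 hneg), cross_one, cross_one]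
          · rw [stageRule_of_far_z hlab n _ hp3 hp1 (hp2.trans hq2.symm),
              if_neg (fun h => hneg ((key p hp2).1 h))]
            simp [tipInv, flip3]
          · have e := (key p hp2).2 hneg
            simp only [tipInv, flip3] at hp3 hq3 e
            have e1 : 0 ≤ p.2.2 ↔ 0 ≤ q.2.2 := by constructor <;> intro <;> linarith
            rw [claspRule, cross_of_iff e1, factorY,
              profile_of_mid (by linarith) (by linarith), if_neg (by linarith),
              if_pos (by linarith)]
            simp [cross_one]
          · have e : ¬ (tipInv (flip3 p)).2.2 < 0 := fun h => hneg ((key p hp2).1 h)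
            have e2 := hp1
            rw [abs_of_nonneg (not_lt.1 e)] at e2
            simp only [tipInv, flip3] at hp3 hq3 e2
            have e1 : 0 ≤ p.2.2 ↔ 0 ≤ q.2.2 := by constructor <;> intro <;> linarith
            rw [claspRule, cross_of_iff e1, factorY,
              profile_of_mid (by linarith) (by linarith), if_pos (by linarith), mul_one]
      · refine (flatAt_claspRule (lab (c₀ s)) (lab (c₁ s)) h1 h2 hh hh' hZ hZ').congr
          ((hc hZ).and (hc' hZ')) fun p q hp hq => ?_
        rw [stageRule_of_notMem _ _ _ hp.1 hp.2]

end HornRecursion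

section HornLimit

open Topology Filter

variable {F : Type} [Group F] {St : Type}

/-- The intersection of all stages. -/
def limitSet : Set V3 := ⋂ n, stage n

/-- The part of the ball below the horns. -/
def body : Set V3 :=
  {p | -40 ≤ p.1 ∧ p.1 ≤ -20 ∧ -20 ≤ p.2.1 ∧ p.2.1 ≤ 20 ∧ -20 ≤ p.2.2 ∧ p.2.2 ≤ 20}

/-- The closed ball bounded by the horned sphere. -/
def hornedBall : Set V3 := body ∪ horns ∪ tipInv ⁻¹' limitSet

theorem isClosed_limitSet : IsClosed limitSet := isClosed_iInter isClosed_stage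

theorem isClosed_body : IsClosed body := by
  simp only [body, ofPred_and]
  repeat' apply IsClosed.inter
  all_goals exact isClosed_le (by fun_prop) (by fun_prop)

theorem isClosed_hornedBall : IsClosed hornedBall :=
  (isClosed_body.union isClosed_horns).union (isClosed_limitSet.preimage continuous_tipInv)

theorem antitone_stage : Antitone stage := antitone_nat_of_succ_le stage_succ_subset

theorem notMem_limitSet {p : V3} : p ∉ limitSet ↔ ∃ n, p ∉ stage n := by
  simp [limitSet]

variable {lab : St → F} {c₀ c₁ : St → St}

theorem stageRule_succ {m : ℕ} {s : St} {p : V3} (q : V3) (hp : p ∉ stage m) :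
    stageRule lab c₀ c₁ (m + 1) s p q = stageRule lab c₀ c₁ m s p q := by
  induction m generalizing s p q with
  | zero =>
    obtain ⟨-, -, h, h'⟩ := horns_union_subset_box hp
    rw [stageRule_of_notMem _ _ _ h h', stageRule_of_notMem _ _ _ h h']
  | succ m ih =>
    rw [mem_stage_succ] at hp
    simp only [not_or] at hp
    rw [stageRule, ih _ hp.2.2.2.2.1, ih _ hp.2.2.2.2.2]
    rfl

variable (lab c₀ c₁) in
/-- The cocycle on the complement of the limit set. -/
def limitRule (s : St) (p q : V3) : F := stageRule lab c₀ c₁ (sInf {n | p ∉ stage n}) s p q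

theorem limitRule_eq {n : ℕ} {s : St} {p : V3} (q : V3) (hp : p ∉ stage n) :
    limitRule lab c₀ c₁ s p q = stageRule lab c₀ c₁ n s p q := by
  set m := sInf {n | p ∉ stage n} with hm
  have h1 : p ∉ stage m := Nat.sInf_mem (s := {n | p ∉ stage n}) ⟨n, hp⟩
  have h2 : m ≤ n := Nat.sInf_le hp
  rw [limitRule, ← hm]
  clear_value m
  clear hp hm
  induction n, h2 using Nat.le_induction with
  | base => rfl
  | succ k hk ih => rw [ih, stageRule_succ _ fun h => h1 (antitone_stage hk h)]

theorem flatAt_limitRule (hlab : ∀ s, lab s = (lab (c₀ s))⁻¹ * (lab (c₁ s))⁻¹ * lab (c₀ s) *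
    lab (c₁ s)) (s : St) {x : V3} (h1 : -20 < x.1) (h2 : x.1 < 20) (hx : x ∉ limitSet) :
    FlatAt (limitRule lab c₀ c₁ s) x := by
  obtain ⟨n, hn⟩ := notMem_limitSet.1 hx
  refine (flatAt_stageRule hlab n s h1 h2 hn).congr ((isClosed_stage n).isOpen_compl.mem_nhds hn)
    fun p q hp _ => limitRule_eq q hp

theorem tipMap_notMem {p : V3} (hp : p ∈ box) (hpX : p ∉ limitSet) : tipMap p ∉ body ∧
    tipMap p ∉ horns ∧ tipMap p ∈ box ∧ tipMap p ∉ limitSet := by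
  obtain ⟨n, hn⟩ := notMem_limitSet.1 hpX
  have h1 : p ∉ stage (n + 1) := fun h => hn (stage_succ_subset n h)
  have h1' := h1
  rw [mem_stage_succ] at h1'
  simp only [not_or] at h1'
  obtain ⟨hf, hf', -⟩ := h1'
  have hh : tipMap p ∉ horns := fun h => by
    simp only [box, face, horns, horn₀, horn₁, tipMap, flip3, mem_union, mem_ofPred_eq] at hp hf hf' h
    obtain ⟨hp1, hp2, hp3, hp4, hp5, hp6⟩ := hp
    rcases h with h | h
    · refine hf ⟨?_, ?_, ?_, ?_, ?_⟩ <;> linarith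
    · refine hf' ⟨?_, ?_, ?_, ?_, ?_⟩ <;> linarith
  refine ⟨fun h => ?_, hh, ?_, notMem_limitSet.2 ⟨n + 2, fun h => ?_⟩⟩
  · simp only [box, body, tipMap, mem_ofPred_eq] at hp h
    linarith
  · simp only [box, tipMap, mem_ofPred_eq] at hp ⊢
    refine ⟨?_, ?_, ?_, ?_, ?_, ?_⟩ <;> linarith
  · rw [mem_stage_succ, tipInv_tipMap] at h
    rcases h with h | h | h | h | h | h
    · simp only [box, face, tipMap, mem_ofPred_eq] at hp h
      linarith
    · simp only [box, face, tipMap, flip3, mem_ofPred_eq] at hp h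
      linarith
    · exact hh h
    · simp only [box, horns, horn₀, horn₁, tipMap, flip3, mem_union, mem_ofPred_eq] at hp h
      rcases h with h | h <;> linarith
    · exact h1 h
    · replace h := mem_box_of_mem_stage h
      simp only [box, tipInv, tipMap, flip3, mem_ofPred_eq] at hp h
      linarith

theorem limitRule_tipMap {s : St} {p q : V3} (hp : p ∈ box) (hpX : p ∉ limitSet) :
    limitRule lab c₀ c₁ s (tipMap p) (tipMap q) = limitRule lab c₀ c₁ (c₀ s) p q := by
  obtain ⟨n, hn⟩ := notMem_limitSet.1 hpX
  obtain ⟨m, hm⟩ := notMem_limitSet.1 (tipMap_notMem hp hpX).2.2.2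
  have hn' : p ∉ stage (n + m) := fun h => hn (antitone_stage (by omega) h)
  have hm' : tipMap p ∉ stage (n + m + 1) := fun h => hm (antitone_stage (by omega) h)
  rw [limitRule_eq _ hm', stageRule, tipInv_tipMap, if_pos hp, tipInv_tipMap, limitRule_eq _ hn']

open Classical in
variable (lab c₀ c₁) in
/-- The cocycle on the complement of the horned sphere. -/
def rootRule (s : St) (p q : V3) : F :=
  if p ∈ hornedBall ∨ q ∈ hornedBall then 1
  else if tipInv p ∈ box then limitRule lab c₀ c₁ s (tipInv p) (tipInv q) else 1

theorem flatAt_rootRule (hlab : ∀ s, lab s = (lab (c₀ s))⁻¹ * (lab (c₁ s))⁻¹ * lab (c₀ s) *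
    lab (c₁ s)) {s : St} (hs : lab s = 1) {x : V3} (hx : x ∈ hornedBall → hornedBall ∈ 𝓝 x) :
    FlatAt (rootRule lab c₀ c₁ s) x := by
  by_cases hB : x ∈ hornedBall
  · refine FlatAt.intro (P := (· ∈ hornedBall)) (hx hB) (fun _ => 1) fun p q hp hq => ?_
    simp [rootRule, hp]
  have eB : ∀ᶠ p in 𝓝 x, p ∉ hornedBall := isClosed_hornedBall.isOpen_compl.mem_nhds hB
  by_cases hZ : tipInv x ∈ box
  · have hB' := hB
    simp only [hornedBall, mem_union, not_or, mem_preimage] at hB'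
    obtain ⟨⟨-, hh⟩, hX⟩ := hB'
    obtain ⟨h3, h4⟩ := tip_side hZ hh
    have hfl := flatAt_limitRule hlab s h3 h4 hX
    have hev : ∀ᶠ p in 𝓝 x, tipInv p ∉ limitSet :=
      (isClosed_limitSet.preimage continuous_tipInv).isOpen_compl.mem_nhds hX
    rcases eventually_far h3 h4 continuous_tipInv rfl with h | h | h
    · refine (hfl.comp continuous_tipInv.continuousAt).congr (h.and eB) fun p q hp hq => ?_
      rw [rootRule, if_neg (by simp [hp.2, hq.2]), if_pos hp.1.1]; rfl
    · refine FlatAt.intro ((h.and eB).and hev) (fun _ => 1) fun p q hp hq => ?_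
      rw [rootRule, if_neg (by simp [hp.1.2, hq.1.2])]
      obtain ⟨n, hn⟩ := notMem_limitSet.1 hp.2
      rw [limitRule_eq _ hn, stageRule_of_far_y n _ hq.1.1.2 hp.1.1.1.1 hq.1.1.1.1
        (hp.1.1.1.2.trans hq.1.1.1.2.symm)]
      simp
    · refine FlatAt.intro ((h.and eB).and hev) (fun _ => 1) fun p q hp hq => ?_
      rw [rootRule, if_neg (by simp [hp.1.2, hq.1.2])]
      obtain ⟨n, hn⟩ := notMem_limitSet.1 hp.2
      rw [limitRule_eq _ hn, stageRule_of_far_z hlab n _ hp.1.1.2 hp.1.1.1.1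
        (hp.1.1.1.2.trans hq.1.1.1.2.symm), hs]
      simp [cross_one]
  · refine FlatAt.intro (P := fun p => tipInv p ∉ box) ((isClosed_box.preimage
      continuous_tipInv).isOpen_compl.mem_nhds hZ) (fun _ => 1) fun p q hp hq => ?_
    simp [rootRule, hp]

theorem iterate_tipMap_mem {p : V3} (hp : p ∈ box) (hpX : p ∉ limitSet) (n : ℕ) :
    tipMap^[n] p ∈ box ∧ tipMap^[n] p ∉ limitSet := by
  induction n with
  | zero => exact ⟨hp, hpX⟩
  | succ n ih =>
    rw [Function.iterate_succ_apply']
    exact (tipMap_notMem ih.1 ih.2).2.2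

theorem iterate_tipMap_notMem {p : V3} (hp : p ∈ box) (hpX : p ∉ limitSet) (n : ℕ) :
    tipMap^[n + 1] p ∉ hornedBall := by
  obtain ⟨h1, h2⟩ := iterate_tipMap_mem hp hpX n
  have := tipMap_notMem h1 h2
  rw [Function.iterate_succ_apply']
  simp only [hornedBall, mem_union, mem_preimage, tipInv_tipMap]
  tauto

theorem rootRule_iterate {n : ℕ} {s : St} {p q : V3} (hp : p ∈ box) (hpX : p ∉ limitSet)
    (hq : q ∈ box) (hqX : q ∉ limitSet) :
    rootRule lab c₀ c₁ s (tipMap^[n + 1] p) (tipMap^[n + 1] q) =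
      limitRule lab c₀ c₁ (c₀^[n] s) p q := by
  rw [rootRule, if_neg (by simp only [iterate_tipMap_notMem hp hpX n,
    iterate_tipMap_notMem hq hqX n, or_self, not_false_eq_true]), Function.iterate_succ_apply',
    Function.iterate_succ_apply', tipInv_tipMap, if_pos (iterate_tipMap_mem hp hpX n).1,
    tipInv_tipMap]
  induction n generalizing s with
  | zero => rfl
  | succ n ih =>
    obtain ⟨p1, p2⟩ := iterate_tipMap_mem hp hpX n
    rw [Function.iterate_succ_apply', Function.iterate_succ_apply', limitRule_tipMap p1 p2, ih,
      Function.iterate_succ_apply]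

/-- The loops around the first horn. -/
def meridian (s : ℝ) (w : ℝ × ℝ) : V3 := (-4 - s * w.1, -10 + s * w.1 / 4, s * w.2)

theorem meridian_prop {s : ℝ} {w : ℝ × ℝ} (hw : max |w.1| |w.2| = 1) (h1 : 1 < s) (h2 : s ≤ 2) :
    meridian s w ∈ box ∧ meridian s w ∉ stage 1 ∧ tipInv (meridian s w) ∉ box ∧
      tipInv (flip3 (meridian s w)) ∉ box := by
  obtain ⟨u, v⟩ := w
  have hu : |u| ≤ 1 := (le_max_left _ _).trans hw.le
  have hv : |v| ≤ 1 := (le_max_right _ _).trans hw.le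
  have hsu : |s * u| ≤ 2 := by
    rw [abs_mul, abs_of_pos (by linarith)]; nlinarith [abs_nonneg u]
  have hsv : |s * v| ≤ 2 := by
    rw [abs_mul, abs_of_pos (by linarith)]; nlinarith [abs_nonneg v]
  have hout : 1 < |s * u| ∨ 1 < |s * v| := by
    rw [abs_mul, abs_mul, abs_of_pos (by linarith : 0 < s)]
    rcases max_choice |u| |v| with h | h
    · left; rw [← h]; simp only at hw; rw [hw]; linarith
    · right; rw [← h]; simp only at hw; rw [hw]; linarith
  rw [abs_le] at hsu hsv
  have hZ : tipInv (meridian s (u, v)) ∉ box := fun h => by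
    simp only [box, tipInv, meridian, mem_ofPred_eq] at h
    linarith
  have hZ' : tipInv (flip3 (meridian s (u, v))) ∉ box := fun h => by
    simp only [box, tipInv, meridian, flip3, mem_ofPred_eq] at h
    linarith
  refine ⟨?_, fun h => ?_, hZ, hZ'⟩
  · simp only [box, meridian, mem_ofPred_eq]
    refine ⟨?_, ?_, ?_, ?_, ?_, ?_⟩ <;> linarith
  · rw [mem_stage_succ] at h
    rcases h with h | h | (h | h) | (h | h) | h | h
    · simp only [face, meridian, mem_ofPred_eq] at h
      linarith
    · simp only [face, meridian, flip3, mem_ofPred_eq] at h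
      linarith
    · simp only [horn₀, meridian, mem_ofPred_eq] at h
      have e1 : |s * u| ≤ 1 := abs_le.2 ⟨by linarith, by linarith⟩
      have e2 : |s * v| ≤ 1 := abs_le.2 ⟨by linarith, by linarith⟩
      rcases hout with h | h <;> linarith
    · simp only [horn₁, meridian, mem_ofPred_eq] at h
      linarith
    · simp only [horn₀, meridian, flip3, mem_ofPred_eq] at h
      linarith
    · simp only [horn₁, meridian, flip3, mem_ofPred_eq] at h
      linarith
    · exact hZ h
    · exact hZ' h

theorem rootRule_meridian {n : ℕ} {s : St} {r : ℝ} {w w' : ℝ × ℝ} (hw : max |w.1| |w.2| = 1)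
    (hw' : max |w'.1| |w'.2| = 1) (h1 : 1 < r) (h2 : r ≤ 2) :
    rootRule lab c₀ c₁ s (tipMap^[n + 1] (meridian r w)) (tipMap^[n + 1] (meridian r w')) =
      cross (0 ≤ w.2) (0 ≤ w'.2) (if 0 < w'.1 then lab (c₀ (c₀^[n] s)) else 1) := by
  obtain ⟨p1, p2, p3, p4⟩ := meridian_prop hw h1 h2
  obtain ⟨q1, q2, -, -⟩ := meridian_prop hw' h1 h2
  have hr : 0 < r := by linarith
  rw [rootRule_iterate p1 (notMem_limitSet.2 ⟨1, p2⟩) q1 (notMem_limitSet.2 ⟨1, q2⟩),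
    limitRule_eq _ p2, stageRule_of_notMem _ _ _ p3 p4, claspRule]
  have hb : ∀ w : ℝ × ℝ, max |w.1| |w.2| = 1 → |r * w.1| ≤ 2 := fun w hw => by
    have : |w.1| ≤ 1 := (le_max_left _ _).trans hw.le
    rw [abs_mul, abs_of_pos hr]; nlinarith [abs_nonneg w.1]
  have b1 := abs_le.1 (hb w hw)
  have b2 := abs_le.1 (hb w' hw')
  have e : (meridian r w').1 < profile (meridian r w').2.1 ↔ 0 < w'.1 := by
    simp only [meridian, profile, lt_min_iff]
    refine ⟨fun h => ?_, fun h => ⟨by linarith, ?_, by linarith⟩⟩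
    · have : 0 < r * w'.1 := by linarith [h.2.1]
      exact pos_of_mul_pos_right this hr.le
    · have := mul_pos hr h
      linarith
  have e2 : (meridian r w').2.1 < 0 := by simp only [meridian]; linarith
  have e3 : ∀ w : ℝ × ℝ, (0 ≤ (meridian r w).2.2) = (0 ≤ w.2) := fun w => by
    simp only [meridian, eq_iff_iff]
    exact ⟨fun h => nonneg_of_mul_nonneg_right h hr, fun h => mul_nonneg hr.le h⟩
  rw [cross_of_iff, one_mul, factorZ, e3, e3]
  · simp only [e, e2, if_true]
  · have e4 : (meridian r w).2.1 < 0 := by simp only [meridian]; linarith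
    rw [← not_lt, ← not_lt]
    simp [e2, e4]

end HornLimit

section HornLoops

open Topology Filter unitInterval

/-- An infinitely divisible system of commutators in a finite group. -/
theorem exists_commutator_system : ∃ (St : Type) (lab : St → Equiv.Perm (Fin 5))
    (c₀ c₁ : St → St) (ι : ℕ → St),
    (∀ s, lab s = (lab (c₀ s))⁻¹ * (lab (c₁ s))⁻¹ * lab (c₀ s) * lab (c₁ s)) ∧
    (∀ n, lab (ι n) = 1) ∧ (∀ n, lab (c₀ (c₀^[n] (ι n))) ≠ 1) ∧
    ∀ i j, i < j → lab (c₀ (c₀^[i] (ι j))) = 1 := by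
  let P : Equiv.Perm (Fin 5) → Prop := fun x => x = 1 ∨ x.IsThreeCycle
  have key : ∀ x : {x // P x}, ∃ a b : {x // P x}, x.1 = a.1⁻¹ * b.1⁻¹ * a.1 * b.1 := by
    rintro ⟨x, hx | hx⟩
    · exact ⟨⟨1, Or.inl rfl⟩, ⟨1, Or.inl rfl⟩, by simp [hx]⟩
    let a : Equiv.Perm (Fin 5) := Equiv.swap 0 1 * Equiv.swap 0 2
    let b : Equiv.Perm (Fin 5) := Equiv.swap 0 3 * Equiv.swap 0 4
    have ha : a.IsThreeCycle :=
      Equiv.Perm.isThreeCycle_swap_mul_swap_same (by decide) (by decide) (by decide)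
    have hb : b.IsThreeCycle :=
      Equiv.Perm.isThreeCycle_swap_mul_swap_same (by decide) (by decide) (by decide)
    have hc : (a⁻¹ * b⁻¹ * a * b).IsThreeCycle := by
      rw [← card_support_eq_three_iff]
      decide
    obtain ⟨π, hπ⟩ := isConj_iff.1 ((Equiv.Perm.isConj_iff_cycleType_eq).2 (hc.trans hx.symm))
    have conj : ∀ {y : Equiv.Perm (Fin 5)}, y.IsThreeCycle → (π * y * π⁻¹).IsThreeCycle :=
      fun {y} hy => by
        rw [Equiv.Perm.IsThreeCycle, Equiv.Perm.cycleType_conj]; exact hy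
    refine ⟨⟨_, Or.inr (conj ha)⟩, ⟨_, Or.inr (conj hb)⟩, ?_⟩
    simp only [← hπ]
    group
  choose A B hAB using key
  have h3 : (Equiv.swap 0 1 * Equiv.swap 0 2 : Equiv.Perm (Fin 5)).IsThreeCycle :=
    Equiv.Perm.isThreeCycle_swap_mul_swap_same (by decide) (by decide) (by decide)
  let one : {x // P x} := ⟨1, Or.inl rfl⟩
  let c₀ : ℕ ⊕ {x // P x} → ℕ ⊕ {x // P x} := fun s => match s with
    | .inl 0 => .inr ⟨_, Or.inr h3⟩
    | .inl (n + 1) => .inl n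
    | .inr x => .inr (A x)
  have hit : ∀ n k, c₀^[n] (.inl (n + k)) = .inl k := by
    intro n k
    induction n with
    | zero => simp
    | succ n ih =>
      rw [Function.iterate_succ_apply, ← ih, show n + 1 + k = (n + k) + 1 by ring]
  refine ⟨ℕ ⊕ {x // P x}, Sum.elim (fun _ => 1) Subtype.val, c₀,
    Sum.elim (fun _ => .inr one) (fun x => .inr (B x)), Sum.inl, ?_, fun _ => rfl, ?_, ?_⟩
  · rintro ((_ | n) | x)
    · simp only [c₀, one, Sum.elim_inl, Sum.elim_inr]; group
    · simp [c₀, one]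
    · simpa [c₀] using hAB x
  · intro n
    have := hit n 0
    rw [add_zero] at this
    rw [this]
    simp only [c₀, Sum.elim_inr]
    decide
  · intro i j hij
    obtain ⟨k, rfl⟩ := Nat.exists_eq_add_of_lt hij
    rw [add_assoc, hit]
    rfl

/-- The square loop. -/
abbrev Square := Metric.sphere (0 : ℝ × ℝ) 1

theorem mem_square {w : ℝ × ℝ} : w ∈ Square ↔ max |w.1| |w.2| = 1 := by
  rw [mem_sphere_zero_iff_norm, Prod.norm_def, Real.norm_eq_abs, Real.norm_eq_abs]

theorem IsTriv.eq_of_isPreconnected {α F : Type*} [TopologicalSpace α] [Group F]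
    {g : α → α → F} {h : α → F}
    (hh : ∀ x ∈ univ, ∃ N ∈ 𝓝[univ] x, ∀ p ∈ N, ∀ q ∈ N, g p q = (h p)⁻¹ * h q)
    {J : Set ℝ} (hJ : IsPreconnected J) {γ : ℝ → α} (hγ : Continuous γ)
    (h1 : ∀ s ∈ J, ∀ t ∈ J, g (γ s) (γ t) = 1) {s t : ℝ} (hs : s ∈ J) (ht : t ∈ J) :
    h (γ s) = h (γ t) := by
  refine hJ.induction₂ (fun s t => h (γ s) = h (γ t)) (fun x hx => ?_)
      (fun _ _ _ _ _ _ h h' => h.trans h') (fun _ _ _ _ h => h.symm) hs ht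
  obtain ⟨N, hN, hs⟩ := hh (γ x) (mem_univ _)
  rw [nhdsWithin_univ] at hN
  filter_upwards [self_mem_nhdsWithin, mem_nhdsWithin_of_mem_nhds (hγ.continuousAt hN)]
    with y hy hyN
  have := hs _ (mem_of_mem_nhds hN) _ hyN
  rw [h1 x hx y hy] at this
  rwa [eq_inv_mul_iff_mul_eq, mul_one] at this

theorem eq_one_of_isTriv_square {F : Type} [Group F] {g : Square → Square → F} {a : F}
    (hg : ∀ p q : Square, g p q =
      cross (0 ≤ p.1.2) (0 ≤ q.1.2) (if 0 < q.1.1 then a else 1)) (ht : IsTriv g univ) :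
    a = 1 := by
  obtain ⟨h, hh⟩ := ht
  have hsq : ∀ t ε : ℝ, |ε| = 1 → -2 ≤ t → t ≤ 2 →
      ((max (-1) (min 1 t), ε * min 1 (2 - |t|)) : ℝ × ℝ) ∈ Square := by
    intro t ε hε h1 h2
    rw [mem_square, abs_mul, hε, one_mul]
    have ht : |t| ≤ 2 := abs_le.2 ⟨h1, h2⟩
    have e2 : |min 1 (2 - |t|)| = min 1 (2 - |t|) := abs_of_nonneg (le_min zero_le_one (by linarith))
    simp only [e2]
    rcases le_total |t| 1 with h3 | h3
    · rw [min_eq_left (by linarith : (1:ℝ) ≤ 2 - |t|)]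
      refine max_eq_right ?_
      exact abs_le.2 ⟨le_max_left _ _, max_le (by norm_num) (min_le_left _ _)⟩
    · rw [min_eq_right (by linarith : 2 - |t| ≤ 1)]
      have : |max (-1) (min 1 t)| = 1 := by
        rcases le_abs.1 h3 with h | h
        · rw [min_eq_left h]; norm_num
        · rw [max_eq_left ((min_le_right _ _).trans (by linarith))]; norm_num
      rw [this]
      exact max_eq_left (by linarith)
  have hcl : ∀ t : ℝ, -2 ≤ max (-2) (min 2 t) ∧ max (-2) (min 2 t) ≤ 2 := fun t =>
    ⟨le_max_left _ _, max_le (by norm_num) (min_le_left _ _)⟩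
  let c : ℝ → ℝ := fun t => max (-2) (min 2 t)
  have hc : ∀ t, -2 ≤ t → t ≤ 2 → c t = t := fun t h1 h2 => by
    simp only [c]; rw [min_eq_right h2, max_eq_right h1]
  let γ : ℝ → ℝ → Square := fun ε t =>
    if hε : |ε| = 1 then ⟨_, hsq (c t) ε hε (hcl t).1 (hcl t).2⟩ else ⟨_, hsq 0 1 (by simp) (by norm_num) (by norm_num)⟩
  have hγ : ∀ ε, |ε| = 1 → ∀ t, -2 ≤ t → t ≤ 2 →
      (γ ε t).1 = (max (-1) (min 1 t), ε * min 1 (2 - |t|)) := fun ε hε t h1 h2 => by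
    simp only [γ, dif_pos hε, hc t h1 h2]
  have hγc : ∀ ε, |ε| = 1 → Continuous (γ ε) := fun ε hε => by
    simp only [γ, dif_pos hε, c]
    refine Continuous.subtype_mk ?_ _
    fun_prop
  have a1 : |(1:ℝ)| = 1 := by simp
  have a2 : |(-1:ℝ)| = 1 := by simp
  have up : ∀ t ∈ Icc (-2:ℝ) 2, 0 ≤ (γ 1 t).1.2 := fun t ht => by
    rw [hγ 1 a1 t ht.1 ht.2]
    simpa using abs_le.2 ht
  have dn : ∀ t ∈ Ioo (-2:ℝ) 2, ¬ 0 ≤ (γ (-1) t).1.2 := fun t ht => by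
    rw [hγ _ a2 t ht.1.le ht.2.le]
    simpa using abs_lt.2 ht
  have E1 : h (γ 1 (-2)) = h (γ 1 2) := by
    refine IsTriv.eq_of_isPreconnected hh isPreconnected_Icc (hγc 1 a1) (fun s hs t ht => ?_)
      (left_mem_Icc.2 (by norm_num)) (right_mem_Icc.2 (by norm_num))
    rw [hg, cross_of_iff (by simp [up s hs, up t ht])]
  have E2 : ∀ s ∈ Ioo (-2:ℝ) 2, ∀ t ∈ Ioo (-2:ℝ) 2, h (γ (-1) s) = h (γ (-1) t) := by
    intro s hs t ht
    refine IsTriv.eq_of_isPreconnected hh isPreconnected_Ioo (hγc _ a2) (fun s hs t ht => ?_) hs ht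
    rw [hg, cross_of_iff (by simp [dn s hs, dn t ht])]
  have R : γ 1 2 = γ (-1) 2 := Subtype.ext (by
    rw [hγ 1 a1 2 (by norm_num) le_rfl, hγ _ a2 2 (by norm_num) le_rfl]; norm_num)
  have L : γ 1 (-2) = γ (-1) (-2) := Subtype.ext (by
    rw [hγ 1 a1 (-2) le_rfl (by norm_num), hγ _ a2 (-2) le_rfl (by norm_num)]; norm_num)
  have near : ∀ x ∈ Icc (-2:ℝ) 2, (∀ᶠ t in 𝓝[Ioo (-2) 2] x, t ∈ Ioo (-2:ℝ) 2 ∧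
      |t - x| < 1 ∧ g (γ (-1) x) (γ (-1) t) = (h (γ (-1) x))⁻¹ * h (γ (-1) t)) := by
    intro x _
    obtain ⟨N, hN, hs⟩ := hh (γ (-1) x) (mem_univ _)
    rw [nhdsWithin_univ] at hN
    filter_upwards [self_mem_nhdsWithin, mem_nhdsWithin_of_mem_nhds ((hγc _ a2).continuousAt hN),
      mem_nhdsWithin_of_mem_nhds (Metric.ball_mem_nhds x one_pos)] with t h1 h2 h3
    exact ⟨h1, h3, hs _ (mem_of_mem_nhds hN) _ h2⟩
  have nR : (𝓝[Ioo (-2:ℝ) 2] (2:ℝ)).NeBot := by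
    rw [nhdsWithin_Ioo_eq_nhdsLT (by norm_num)]; infer_instance
  have nL : (𝓝[Ioo (-2:ℝ) 2] (-2:ℝ)).NeBot := by
    rw [nhdsWithin_Ioo_eq_nhdsGT (by norm_num)]; infer_instance
  obtain ⟨t, ht, ht1, ht2⟩ := (near 2 ⟨by norm_num, le_rfl⟩).exists
  obtain ⟨s, hs, hs1, hs2⟩ := (near (-2) ⟨le_rfl, by norm_num⟩).exists
  have ht3 := abs_lt.1 ht1
  have hs3 := abs_lt.1 hs1
  have e1 : (γ (-1) 2).1 = (1, 0) := by
    rw [hγ _ a2 2 (by norm_num) le_rfl]; norm_num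
  have e2 : (γ (-1) (-2)).1 = (-1, 0) := by
    rw [hγ _ a2 (-2) le_rfl (by norm_num)]; norm_num
  have e3 : 0 < (γ (-1) t).1.1 := by
    rw [hγ _ a2 t ht.1.le ht.2.le]
    exact lt_max_of_lt_right (lt_min one_pos (by linarith))
  have e4 : ¬ 0 < (γ (-1) s).1.1 := by
    rw [hγ _ a2 s hs.1.le hs.2.le]
    exact not_lt.2 (max_le (by norm_num) ((min_le_right _ _).trans (by linarith)))
  rw [hg, e1, if_pos e3, ← R, ← E1, L, E2 t ht s hs, ← hs2, hg, e2, if_neg e4, cross_one] at ht2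
  simpa [cross, dn t ht] using ht2

theorem not_isAttractor_of_hornedBall {e : R3 ≃ₜ V3} {S : Set V3} (hSB : S ⊆ hornedBall)
    (hS : ∀ x ∈ hornedBall, x ∉ S → hornedBall ∈ 𝓝 x)
    (hm : ∀ n, ∀ w ∈ Square, tipMap^[n + 1] (meridian 1 w) ∈ S) {U : Set R3} (hU : IsOpen U)
    {f : U → U} (hf : Continuous f) (hfi : Function.Injective f) :
    ¬ IsAttractor f (e ⁻¹' S) := by
  obtain ⟨St, lab, c₀, c₁, ι, hlab, h1, hne, heq⟩ := exists_commutator_system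
  let g : ℕ → R3 → R3 → Equiv.Perm (Fin 5) := fun n => pull e (rootRule lab c₀ c₁ (ι n))
  let m : ℕ → Square × I → R3 := fun n x =>
    e.symm (tipMap^[n + 1] (meridian (1 + x.2) x.1.1))
  have hsq : ∀ w : Square, max |w.1.1| |w.1.2| = 1 := fun w => mem_square.1 w.2
  have hs1 : ∀ s : I, s ≠ 0 → (1 : ℝ) < 1 + s := fun s hs => by
    have := unitInterval.pos_iff_ne_zero.2 hs
    have : (0 : ℝ) < s := this
    linarith
  have hs2 : ∀ s : I, (1 : ℝ) + s ≤ 2 := fun s => by linarith [s.2.2]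
  have hg : ∀ n, IsFlat (g n) (e ⁻¹' S)ᶜ := by
    intro n x hx
    obtain ⟨N, hN, s, hs⟩ := (flatAt_rootRule hlab (h1 n) (x := e x) fun h => hS _ h hx).comp
      e.continuous.continuousAt
    exact ⟨N, mem_nhdsWithin_of_mem_nhds hN, s, hs⟩
  have hpull : ∀ i j (s : I), s ≠ 0 → ∀ p q : Square,
      pull (fun x => m i (x, s)) (g j) p q = cross (0 ≤ p.1.2) (0 ≤ q.1.2)
        (if 0 < q.1.1 then lab (c₀ (c₀^[i] (ι j))) else 1) := by
    intro i j s hs p q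
    simp only [pull, g, m, e.apply_symm_apply]
    exact rootRule_meridian (hsq p) (hsq q) (hs1 s hs) (hs2 s)
  have hmc : ∀ n, Continuous (m n) := fun n => by
    refine e.symm.continuous.comp ((continuous_tipMap.iterate _).comp ?_)
    unfold meridian
    fun_prop
  refine not_isAttractor_of_cocycles hg hmc (fun n x => ?_) (fun n x s hs => ?_) (fun n => ?_)
    (fun i j hij s hs => ?_) hU hf hfi
  · simp only [m, mem_preimage, e.apply_symm_apply, Set.Icc.coe_zero, add_zero]
    exact hm n _ x.2
  · simp only [m, mem_preimage, e.apply_symm_apply]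
    obtain ⟨p1, p2, -, -⟩ := meridian_prop (hsq x) (hs1 s hs) (hs2 s)
    exact fun h => iterate_tipMap_notMem p1 (notMem_limitSet.2 ⟨1, p2⟩) n (hSB h)
  · exact fun h => hne n (eq_one_of_isTriv_square (hpull n n 1 one_ne_zero) h)
  · refine ⟨fun _ => 1, fun x _ => ⟨univ, by simp, fun p _ q _ => ?_⟩⟩
    rw [hpull i j s hs, heq i j hij]
    simp [cross_one]

end HornLoops

section HornSurface

open Topology Filter

theorem norm_le_iff_abs {p : V3} {c : ℝ} : ‖p‖ ≤ c ↔ |p.1| ≤ c ∧ |p.2.1| ≤ c ∧ |p.2.2| ≤ c := by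
  simp [Prod.norm_def, Real.norm_eq_abs]

theorem norm_le_iff_abs₂ {u : ℝ × ℝ} {c : ℝ} : ‖u‖ ≤ c ↔ |u.1| ≤ c ∧ |u.2| ≤ c := by
  simp [Prod.norm_def, Real.norm_eq_abs]

theorem lt_norm_iff_abs₂ {u : ℝ × ℝ} {c : ℝ} : c < ‖u‖ ↔ c < |u.1| ∨ c < |u.2| := by
  simp [Prod.norm_def, Real.norm_eq_abs]

/-- The linear part of `tipMap`. -/
def tipLin (p : V3) : V3 := (-p.2.2 / 10, p.1 / 10, p.2.1 / 20)

theorem tipLin_sub (p q : V3) : tipLin (p - q) = tipLin p - tipLin q := by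
  simp only [tipLin, Prod.fst_sub, Prod.snd_sub]
  ext <;> simp only [Prod.fst_sub, Prod.snd_sub] <;> ring

theorem flip3_sub (p q : V3) : flip3 (p - q) = flip3 p - flip3 q := by
  simp only [flip3, Prod.fst_sub, Prod.snd_sub]
  ext <;> simp only [Prod.fst_sub, Prod.snd_sub] <;> ring

theorem tipMap_add (p q : V3) : tipMap (p + q) = tipMap p + tipLin q := by
  simp only [tipMap, tipLin, Prod.fst_add, Prod.snd_add]
  ext <;> simp only [Prod.fst_add, Prod.snd_add] <;> ring

theorem flip3_add (p q : V3) : flip3 (p + q) = flip3 p + flip3 q := by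
  simp only [flip3, Prod.fst_add, Prod.snd_add]
  ext <;> simp only [Prod.fst_add, Prod.snd_add] <;> ring

theorem norm_tipLin_le (p : V3) : ‖tipLin p‖ ≤ ‖p‖ / 10 := by
  obtain ⟨h1, h2, h3⟩ := norm_le_iff_abs.1 (le_refl ‖p‖)
  rw [abs_le] at h1 h2 h3
  simp only [norm_le_iff_abs, tipLin, abs_le]
  refine ⟨⟨?_, ?_⟩, ⟨?_, ?_⟩, ⟨?_, ?_⟩⟩ <;> linarith

theorem norm_flip3 (p : V3) : ‖flip3 p‖ = ‖p‖ := by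
  simp only [flip3, Prod.norm_def, norm_neg]
  rw [max_comm ‖p.2.2‖]

theorem continuous_tipLin : Continuous tipLin := by unfold tipLin; fun_prop

/-- The parametrization of the face. -/
def faceMap (u : ℝ × ℝ) : V3 := (-20, 20 * u.1, 20 * u.2)

/-- The coordinate on the root of the first horn. -/
def root₀ (u : ℝ × ℝ) : ℝ × ℝ := (40 * u.2, 80 * u.1 + 56)

/-- The coordinate on the root of the second horn. -/
def root₁ (u : ℝ × ℝ) : ℝ × ℝ := (28 - 40 * u.1, 40 * u.2)

/-- The parametrization of the side of the first horn. -/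
def side₀ (t : ℝ) (w : ℝ × ℝ) : V3 :=
  (-20 + 4 * (8 - w.2 / 2) * t, -6 - (8 - w.2 / 2) * (1 - t), w.1)

/-- The parametrization of the side of the second horn. -/
def side₁ (t : ℝ) (w : ℝ × ℝ) : V3 :=
  (-20 + 2 * (16 - w.1) * t, -2 + (16 - w.1) * (1 - t), w.2)

open Classical in
/-- The displacement of the root of a horn onto its side. -/
def hornPiece (L : ℝ → ℝ × ℝ → V3) (w : ℝ × ℝ → ℝ × ℝ) (u : ℝ × ℝ) : V3 :=
  if ‖w u‖ ≤ 2 then L (min 1 (2 - ‖w u‖)) ((max 1 ‖w u‖)⁻¹ • w u) - faceMap u else 0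

theorem hornPiece_of_two_le {L : ℝ → ℝ × ℝ → V3} {w : ℝ × ℝ → ℝ × ℝ}
    (h : ∀ u, L 0 ((2 : ℝ)⁻¹ • w u) = faceMap u) {u : ℝ × ℝ} (hu : 2 ≤ ‖w u‖) :
    hornPiece L w u = 0 := by
  rcases hu.eq_or_lt with h2 | h2
  · have e1 : min (1 : ℝ) (2 - 2) = 0 := by norm_num
    have e2 : max (1 : ℝ) 2 = 2 := by norm_num
    rw [hornPiece, if_pos h2.ge, ← h2, e1, e2, h u, sub_self]
  · rw [hornPiece, if_neg (not_le.2 h2)]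

theorem continuous_faceMap : Continuous faceMap := by unfold faceMap; fun_prop

theorem continuous_root₀ : Continuous root₀ := by unfold root₀; fun_prop

theorem continuous_root₁ : Continuous root₁ := by unfold root₁; fun_prop

theorem continuous_hornPiece {L : ℝ → ℝ × ℝ → V3} {w : ℝ × ℝ → ℝ × ℝ}
    (hL : Continuous fun x : ℝ × (ℝ × ℝ) => L x.1 x.2) (hw : Continuous w)
    (h : ∀ u, L 0 ((2 : ℝ)⁻¹ • w u) = faceMap u) : Continuous (hornPiece L w) := by
  refine Continuous.if_le ?_ continuous_const hw.norm continuous_const fun u hu => ?_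
  · have e1 : Continuous fun u => min (1 : ℝ) (2 - ‖w u‖) := by fun_prop
    have e2 : Continuous fun u => (max (1 : ℝ) ‖w u‖)⁻¹ :=
      Continuous.inv₀ (by fun_prop) fun u => (lt_max_of_lt_left one_pos).ne'
    exact (hL.comp (e1.prodMk (e2.smul hw))).sub continuous_faceMap
  · have := hornPiece_of_two_le h hu.ge
    rwa [hornPiece, if_pos hu.le] at this

theorem side₀_zero (u : ℝ × ℝ) : side₀ 0 ((2 : ℝ)⁻¹ • root₀ u) = faceMap u := by
  simp only [side₀, root₀, faceMap, Prod.smul_mk, smul_eq_mul]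
  ext <;> dsimp only <;> ring

theorem side₁_zero (u : ℝ × ℝ) : side₁ 0 ((2 : ℝ)⁻¹ • root₁ u) = faceMap u := by
  simp only [side₁, root₁, faceMap, Prod.smul_mk, smul_eq_mul]
  ext <;> dsimp only <;> ring

theorem side₀_one (w : ℝ × ℝ) : side₀ 1 w = tipMap (faceMap w) := by
  simp only [side₀, tipMap, faceMap]
  ext <;> dsimp only <;> ring

theorem side₁_one (w : ℝ × ℝ) : side₁ 1 w = tipMap (flip3 (faceMap w)) := by
  simp only [side₁, tipMap, flip3, faceMap]
  ext <;> dsimp only <;> ring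

theorem two_le_norm_root₁ {u : ℝ × ℝ} (h : ‖root₀ u‖ ≤ 2) : 2 ≤ ‖root₁ u‖ := by
  simp only [norm_le_iff_abs₂, root₀, abs_le] at h
  refine (lt_norm_iff_abs₂.2 (Or.inl ?_)).le
  simp only [root₁]
  exact lt_abs.2 (Or.inl (by linarith))

theorem two_lt_norm_root₀ {u : ℝ × ℝ} (h : 1 ≤ ‖u‖) : 2 < ‖root₀ u‖ := by
  by_contra! h'
  refine h.not_gt ?_
  simp only [norm_le_iff_abs₂, root₀, abs_le] at h'
  simp only [Prod.norm_def, Real.norm_eq_abs, max_lt_iff, abs_lt]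
  refine ⟨⟨?_, ?_⟩, ⟨?_, ?_⟩⟩ <;> linarith

theorem two_lt_norm_root₁ {u : ℝ × ℝ} (h : 1 ≤ ‖u‖) : 2 < ‖root₁ u‖ := by
  by_contra! h'
  refine h.not_gt ?_
  simp only [norm_le_iff_abs₂, root₁, abs_le] at h'
  simp only [Prod.norm_def, Real.norm_eq_abs, max_lt_iff, abs_lt]
  refine ⟨⟨?_, ?_⟩, ⟨?_, ?_⟩⟩ <;> linarith

/-- The displacement of the face onto the horned disc. -/
theorem exists_displacement : ∃ k : ℝ × ℝ → V3, Continuous k ∧ (∀ u, 1 ≤ ‖u‖ → k u = 0) ∧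
    ∀ u, k u = hornPiece side₀ root₀ u + hornPiece side₁ root₁ u + tipLin (k (root₀ u)) +
      tipLin (flip3 (k (root₁ u))) := by
  let k₁ : ℝ × ℝ → V3 := fun u => hornPiece side₀ root₀ u + hornPiece side₁ root₁ u
  have hk₁ : Continuous k₁ :=
    (continuous_hornPiece (by unfold side₀; fun_prop) continuous_root₀ side₀_zero).add
      (continuous_hornPiece (by unfold side₁; fun_prop) continuous_root₁ side₁_zero)
  have hz : ∀ u, 1 ≤ ‖u‖ → k₁ u = 0 := fun u hu => by
    simp only [k₁]
    rw [hornPiece_of_two_le side₀_zero (two_lt_norm_root₀ hu).le,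
      hornPiece_of_two_le side₁_zero (two_lt_norm_root₁ hu).le, add_zero]
  obtain ⟨C, hC⟩ := hk₁.bounded_above_of_compact_support
    (HasCompactSupport.intro (isCompact_closedBall (0 : ℝ × ℝ) 1) fun u hu => hz u (by
      rw [mem_closedBall_zero_iff, not_le] at hu; exact hu.le))
  let Φ : BoundedContinuousFunction (ℝ × ℝ) V3 → BoundedContinuousFunction (ℝ × ℝ) V3 := fun k =>
    BoundedContinuousFunction.ofNormedAddCommGroup
      (fun u => k₁ u + tipLin (k (root₀ u)) + tipLin (flip3 (k (root₁ u))))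
      ((hk₁.add (continuous_tipLin.comp (k.continuous.comp continuous_root₀))).add
        (continuous_tipLin.comp (continuous_flip3.comp (k.continuous.comp continuous_root₁))))
      (C + ‖k‖ / 10 + ‖k‖ / 10) fun u => by
        refine (norm_add_le _ _).trans (add_le_add ((norm_add_le _ _).trans
          (add_le_add (hC u) ((norm_tipLin_le _).trans ?_))) ((norm_tipLin_le _).trans ?_))
        · gcongr; exact k.norm_coe_le_norm _
        · rw [norm_flip3]; gcongr; exact k.norm_coe_le_norm _
  have hΦ : ContractingWith (1 / 5) Φ := by
    refine ⟨by rw [← NNReal.coe_lt_coe]; norm_num, LipschitzWith.of_dist_le_mul fun k k' => ?_⟩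
    rw [BoundedContinuousFunction.dist_le (by positivity)]
    intro u
    have e : Φ k u - Φ k' u = tipLin (k (root₀ u) - k' (root₀ u)) +
        tipLin (flip3 (k (root₁ u) - k' (root₁ u))) := by
      simp only [Φ, BoundedContinuousFunction.coe_ofNormedAddCommGroup, tipLin_sub, flip3_sub]
      abel
    rw [dist_eq_norm, e]
    have b1 : ‖k (root₀ u) - k' (root₀ u)‖ ≤ dist k k' := by
      rw [← dist_eq_norm]; exact BoundedContinuousFunction.dist_coe_le_dist _
    have b2 : ‖k (root₁ u) - k' (root₁ u)‖ ≤ dist k k' := by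
      rw [← dist_eq_norm]; exact BoundedContinuousFunction.dist_coe_le_dist _
    have b3 := norm_tipLin_le (k (root₀ u) - k' (root₀ u))
    have b4 := norm_tipLin_le (flip3 (k (root₁ u) - k' (root₁ u)))
    rw [norm_flip3] at b4
    have : ((1 / 5 : NNReal) : ℝ) = 1 / 5 := by norm_num
    rw [this]
    linarith [norm_add_le (tipLin (k (root₀ u) - k' (root₀ u)))
      (tipLin (flip3 (k (root₁ u) - k' (root₁ u))))]
  let k := hΦ.fixedPoint
  have hk : ∀ u, k u = k₁ u + tipLin (k (root₀ u)) + tipLin (flip3 (k (root₁ u))) := fun u => by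
    have : Φ k = k := hΦ.fixedPoint_isFixedPt
    conv_lhs => rw [← this]
    rfl
  refine ⟨k, k.continuous, fun u hu => ?_, hk⟩
  have bound : ∀ n : ℕ, ∀ u, 1 ≤ ‖u‖ → ‖k u‖ ≤ ‖k‖ * (1 / 5) ^ n := by
    intro n
    induction n with
    | zero => intro u _; simpa using k.norm_coe_le_norm u
    | succ n ih =>
      intro u hu
      rw [hk, hz u hu, zero_add]
      have b1 := ih _ (one_le_two.trans (two_lt_norm_root₀ hu).le)
      have b2 := ih _ (one_le_two.trans (two_lt_norm_root₁ hu).le)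
      have b3 := norm_tipLin_le (k (root₀ u))
      have b4 := norm_tipLin_le (flip3 (k (root₁ u)))
      rw [norm_flip3] at b4
      rw [pow_succ]
      linarith [norm_add_le (tipLin (k (root₀ u))) (tipLin (flip3 (k (root₁ u))))]
  have lim : Tendsto (fun n : ℕ => ‖k‖ * (1 / 5 : ℝ) ^ n) atTop (𝓝 (‖k‖ * 0)) :=
    (tendsto_pow_atTop_nhds_zero_of_lt_one (by norm_num) (by norm_num)).const_mul _
  rw [mul_zero] at lim
  exact norm_le_zero_iff.1 (ge_of_tendsto' lim fun n => bound n u hu)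

/-- A displacement of the face onto the horned disc. -/
def displacement : ℝ × ℝ → V3 := exists_displacement.choose

theorem continuous_displacement : Continuous displacement := exists_displacement.choose_spec.1

theorem displacement_of_one_le {u : ℝ × ℝ} (hu : 1 ≤ ‖u‖) : displacement u = 0 :=
  exists_displacement.choose_spec.2.1 u hu

theorem displacement_eq (u : ℝ × ℝ) : displacement u = hornPiece side₀ root₀ u +
    hornPiece side₁ root₁ u + tipLin (displacement (root₀ u)) +
      tipLin (flip3 (displacement (root₁ u))) :=
  exists_displacement.choose_spec.2.2 u

theorem tipLin_zero : tipLin 0 = 0 := by simp [tipLin]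

theorem flip3_zero : flip3 0 = 0 := by simp [flip3]

/-- The parametrization of the horned disc. -/
def hornedDisc (u : ℝ × ℝ) : V3 := faceMap u + displacement u

theorem continuous_hornedDisc : Continuous hornedDisc :=
  continuous_faceMap.add continuous_displacement

theorem hornedDisc_of_two_le {u : ℝ × ℝ} (h0 : 2 ≤ ‖root₀ u‖) (h1 : 2 ≤ ‖root₁ u‖) :
    hornedDisc u = faceMap u := by
  rw [hornedDisc, displacement_eq, hornPiece_of_two_le side₀_zero h0,
    hornPiece_of_two_le side₁_zero h1, displacement_of_one_le (one_le_two.trans h0),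
    displacement_of_one_le (one_le_two.trans h1), flip3_zero, tipLin_zero]
  simp

theorem hornedDisc_of_norm_root₀_le_one {u : ℝ × ℝ} (h : ‖root₀ u‖ ≤ 1) :
    hornedDisc u = tipMap (hornedDisc (root₀ u)) := by
  have h1 := two_le_norm_root₁ (h.trans one_le_two)
  have e : min (1 : ℝ) (2 - ‖root₀ u‖) = 1 := min_eq_left (by linarith)
  rw [hornedDisc, displacement_eq, hornPiece_of_two_le side₁_zero h1,
    displacement_of_one_le (one_le_two.trans h1), flip3_zero, tipLin_zero, hornPiece,
    if_pos (h.trans one_le_two), max_eq_left h, e, inv_one, one_smul, side₀_one,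
    hornedDisc, tipMap_add]
  abel

theorem hornedDisc_of_norm_root₁_le_one {u : ℝ × ℝ} (h : ‖root₁ u‖ ≤ 1) :
    hornedDisc u = tipMap (flip3 (hornedDisc (root₁ u))) := by
  have h1 : 2 ≤ ‖root₀ u‖ := by
    by_contra! h0
    linarith [two_le_norm_root₁ h0.le]
  have e : min (1 : ℝ) (2 - ‖root₁ u‖) = 1 := min_eq_left (by linarith)
  rw [hornedDisc, displacement_eq, hornPiece_of_two_le side₀_zero h1,
    displacement_of_one_le (one_le_two.trans h1), tipLin_zero, hornPiece,
    if_pos (h.trans one_le_two), max_eq_left h, e, inv_one, one_smul, side₁_one,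
    hornedDisc, flip3_add, tipMap_add]
  abel

theorem hornedDisc_of_norm_root₀_le_two {u : ℝ × ℝ} (h : 1 ≤ ‖root₀ u‖) (h2 : ‖root₀ u‖ ≤ 2) :
    hornedDisc u = side₀ (2 - ‖root₀ u‖) (‖root₀ u‖⁻¹ • root₀ u) := by
  have h1 := two_le_norm_root₁ h2
  rw [hornedDisc, displacement_eq, hornPiece_of_two_le side₁_zero h1,
    displacement_of_one_le (one_le_two.trans h1), displacement_of_one_le h, flip3_zero,
    tipLin_zero, hornPiece, if_pos h2, max_eq_right h, min_eq_right (by linarith)]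
  abel

theorem hornedDisc_of_norm_root₁_le_two {u : ℝ × ℝ} (h : 1 ≤ ‖root₁ u‖) (h2 : ‖root₁ u‖ ≤ 2) :
    hornedDisc u = side₁ (2 - ‖root₁ u‖) (‖root₁ u‖⁻¹ • root₁ u) := by
  have h1 : 2 ≤ ‖root₀ u‖ := by
    by_contra! h0
    simp only [norm_le_iff_abs₂, root₁, abs_le] at h2
    simp only [Prod.norm_def, Real.norm_eq_abs, max_lt_iff, abs_lt, root₀] at h0
    linarith
  rw [hornedDisc, displacement_eq, hornPiece_of_two_le side₀_zero h1,
    displacement_of_one_le (one_le_two.trans h1), displacement_of_one_le h, flip3_zero,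
    tipLin_zero, hornPiece, if_pos h2, max_eq_right h, min_eq_right (by linarith)]
  abel

end HornSurface

section HornDisc

open Topology Filter

theorem hornedDisc_cases (u : ℝ × ℝ) : hornedDisc u = faceMap u ∨
    (∃ t w, 0 < t ∧ t < 1 ∧ ‖w‖ ≤ 1 ∧ root₀ u = (2 - t) • w ∧ hornedDisc u = side₀ t w) ∨
    (∃ t w, 0 < t ∧ t < 1 ∧ ‖w‖ ≤ 1 ∧ root₁ u = (2 - t) • w ∧ hornedDisc u = side₁ t w) ∨
    (‖root₀ u‖ ≤ 1 ∧ hornedDisc u = tipMap (hornedDisc (root₀ u))) ∨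
    ‖root₁ u‖ ≤ 1 ∧ hornedDisc u = tipMap (flip3 (hornedDisc (root₁ u))) := by
  have aux : ∀ w : ℝ × ℝ, 1 < ‖w‖ → ‖‖w‖⁻¹ • w‖ ≤ 1 ∧ w = (2 - (2 - ‖w‖)) • ‖w‖⁻¹ • w :=
    fun w hw => by
      have : ‖w‖ ≠ 0 := by linarith
      rw [norm_smul, norm_inv, norm_norm, inv_mul_cancel₀ this, sub_sub_cancel, smul_smul,
        mul_inv_cancel₀ this, one_smul]
      exact ⟨le_rfl, rfl⟩
  rcases le_or_gt ‖root₀ u‖ 1 with h | h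
  · exact .inr (.inr (.inr (.inl ⟨h, hornedDisc_of_norm_root₀_le_one h⟩)))
  rcases le_or_gt ‖root₁ u‖ 1 with h1 | h1
  · exact .inr (.inr (.inr (.inr ⟨h1, hornedDisc_of_norm_root₁_le_one h1⟩)))
  rcases lt_or_ge ‖root₀ u‖ 2 with h2 | h2
  · obtain ⟨a, b⟩ := aux _ h
    exact .inr (.inl ⟨_, _, by linarith, by linarith, a, b,
      hornedDisc_of_norm_root₀_le_two h.le h2.le⟩)
  rcases lt_or_ge ‖root₁ u‖ 2 with h3 | h3
  · obtain ⟨a, b⟩ := aux _ h1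
    exact .inr (.inr (.inl ⟨_, _, by linarith, by linarith, a, b,
      hornedDisc_of_norm_root₁_le_two h1.le h3.le⟩))
  exact .inl (hornedDisc_of_two_le h2 h3)

theorem side₀_mem {t : ℝ} {w : ℝ × ℝ} (h0 : 0 ≤ t) (h1 : t ≤ 1) (hw : ‖w‖ ≤ 1) :
    side₀ t w ∈ horn₀ := by
  simp only [norm_le_iff_abs₂, abs_le] at hw
  have a := mul_nonneg (by linarith : 0 ≤ 8 - w.2 / 2) h0
  have b := mul_nonneg (by linarith : 0 ≤ 8 - w.2 / 2) (sub_nonneg.2 h1)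
  simp only [horn₀, side₀, mem_ofPred_eq]
  refine ⟨?_, ?_, ?_, ?_, ?_, ?_⟩ <;> linarith

theorem side₁_mem {t : ℝ} {w : ℝ × ℝ} (h0 : 0 ≤ t) (h1 : t ≤ 1) (hw : ‖w‖ ≤ 1) :
    side₁ t w ∈ horn₁ := by
  simp only [norm_le_iff_abs₂, abs_le] at hw
  have a := mul_nonneg (by linarith : 0 ≤ 16 - w.1) h0
  have b := mul_nonneg (by linarith : 0 ≤ 16 - w.1) (sub_nonneg.2 h1)
  simp only [horn₁, side₁, mem_ofPred_eq]
  refine ⟨?_, ?_, ?_, ?_, ?_, ?_⟩ <;> linarith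

theorem faceMap_mem {u : ℝ × ℝ} (hu : ‖u‖ ≤ 1) : faceMap u ∈ face := by
  simp only [norm_le_iff_abs₂, abs_le] at hu
  simp only [face, faceMap, mem_ofPred_eq]
  refine ⟨trivial, ?_, ?_, ?_, ?_⟩ <;> linarith

theorem mem_box_iff_norm {p : V3} : p ∈ box ↔ ‖p‖ ≤ 20 := by
  simp only [box, norm_le_iff_abs, abs_le, mem_ofPred_eq, and_assoc]

theorem norm_tipMap_le (p : V3) : ‖tipMap p‖ ≤ 12 + ‖p‖ / 10 := by
  obtain ⟨h1, h2, h3⟩ := norm_le_iff_abs.1 (le_refl ‖p‖)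
  rw [abs_le] at h1 h2 h3
  simp only [norm_le_iff_abs, tipMap, abs_le]
  refine ⟨⟨?_, ?_⟩, ⟨?_, ?_⟩, ⟨?_, ?_⟩⟩ <;> linarith

theorem face_subset_box : face ⊆ box := fun p h => by
  simp only [box, face, mem_ofPred_eq] at h ⊢
  refine ⟨?_, ?_, ?_, ?_, ?_, ?_⟩ <;> linarith

theorem horn₀_subset_box : horn₀ ⊆ box := fun p h => by
  simp only [box, horn₀, mem_ofPred_eq] at h ⊢
  refine ⟨?_, ?_, ?_, ?_, ?_, ?_⟩ <;> linarith

theorem horn₁_subset_box : horn₁ ⊆ box := fun p h => by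
  simp only [box, horn₁, mem_ofPred_eq] at h ⊢
  refine ⟨?_, ?_, ?_, ?_, ?_, ?_⟩ <;> linarith

theorem hornedDisc_mem_box {u : ℝ × ℝ} (hu : ‖u‖ ≤ 1) : hornedDisc u ∈ box := by
  obtain ⟨v, hv, hm⟩ := (isCompact_closedBall (0 : ℝ × ℝ) 1).exists_isMaxOn
    ⟨0, by simp⟩ continuous_hornedDisc.norm.continuousOn
  replace hm : ∀ x : ℝ × ℝ, ‖x‖ ≤ 1 → ‖hornedDisc x‖ ≤ ‖hornedDisc v‖ := fun x hx =>
    hm (mem_closedBall_zero_iff.2 hx)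
  rw [mem_closedBall_zero_iff] at hv
  rw [mem_box_iff_norm]
  refine (hm u hu).trans ?_
  rcases hornedDisc_cases v with h | ⟨t, w, h0, h1, hw, -, h⟩ | ⟨t, w, h0, h1, hw, -, h⟩ |
    ⟨hw, h⟩ | ⟨hw, h⟩
  · rw [h]; exact mem_box_iff_norm.1 (face_subset_box (faceMap_mem hv))
  · rw [h]; exact mem_box_iff_norm.1 (horn₀_subset_box (side₀_mem h0.le h1.le hw))
  · rw [h]; exact mem_box_iff_norm.1 (horn₁_subset_box (side₁_mem h0.le h1.le hw))
  · have := norm_tipMap_le (hornedDisc (root₀ v))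
    rw [← h] at this
    linarith [hm _ hw]
  · have := norm_tipMap_le (flip3 (hornedDisc (root₁ v)))
    rw [← h, norm_flip3] at this
    linarith [hm _ hw]

theorem flip3_mem_limitSet {p : V3} (h : p ∈ limitSet) : flip3 p ∈ limitSet := by
  simp only [limitSet, mem_iInter] at h ⊢
  exact fun n => flip3_mem_stage (h n)

theorem hornedDisc_mem_limitSet {u : ℝ × ℝ} (hu : ‖u‖ ≤ 1) : hornedDisc u ∈ limitSet := by
  refine mem_iInter.2 fun n => ?_
  induction n generalizing u with
  | zero => exact hornedDisc_mem_box hu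
  | succ n ih =>
    rw [mem_stage_succ]
    rcases hornedDisc_cases u with h | ⟨t, w, h0, h1, hw, -, h⟩ | ⟨t, w, h0, h1, hw, -, h⟩ |
      ⟨hw, h⟩ | ⟨hw, h⟩ <;> rw [h]
    · exact .inl (faceMap_mem hu)
    · exact .inr (.inr (.inl (.inl (side₀_mem h0.le h1.le hw))))
    · exact .inr (.inr (.inl (.inr (side₁_mem h0.le h1.le hw))))
    · rw [tipInv_tipMap]
      exact .inr (.inr (.inr (.inr (.inl (ih hw)))))
    · rw [tipInv_tipMap]
      exact .inr (.inr (.inr (.inr (.inl (flip3_mem_stage (ih hw))))))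

theorem hornedDisc_mem_hornedBall {u : ℝ × ℝ} (hu : ‖u‖ ≤ 1) : hornedDisc u ∈ hornedBall := by
  rcases hornedDisc_cases u with h | ⟨t, w, h0, h1, hw, -, h⟩ | ⟨t, w, h0, h1, hw, -, h⟩ |
    ⟨hw, h⟩ | ⟨hw, h⟩ <;> rw [h]
  · refine .inl (.inl ?_)
    obtain ⟨h1, h2, h3, h4, h5⟩ := faceMap_mem hu
    exact ⟨by linarith, h1.le, h2, h3, h4, h5⟩
  · exact .inl (.inr (.inl (side₀_mem h0.le h1.le hw)))
  · exact .inl (.inr (.inr (side₁_mem h0.le h1.le hw)))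
  · refine .inr ?_
    rw [mem_preimage, tipInv_tipMap]
    exact hornedDisc_mem_limitSet hw
  · refine .inr ?_
    rw [mem_preimage, tipInv_tipMap]
    exact flip3_mem_limitSet (hornedDisc_mem_limitSet hw)

theorem tipMap_mem_of_mem_box {p : V3} (hp : p ∈ box) : 10 ≤ (tipMap p).1 ∧ (tipMap p).1 ≤ 14 ∧
    -6 ≤ (tipMap p).2.1 ∧ (tipMap p).2.1 ≤ -2 ∧ |(tipMap p).2.2| ≤ 1 := by
  simp only [box, tipMap, mem_ofPred_eq, abs_le] at hp ⊢
  refine ⟨?_, ?_, ?_, ?_, ?_, ?_⟩ <;> linarith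

theorem flip3_mem_box {p : V3} (hp : p ∈ box) : flip3 p ∈ box :=
  flip3_mem_stage (n := 0) hp

theorem hornedDisc_coord (u : ℝ × ℝ) : (hornedDisc u).1 ≤ 14 ∧
    ((hornedDisc u).1 = -20 ∨ |(hornedDisc u).2.2| ≤ 1 ∧
      (|(hornedDisc u).2.1| ≤ 1 → 0 < (hornedDisc u).1)) := by
  rcases hornedDisc_cases u with h | ⟨t, w, h0, h1, hw, -, h⟩ | ⟨t, w, h0, h1, hw, -, h⟩ |
    ⟨hw, h⟩ | ⟨hw, h⟩ <;> rw [h]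
  · exact ⟨by norm_num [faceMap], .inl rfl⟩
  · obtain ⟨a1, a2, a3, a4, a5, a6⟩ := side₀_mem h0.le h1.le hw
    exact ⟨by linarith, .inr ⟨abs_le.2 ⟨a5, a6⟩, fun h => by linarith [abs_le.1 h]⟩⟩
  · obtain ⟨a1, a2, a3, a4, a5, a6⟩ := side₁_mem h0.le h1.le hw
    exact ⟨by linarith, .inr ⟨abs_le.2 ⟨a5, a6⟩, fun h => by linarith [abs_le.1 h]⟩⟩
  · obtain ⟨a1, a2, a3, a4, a5⟩ := tipMap_mem_of_mem_box (hornedDisc_mem_box hw)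
    exact ⟨a2, .inr ⟨a5, fun h => by linarith⟩⟩
  · obtain ⟨a1, a2, a3, a4, a5⟩ := tipMap_mem_of_mem_box (flip3_mem_box (hornedDisc_mem_box hw))
    exact ⟨a2, .inr ⟨a5, fun h => by linarith⟩⟩

theorem hornedDisc_ne_flip3 (u v : ℝ × ℝ) : hornedDisc u ≠ flip3 (hornedDisc v) := fun h => by
  obtain ⟨a1, a2⟩ := hornedDisc_coord u
  obtain ⟨b1, b2⟩ := hornedDisc_coord v
  rw [h] at a1 a2
  simp only [flip3] at a1 a2
  rcases a2 with a2 | ⟨a2, a3⟩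
  · linarith
  rcases b2 with b2 | ⟨b2, b3⟩
  · linarith
  linarith [a3 b2, b3 a2]

theorem tipMap_injective : Function.Injective tipMap :=
  Function.LeftInverse.injective tipInv_tipMap

theorem flip3_injective : Function.Injective flip3 :=
  Function.LeftInverse.injective flip3_flip3

theorem side₀_injective {t t' : ℝ} {w w' : ℝ × ℝ} (hw : ‖w‖ ≤ 1) (h : side₀ t w = side₀ t' w') :
    t = t' ∧ w = w' := by
  simp only [norm_le_iff_abs₂, abs_le] at hw
  simp only [side₀, Prod.mk.injEq] at h
  obtain ⟨h1, h2, h3⟩ := h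
  have e : w.2 = w'.2 := by linarith
  refine ⟨?_, Prod.ext h3 e⟩
  rw [← e] at h1
  exact mul_left_cancel₀ (by linarith : 8 - w.2 / 2 ≠ 0) (by linarith)

theorem side₁_injective {t t' : ℝ} {w w' : ℝ × ℝ} (hw : ‖w‖ ≤ 1) (h : side₁ t w = side₁ t' w') :
    t = t' ∧ w = w' := by
  simp only [norm_le_iff_abs₂, abs_le] at hw
  simp only [side₁, Prod.mk.injEq] at h
  obtain ⟨h1, h2, h3⟩ := h
  have e : w.1 = w'.1 := by linarith
  refine ⟨?_, Prod.ext e h3⟩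
  rw [← e] at h1
  exact mul_left_cancel₀ (by linarith : 16 - w.1 ≠ 0) (by linarith)

theorem norm_sub_le_root₀ (u v : ℝ × ℝ) : ‖u - v‖ ≤ ‖root₀ u - root₀ v‖ / 40 := by
  obtain ⟨h1, h2⟩ := norm_le_iff_abs₂.1 (le_refl ‖root₀ u - root₀ v‖)
  simp only [root₀, Prod.fst_sub, Prod.snd_sub, abs_le] at h1 h2
  simp only [norm_le_iff_abs₂, Prod.fst_sub, Prod.snd_sub, abs_le]
  simp only [root₀]
  refine ⟨⟨?_, ?_⟩, ⟨?_, ?_⟩⟩ <;> linarith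

theorem norm_sub_le_root₁ (u v : ℝ × ℝ) : ‖u - v‖ ≤ ‖root₁ u - root₁ v‖ / 40 := by
  obtain ⟨h1, h2⟩ := norm_le_iff_abs₂.1 (le_refl ‖root₁ u - root₁ v‖)
  simp only [root₁, Prod.fst_sub, Prod.snd_sub, abs_le] at h1 h2
  simp only [norm_le_iff_abs₂, Prod.fst_sub, Prod.snd_sub, abs_le]
  simp only [root₁]
  refine ⟨⟨?_, ?_⟩, ⟨?_, ?_⟩⟩ <;> linarith

theorem root₀_injective : Function.Injective root₀ := fun u v h => by
  have := norm_sub_le_root₀ u v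
  rw [h, sub_self, norm_zero, zero_div] at this
  exact sub_eq_zero.1 (norm_le_zero_iff.1 this)

theorem root₁_injective : Function.Injective root₁ := fun u v h => by
  have := norm_sub_le_root₁ u v
  rw [h, sub_self, norm_zero, zero_div] at this
  exact sub_eq_zero.1 (norm_le_zero_iff.1 this)

/-- The parts of the horned disc. -/
def discPart (u : ℝ × ℝ) (p : V3) : Fin 4 → Prop
  | 0 => p.1 = -20 ∧ p = faceMap u
  | 1 => (-20 < p.1 ∧ p.2.1 < -6) ∧ ∃ t w, ‖w‖ ≤ 1 ∧ root₀ u = (2 - t) • w ∧ p = side₀ t w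
  | 2 => (-20 < p.1 ∧ -2 < p.2.1) ∧ ∃ t w, ‖w‖ ≤ 1 ∧ root₁ u = (2 - t) • w ∧ p = side₁ t w
  | 3 => (-20 < p.1 ∧ -6 ≤ p.2.1 ∧ p.2.1 ≤ -2) ∧ (‖root₀ u‖ ≤ 1 ∧ p = tipMap (hornedDisc (root₀ u)) ∨
      ‖root₁ u‖ ≤ 1 ∧ p = tipMap (flip3 (hornedDisc (root₁ u))))

theorem exists_discPart (u : ℝ × ℝ) : ∃ i, discPart u (hornedDisc u) i := by
  rcases hornedDisc_cases u with h | ⟨t, w, h0, h1, hw, hr, h⟩ | ⟨t, w, h0, h1, hw, hr, h⟩ |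
    ⟨hw, h⟩ | ⟨hw, h⟩
  · exact ⟨0, by rw [h]; rfl, h⟩
  · refine ⟨1, ?_, t, w, hw, hr, h⟩
    simp only [norm_le_iff_abs₂, abs_le] at hw
    have a := mul_pos (by linarith : 0 < 8 - w.2 / 2) h0
    have b := mul_pos (by linarith : 0 < 8 - w.2 / 2) (sub_pos.2 h1)
    simp only [h, side₀]
    constructor <;> linarith
  · refine ⟨2, ?_, t, w, hw, hr, h⟩
    simp only [norm_le_iff_abs₂, abs_le] at hw
    have a := mul_pos (by linarith : 0 < 16 - w.1) h0
    have b := mul_pos (by linarith : 0 < 16 - w.1) (sub_pos.2 h1)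
    simp only [h, side₁]
    constructor <;> linarith
  · obtain ⟨a1, a2, a3, a4, a5⟩ := tipMap_mem_of_mem_box (hornedDisc_mem_box hw)
    rw [← h] at a1 a3 a4
    exact ⟨3, ⟨by linarith, a3, a4⟩, .inl ⟨hw, h⟩⟩
  · obtain ⟨a1, a2, a3, a4, a5⟩ := tipMap_mem_of_mem_box (flip3_mem_box (hornedDisc_mem_box hw))
    rw [← h] at a1 a3 a4
    exact ⟨3, ⟨by linarith, a3, a4⟩, .inr ⟨hw, h⟩⟩

theorem discPart_unique {u v : ℝ × ℝ} {p : V3} {i j : Fin 4} (hi : discPart u p i)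
    (hj : discPart v p j) : i = j := by
  have key : ∀ (i : Fin 4) (u : ℝ × ℝ), discPart u p i → i = if p.1 = -20 then 0 else
      if p.2.1 < -6 then 1 else if p.2.1 ≤ -2 then 3 else 2 := fun i u h => by
    fin_cases i
    · rw [if_pos h.1]; rfl
    · rw [if_neg h.1.1.ne', if_pos h.1.2]; rfl
    · rw [if_neg h.1.1.ne', if_neg (by linarith [h.1.2]), if_neg h.1.2.not_ge]; rfl
    · rw [if_neg h.1.1.ne', if_neg h.1.2.1.not_gt, if_pos h.1.2.2]; rfl
  rw [key i u hi, key j v hj]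

theorem norm_sub_le_of_hornedDisc_eq (n : ℕ) {u v : ℝ × ℝ} (hu : ‖u‖ ≤ 1) (hv : ‖v‖ ≤ 1)
    (h : hornedDisc u = hornedDisc v) : ‖u - v‖ ≤ 2 * (1 / 40) ^ n := by
  induction n generalizing u v with
  | zero => linarith [norm_sub_le u v]
  | succ n ih =>
    obtain ⟨i, hi⟩ := exists_discPart u
    obtain ⟨j, hj⟩ := exists_discPart v
    rw [← h] at hj
    obtain rfl := discPart_unique hi hj
    have hz : u = v → ‖u - v‖ ≤ 2 * (1 / 40) ^ (n + 1) := fun e => by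
      rw [e, sub_self, norm_zero]; positivity
    have hp : (1 / 40 : ℝ) ^ (n + 1) = (1 / 40) ^ n / 40 := by rw [pow_succ]; ring
    fin_cases i
    · refine hz ?_
      have e := hi.2.symm.trans hj.2
      simp only [faceMap, Prod.mk.injEq, true_and] at e
      exact Prod.ext (by linarith) (by linarith)
    · obtain ⟨-, t, w, hw, e1, e2⟩ := hi
      obtain ⟨-, t', w', hw', e3, e4⟩ := hj
      obtain ⟨rfl, rfl⟩ := side₀_injective hw (e2.symm.trans e4)
      exact hz (root₀_injective (e1.trans e3.symm))
    · obtain ⟨-, t, w, hw, e1, e2⟩ := hi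
      obtain ⟨-, t', w', hw', e3, e4⟩ := hj
      obtain ⟨rfl, rfl⟩ := side₁_injective hw (e2.symm.trans e4)
      exact hz (root₁_injective (e1.trans e3.symm))
    · rcases hi.2 with ⟨r1, e1⟩ | ⟨r1, e1⟩ <;> rcases hj.2 with ⟨r2, e2⟩ | ⟨r2, e2⟩ <;>
        have e := tipMap_injective (e1.symm.trans e2)
      · have := ih r1 r2 e
        linarith [norm_sub_le_root₀ u v]
      · exact (hornedDisc_ne_flip3 _ _ e).elim
      · exact (hornedDisc_ne_flip3 _ _ e.symm).elim
      · have := ih r1 r2 (flip3_injective e)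
        linarith [norm_sub_le_root₁ u v]

theorem hornedDisc_injOn {u v : ℝ × ℝ} (hu : ‖u‖ ≤ 1) (hv : ‖v‖ ≤ 1)
    (h : hornedDisc u = hornedDisc v) : u = v := by
  have lim : Tendsto (fun n : ℕ => 2 * (1 / 40 : ℝ) ^ n) atTop (𝓝 (2 * 0)) :=
    (tendsto_pow_atTop_nhds_zero_of_lt_one (by norm_num) (by norm_num)).const_mul _
  rw [mul_zero] at lim
  exact sub_eq_zero.1 (norm_le_zero_iff.1 (ge_of_tendsto' lim fun n =>
    norm_sub_le_of_hornedDisc_eq n hu hv h))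

end HornDisc

section HornSphere

open Topology Filter

/-- The parametrization of the horned sphere by the unit sphere of the sup norm. -/
def sphereMap (p : V3) : V3 :=
  (-30 + 10 * p.1, 20 * p.2.1, 20 * p.2.2) + max p.1 0 • displacement p.2

/-- The horned sphere. -/
def hornedSphere : Set V3 := sphereMap '' Metric.sphere 0 1

theorem continuous_sphereMap : Continuous sphereMap := by
  have := continuous_displacement
  unfold sphereMap
  fun_prop

theorem sphereMap_one (u : ℝ × ℝ) : sphereMap (1, u) = hornedDisc u := by
  rw [sphereMap, hornedDisc, faceMap]
  norm_num

theorem norm_eq_max (p : V3) : ‖p‖ = max |p.1| ‖p.2‖ := rfl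

theorem sphereMap_of_ne_one {p : V3} (hp : ‖p‖ = 1) (h : p.1 ≠ 1) :
    p.1 < 1 ∧ sphereMap p = (-30 + 10 * p.1, 20 * p.2.1, 20 * p.2.2) := by
  rw [norm_eq_max] at hp
  have h1 : |p.1| ≤ 1 := (le_max_left _ _).trans hp.le
  have h2 : p.1 < 1 := lt_of_le_of_ne (abs_le.1 h1).2 h
  refine ⟨h2, ?_⟩
  rcases le_or_gt p.1 0 with h0 | h0
  · rw [sphereMap, max_eq_right h0, zero_smul, add_zero]
  · have : ‖p.2‖ = 1 := by
      rcases max_choice |p.1| ‖p.2‖ with e | e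
      · rw [hp, abs_of_pos h0] at e
        exact (h e.symm).elim
      · rw [← e, hp]
    rw [sphereMap, displacement_of_one_le this.ge, smul_zero, add_zero]

theorem sphereMap_injOn : InjOn sphereMap (Metric.sphere 0 1) := by
  intro p hp q hq h
  rw [mem_sphere_zero_iff_norm] at hp hq
  have hp2 : ‖p.2‖ ≤ 1 := (le_max_right _ _).trans hp.le
  have hq2 : ‖q.2‖ ≤ 1 := (le_max_right _ _).trans hq.le
  have aux : ∀ {p q : V3}, ‖p.2‖ ≤ 1 → ‖q‖ = 1 → p.1 = 1 → q.1 ≠ 1 →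
      sphereMap p ≠ sphereMap q := by
    rintro ⟨_, u⟩ q hu hq rfl h h'
    obtain ⟨h1, h2⟩ := sphereMap_of_ne_one hq h
    have := (hornedDisc_mem_box hu).1
    rw [sphereMap_one] at h'
    rw [h', h2] at this
    simp only at this
    linarith
  by_cases h1 : p.1 = 1 <;> by_cases h2 : q.1 = 1
  · obtain ⟨_, u⟩ := p
    obtain ⟨_, v⟩ := q
    obtain rfl := h1
    obtain rfl := h2
    rw [sphereMap_one, sphereMap_one] at h
    exact congrArg (Prod.mk 1) (hornedDisc_injOn hp2 hq2 h)
  · exact (aux hp2 hq h1 h2 h).elim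
  · exact (aux hq2 hp h2 h1 h.symm).elim
  · rw [(sphereMap_of_ne_one hp h1).2, (sphereMap_of_ne_one hq h2).2] at h
    simp only [Prod.mk.injEq] at h
    exact Prod.ext (by linarith) (Prod.ext (by linarith) (by linarith))

theorem isCompact_hornedSphere : IsCompact hornedSphere :=
  (isCompact_sphere _ _).image continuous_sphereMap

theorem hornedDisc_mem_hornedSphere {u : ℝ × ℝ} (hu : ‖u‖ ≤ 1) : hornedDisc u ∈ hornedSphere :=
  ⟨(1, u), by rw [mem_sphere_zero_iff_norm, norm_eq_max, abs_one, max_eq_left hu],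
    sphereMap_one u⟩

theorem hornedSphere_subset : hornedSphere ⊆ hornedBall := by
  rintro _ ⟨p, hp, rfl⟩
  rw [mem_sphere_zero_iff_norm] at hp
  by_cases h : p.1 = 1
  · obtain ⟨_, u⟩ := p
    obtain rfl := h
    rw [sphereMap_one]
    exact hornedDisc_mem_hornedBall ((le_max_right _ _).trans hp.le)
  · rw [(sphereMap_of_ne_one hp h).2]
    obtain ⟨h1, h2, h3⟩ := norm_le_iff_abs.1 hp.le
    rw [abs_le] at h1 h2 h3
    refine .inl (.inl ?_)
    simp only [body, mem_ofPred_eq]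
    refine ⟨?_, ?_, ?_, ?_, ?_, ?_⟩ <;> linarith

/-- The horned sphere is a topological sphere. -/
theorem nonempty_homeomorph_hornedSphere {E : Type*} [NormedAddCommGroup E] [NormedSpace ℝ E]
    [FiniteDimensional ℝ E] (e : E ≃L[ℝ] V3) :
    Nonempty (e ⁻¹' hornedSphere ≃ₜ Metric.sphere (0 : E) 1) := by
  let N : V3 → V3 := fun v => ‖v‖⁻¹ • v
  have hne : ∀ x : Metric.sphere (0 : E) 1, e x ≠ 0 := fun x h => by
    have h1 := mem_sphere_zero_iff_norm.1 x.2
    rw [e.map_eq_zero_iff.1 h, norm_zero] at h1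
    exact zero_ne_one h1
  have hnorm : ∀ v : V3, v ≠ 0 → ‖N v‖ = 1 := fun v hv => by
    simp only [N]
    rw [norm_smul, norm_inv, norm_norm, inv_mul_cancel₀ (norm_ne_zero_iff.2 hv)]
  let φ : Metric.sphere (0 : E) 1 → e ⁻¹' hornedSphere := fun x =>
    ⟨e.symm (sphereMap (N (e x))), by
      rw [mem_preimage, e.apply_symm_apply]
      exact ⟨_, mem_sphere_zero_iff_norm.2 (hnorm _ (hne x)), rfl⟩⟩
  have hφ : Continuous φ := by
    refine Continuous.subtype_mk (e.symm.continuous.comp (continuous_sphereMap.comp ?_)) _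
    have c : Continuous fun x : Metric.sphere (0 : E) 1 => e x :=
      e.continuous.comp continuous_subtype_val
    exact (c.norm.inv₀ fun x => norm_ne_zero_iff.2 (hne x)).smul c
  have hi : Function.Injective φ := fun x y h => by
    have h1 := e.symm.injective (congrArg Subtype.val h)
    have h2 := sphereMap_injOn (mem_sphere_zero_iff_norm.2 (hnorm _ (hne x)))
      (mem_sphere_zero_iff_norm.2 (hnorm _ (hne y))) h1
    have h3 : e.symm (N (e x)) = e.symm (N (e y)) := by rw [h2]
    simp only [N, map_smul, e.symm_apply_apply] at h3
    have h4 := congrArg norm h3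
    have ex := mem_sphere_zero_iff_norm.1 x.2
    have ey := mem_sphere_zero_iff_norm.1 y.2
    rw [norm_smul, norm_smul, norm_inv, norm_inv, norm_norm, norm_norm, ex, ey, mul_one,
      mul_one] at h4
    rw [h4] at h3
    exact Subtype.ext (smul_right_injective E (inv_ne_zero (norm_ne_zero_iff.2 (hne y))) h3)
  have hs : Function.Surjective φ := by
    rintro ⟨y, p, hp, hy⟩
    rw [mem_sphere_zero_iff_norm] at hp
    have hp0 : p ≠ 0 := fun h => by simp [h] at hp
    have hq : e.symm p ≠ 0 := fun h => hp0 (e.symm.map_eq_zero_iff.1 h)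
    have hq' := norm_ne_zero_iff.2 hq
    refine ⟨⟨‖e.symm p‖⁻¹ • e.symm p, ?_⟩, Subtype.ext ?_⟩
    · rw [mem_sphere_zero_iff_norm, norm_smul, norm_inv, norm_norm, inv_mul_cancel₀ hq']
    · simp only [φ, N, map_smul, e.apply_symm_apply]
      rw [norm_smul, norm_inv, norm_norm, hp, mul_one, inv_inv, smul_smul, mul_inv_cancel₀ hq',
        one_smul, hy, e.symm_apply_apply]
  have : CompactSpace (Metric.sphere (0 : E) 1) := by
    have := FiniteDimensional.proper ℝ E
    infer_instance
  exact ⟨(hφ.homeoOfEquivCompactToT2 (f := Equiv.ofBijective φ ⟨hi, hs⟩)).symm⟩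

theorem exists_root₀_eq {v : ℝ × ℝ} (hv : ‖v‖ ≤ 2) : ∃ u, ‖u‖ ≤ 1 ∧ root₀ u = v := by
  rw [norm_le_iff_abs₂, abs_le, abs_le] at hv
  refine ⟨((v.2 - 56) / 80, v.1 / 40), ?_, ?_⟩
  · simp only [norm_le_iff_abs₂, abs_le]
    refine ⟨⟨?_, ?_⟩, ⟨?_, ?_⟩⟩ <;> linarith
  · ext <;> simp only [root₀] <;> ring

theorem exists_root₁_eq {v : ℝ × ℝ} (hv : ‖v‖ ≤ 2) : ∃ u, ‖u‖ ≤ 1 ∧ root₁ u = v := by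
  rw [norm_le_iff_abs₂, abs_le, abs_le] at hv
  refine ⟨((28 - v.1) / 40, v.2 / 40), ?_, ?_⟩
  · simp only [norm_le_iff_abs₂, abs_le]
    refine ⟨⟨?_, ?_⟩, ⟨?_, ?_⟩⟩ <;> linarith
  · ext <;> simp only [root₁] <;> ring

theorem exists_hornedDisc_eq_side₀ {t : ℝ} {w : ℝ × ℝ} (h0 : 0 ≤ t) (h1 : t ≤ 1) (hw : ‖w‖ = 1) :
    ∃ u, ‖u‖ ≤ 1 ∧ hornedDisc u = side₀ t w := by
  have e : ‖(2 - t) • w‖ = 2 - t := by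
    rw [norm_smul, hw, mul_one, Real.norm_eq_abs, abs_of_nonneg (by linarith)]
  obtain ⟨u, hu, hr⟩ := exists_root₀_eq (v := (2 - t) • w) (by linarith)
  refine ⟨u, hu, ?_⟩
  rw [hornedDisc_of_norm_root₀_le_two] <;> rw [hr, e]
  · rw [sub_sub_cancel, smul_smul, inv_mul_cancel₀ (by linarith), one_smul]
  · linarith
  · linarith

theorem exists_hornedDisc_eq_side₁ {t : ℝ} {w : ℝ × ℝ} (h0 : 0 ≤ t) (h1 : t ≤ 1) (hw : ‖w‖ = 1) :
    ∃ u, ‖u‖ ≤ 1 ∧ hornedDisc u = side₁ t w := by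
  have e : ‖(2 - t) • w‖ = 2 - t := by
    rw [norm_smul, hw, mul_one, Real.norm_eq_abs, abs_of_nonneg (by linarith)]
  obtain ⟨u, hu, hr⟩ := exists_root₁_eq (v := (2 - t) • w) (by linarith)
  refine ⟨u, hu, ?_⟩
  rw [hornedDisc_of_norm_root₁_le_two] <;> rw [hr, e]
  · rw [sub_sub_cancel, smul_smul, inv_mul_cancel₀ (by linarith), one_smul]
  · linarith
  · linarith

/-- The image of the horned disc. -/
def discSet : Set V3 := hornedDisc '' Metric.closedBall 0 1

theorem mem_discSet {p : V3} : p ∈ discSet ↔ ∃ u, ‖u‖ ≤ 1 ∧ hornedDisc u = p := by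
  simp only [discSet, mem_image, mem_closedBall_zero_iff]

theorem tipMap_mem_discSet {p : V3} (hp : p ∈ discSet) : tipMap p ∈ discSet := by
  obtain ⟨v, hv, rfl⟩ := mem_discSet.1 hp
  obtain ⟨u, hu, hr⟩ := exists_root₀_eq (hv.trans one_le_two)
  exact mem_discSet.2 ⟨u, hu, by rw [hornedDisc_of_norm_root₀_le_one (hr ▸ hv), hr]⟩

theorem tipMap_flip3_mem_discSet {p : V3} (hp : p ∈ discSet) : tipMap (flip3 p) ∈ discSet := by
  obtain ⟨v, hv, rfl⟩ := mem_discSet.1 hp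
  obtain ⟨u, hu, hr⟩ := exists_root₁_eq (hv.trans one_le_two)
  exact mem_discSet.2 ⟨u, hu, by rw [hornedDisc_of_norm_root₁_le_one (hr ▸ hv), hr]⟩

theorem meridian_mem_discSet {w : ℝ × ℝ} (hw : max |w.1| |w.2| = 1) : meridian 1 w ∈ discSet := by
  obtain ⟨u, hu, h⟩ := exists_hornedDisc_eq_side₀ (t := 1 / 2) (w := (w.2, w.1)) (by norm_num)
    (by norm_num) (by rw [Prod.norm_def, max_comm]; exact hw)
  refine mem_discSet.2 ⟨u, hu, h.trans ?_⟩
  simp only [side₀, meridian]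
  ext <;> dsimp only <;> ring

theorem iterate_meridian_mem {w : ℝ × ℝ} (hw : max |w.1| |w.2| = 1) (n : ℕ) :
    tipMap^[n] (meridian 1 w) ∈ hornedSphere := by
  have : tipMap^[n] (meridian 1 w) ∈ discSet := by
    induction n with
    | zero => exact meridian_mem_discSet hw
    | succ n ih => rw [Function.iterate_succ_apply']; exact tipMap_mem_discSet ih
  obtain ⟨u, hu, h⟩ := mem_discSet.1 this
  rw [← h]
  exact hornedDisc_mem_hornedSphere hu

end HornSphere

section HornBoundary

open Topology Filter

theorem mem_limitSet_iff {p : V3} : p ∈ limitSet ↔ (p ∈ face ∨ p ∈ horns ∨ tipInv p ∈ limitSet) ∨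
    flip3 p ∈ face ∨ flip3 p ∈ horns ∨ tipInv (flip3 p) ∈ limitSet := by
  constructor
  · intro h
    by_contra! hn
    obtain ⟨⟨h1, h2, h3⟩, h4, h5, h6⟩ := hn
    obtain ⟨n, hn⟩ := notMem_limitSet.1 h3
    obtain ⟨m, hm⟩ := notMem_limitSet.1 h6
    have := mem_iInter.1 h (n + m + 1)
    rw [mem_stage_succ] at this
    rcases this with h | h | h | h | h | h
    · exact h1 h
    · exact h4 h
    · exact h2 h
    · exact h5 h
    · exact hn (antitone_stage (by omega) h)
    · exact hm (antitone_stage (by omega) h)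
  · intro h
    refine mem_iInter.2 fun n => stage_succ_subset n ?_
    rw [mem_stage_succ]
    rcases h with (h | h | h) | h | h | h
    · exact .inl h
    · exact .inr (.inr (.inl h))
    · exact .inr (.inr (.inr (.inr (.inl (mem_iInter.1 h n)))))
    · exact .inr (.inl h)
    · exact .inr (.inr (.inr (.inl h)))
    · exact .inr (.inr (.inr (.inr (.inr (mem_iInter.1 h n)))))

/-- Near the point there is nothing above the face but the horns. -/
def HornNear (p : V3) : Prop :=
  (∀ᶠ q in 𝓝 p, q ∈ horns ∨ q.1 ≤ -20) ∧ |p.2.1| < 20 ∧ |p.2.2| < 20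

/-- Near the point the limit set fills the box. -/
def LimitNear (p : V3) : Prop :=
  (∀ᶠ q in 𝓝 p, q.1 ≤ -20 ∨ 20 ≤ q.1 ∨ q ∈ limitSet) ∧ |p.2.1| < 20 ∧ |p.2.2| < 20

theorem HornNear.limitNear {p : V3} (h : HornNear p) : LimitNear p :=
  ⟨h.1.mono fun _ hq => hq.elim (fun hq => .inr (.inr (mem_limitSet_iff.2 (.inl (.inr (.inl hq))))))
    .inl, h.2⟩

theorem hornNear_of_mem_horn₀ {p : V3} (hp : p ∈ horn₀) (hy : p.2.1 < -6) :
    p ∈ discSet ∨ HornNear p := by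
  obtain ⟨h1, h2, h3, h4, h5, h6⟩ := hp
  set r := (-6 - p.2.1) + (p.1 + 20) / 4 with hr
  have hw : ‖((p.2.2, 16 - 2 * r) : ℝ × ℝ)‖ ≤ 1 := by
    simp only [norm_le_iff_abs₂, abs_le]
    refine ⟨⟨?_, ?_⟩, ⟨?_, ?_⟩⟩ <;> linarith
  rcases hw.eq_or_lt with hw | hw
  · left
    have hr0 : 0 < 4 * r := by linarith
    obtain ⟨u, hu, h⟩ := exists_hornedDisc_eq_side₀ (t := (p.1 + 20) / (4 * r))
      (div_nonneg (by linarith) hr0.le) ((div_le_one hr0).2 (by linarith)) hw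
    refine mem_discSet.2 ⟨u, hu, h.trans ?_⟩
    have e : 4 * r * ((p.1 + 20) / (4 * r)) = p.1 + 20 := mul_div_cancel₀ _ hr0.ne'
    simp only [side₀]
    generalize (p.1 + 20) / (4 * r) = t at e
    ext <;> dsimp only <;> linarith
  · right
    simp only [Prod.norm_def, Real.norm_eq_abs, max_lt_iff, abs_lt] at hw
    refine ⟨?_, abs_lt.2 ⟨by linarith, by linarith⟩, abs_lt.2 ⟨by linarith, by linarith⟩⟩
    have c : Continuous fun q : V3 => (-6 - q.2.1) + (q.1 + 20) / 4 := by fun_prop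
    have c2 : Continuous fun q : V3 => q.2.1 := by fun_prop
    have c3 : Continuous fun q : V3 => q.2.2 := by fun_prop
    filter_upwards [(c.tendsto p).eventually_const_lt (u := 15 / 2) (by linarith),
      (c.tendsto p).eventually_lt_const (u := 17 / 2) (by linarith),
      c2.continuousAt.eventually_lt_const hy,
      (c3.tendsto p).eventually_const_lt (u := -1) (by linarith),
      (c3.tendsto p).eventually_lt_const (u := 1) (by linarith)] with q q1 q2 q3 q4 q5
    rcases le_total q.1 (-20) with h | h
    · exact .inr h
    · exact .inl (.inl ⟨h, q3.le, q1.le, q2.le, q4.le, q5.le⟩)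

theorem hornNear_of_mem_horn₁ {p : V3} (hp : p ∈ horn₁) (hy : -2 < p.2.1) :
    p ∈ discSet ∨ HornNear p := by
  obtain ⟨h1, h2, h3, h4, h5, h6⟩ := hp
  set r := (p.2.1 + 2) + (p.1 + 20) / 2 with hr
  have hw : ‖((16 - r, p.2.2) : ℝ × ℝ)‖ ≤ 1 := by
    simp only [norm_le_iff_abs₂, abs_le]
    refine ⟨⟨?_, ?_⟩, ⟨?_, ?_⟩⟩ <;> linarith
  rcases hw.eq_or_lt with hw | hw
  · left
    have hr0 : 0 < 2 * r := by linarith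
    obtain ⟨u, hu, h⟩ := exists_hornedDisc_eq_side₁ (t := (p.1 + 20) / (2 * r))
      (div_nonneg (by linarith) hr0.le) ((div_le_one hr0).2 (by linarith)) hw
    refine mem_discSet.2 ⟨u, hu, h.trans ?_⟩
    have e : 2 * r * ((p.1 + 20) / (2 * r)) = p.1 + 20 := mul_div_cancel₀ _ hr0.ne'
    simp only [side₁]
    generalize (p.1 + 20) / (2 * r) = t at e
    ext <;> dsimp only <;> linarith
  · right
    simp only [Prod.norm_def, Real.norm_eq_abs, max_lt_iff, abs_lt] at hw
    refine ⟨?_, abs_lt.2 ⟨by linarith, by linarith⟩, abs_lt.2 ⟨by linarith, by linarith⟩⟩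
    have c : Continuous fun q : V3 => (q.2.1 + 2) + (q.1 + 20) / 2 := by fun_prop
    have c2 : Continuous fun q : V3 => q.2.1 := by fun_prop
    have c3 : Continuous fun q : V3 => q.2.2 := by fun_prop
    filter_upwards [(c.tendsto p).eventually_const_lt (u := 15) (by linarith),
      (c.tendsto p).eventually_lt_const (u := 17) (by linarith),
      c2.continuousAt.eventually_const_lt hy,
      (c3.tendsto p).eventually_const_lt (u := -1) (by linarith),
      (c3.tendsto p).eventually_lt_const (u := 1) (by linarith)] with q q1 q2 q3 q4 q5
    rcases le_total q.1 (-20) with h | h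
    · exact .inr h
    · exact .inl (.inr ⟨h, q3.le, q1.le, q2.le, q4.le, q5.le⟩)

theorem hornNear_of_mem_horns {p : V3} (hp : p ∈ horns) :
    p ∈ discSet ∨ HornNear p ∨ tipInv p ∈ limitSet := by
  rcases hp with hp | hp
  · rcases hp.2.1.lt_or_eq with hy | hy
    · exact (hornNear_of_mem_horn₀ hp hy).imp_right .inl
    · refine .inr (.inr (mem_limitSet_iff.2 (.inl (.inl ?_))))
      simp only [horn₀, face, tipInv, mem_ofPred_eq, hy] at hp ⊢
      refine ⟨?_, ?_, ?_, ?_, ?_⟩ <;> linarith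
  · rcases hp.2.1.lt_or_eq with hy | hy
    · exact (hornNear_of_mem_horn₁ hp hy).imp_right .inl
    · refine .inr (.inr (mem_limitSet_iff.2 (.inr (.inl ?_))))
      simp only [horn₁, face, tipInv, flip3, mem_ofPred_eq, ← hy] at hp ⊢
      refine ⟨?_, ?_, ?_, ?_, ?_⟩ <;> linarith

theorem hornNear_of_mem_face {p : V3} (hp : p ∈ face) : p ∈ discSet ∨ HornNear p := by
  simp only [face, mem_ofPred_eq] at hp
  let u : ℝ × ℝ := (p.2.1 / 20, p.2.2 / 20)
  have hu : ‖u‖ ≤ 1 := by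
    simp only [u, norm_le_iff_abs₂, abs_le]
    refine ⟨⟨?_, ?_⟩, ⟨?_, ?_⟩⟩ <;> linarith
  rcases lt_or_ge ‖root₀ u‖ 2 with h0 | h0
  · simp only [u, root₀, Prod.norm_def, Real.norm_eq_abs, max_lt_iff, abs_lt] at h0
    refine hornNear_of_mem_horn₀ ?_ (by linarith)
    simp only [horn₀, mem_ofPred_eq]
    refine ⟨?_, ?_, ?_, ?_, ?_, ?_⟩ <;> linarith
  rcases lt_or_ge ‖root₁ u‖ 2 with h1 | h1
  · simp only [u, root₁, Prod.norm_def, Real.norm_eq_abs, max_lt_iff, abs_lt] at h1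
    refine hornNear_of_mem_horn₁ ?_ (by linarith)
    simp only [horn₁, mem_ofPred_eq]
    refine ⟨?_, ?_, ?_, ?_, ?_, ?_⟩ <;> linarith
  refine .inl (mem_discSet.2 ⟨u, hu, ?_⟩)
  rw [hornedDisc_of_two_le h0 h1]
  simp only [u, faceMap]
  ext <;> dsimp only <;> linarith

theorem LimitNear.tip {p : V3} (hp : tipInv p ∈ limitSet) (h : LimitNear (tipInv p)) :
    ∀ᶠ q in 𝓝 p, q ∈ horns ∨ tipInv q ∈ limitSet := by
  obtain ⟨h, hy, hz⟩ := h
  have hb : tipInv p ∈ box := mem_iInter.1 hp 0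
  simp only [box, tipInv, mem_ofPred_eq, abs_lt] at hb hy hz
  have c1 : Continuous fun q : V3 => q.1 := by fun_prop
  have c2 : Continuous fun q : V3 => q.2.1 := by fun_prop
  have c3 : Continuous fun q : V3 => q.2.2 := by fun_prop
  have a1 := (c1.tendsto p).eventually_const_lt (u := 10) (by linarith)
  have a2 := (c3.tendsto p).eventually_const_lt (u := -1) (by linarith)
  have a3 := (c3.tendsto p).eventually_lt_const (u := 1) (by linarith)
  have e0 : ∀ᶠ q in 𝓝 p, q.2.1 ≤ -6 → q ∈ horn₀ := by
    rcases lt_or_ge (-6) p.2.1 with hl | hl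
    · filter_upwards [c2.continuousAt.eventually_const_lt hl] with q hq hq'
      linarith
    · have c : Continuous fun q : V3 => (-6 - q.2.1) + (q.1 + 20) / 4 := by fun_prop
      filter_upwards [a1, a2, a3,
        (c.tendsto p).eventually_const_lt (u := 15 / 2) (by linarith),
        (c.tendsto p).eventually_lt_const (u := 17 / 2) (by linarith)]
        with q q1 q2 q3 q4 q5 q6
      exact ⟨by linarith, q6, q4.le, q5.le, q2.le, q3.le⟩
  have e1 : ∀ᶠ q in 𝓝 p, -2 ≤ q.2.1 → q ∈ horn₁ := by
    rcases lt_or_ge p.2.1 (-2) with hl | hl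
    · filter_upwards [c2.continuousAt.eventually_lt_const hl] with q hq hq'
      linarith
    · have c : Continuous fun q : V3 => (q.2.1 + 2) + (q.1 + 20) / 2 := by fun_prop
      filter_upwards [a1, a2, a3,
        (c.tendsto p).eventually_const_lt (u := 15) (by linarith),
        (c.tendsto p).eventually_lt_const (u := 17) (by linarith)]
        with q q1 q2 q3 q4 q5 q6
      exact ⟨by linarith, q6, q4.le, q5.le, q2.le, q3.le⟩
  filter_upwards [e0, e1, continuous_tipInv.continuousAt.eventually h] with q q0 q1 hq
  rcases hq with hq | hq | hq
  · simp only [tipInv] at hq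
    exact .inl (.inl (q0 (by linarith)))
  · simp only [tipInv] at hq
    exact .inl (.inr (q1 (by linarith)))
  · exact .inr hq

theorem LimitNear.of_tip {p : V3} (hp : tipInv p ∈ limitSet) (h : LimitNear (tipInv p)) :
    LimitNear p := by
  refine ⟨(h.tip hp).mono fun q hq => .inr (.inr (mem_limitSet_iff.2 (.inl (.inr hq)))), ?_, ?_⟩ <;>
  · have hb : tipInv p ∈ box := mem_iInter.1 hp 0
    simp only [box, tipInv, mem_ofPred_eq] at hb
    rw [abs_lt]
    constructor <;> linarith

theorem LimitNear.of_flip3 {p : V3} (h : LimitNear (flip3 p)) : LimitNear p := by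
  refine ⟨(continuous_flip3.continuousAt.eventually h.1).mono fun q hq => ?_, h.2.2, h.2.1⟩
  rcases hq with hq | hq | hq
  · simp only [flip3] at hq
    exact .inr (.inl (by linarith))
  · simp only [flip3] at hq
    exact .inl (by linarith)
  · exact .inr (.inr (flip3_flip3 q ▸ flip3_mem_limitSet hq))

/-- The boundary of the limit set inside the box. -/
def discPair : Set V3 := discSet ∪ flip3 ⁻¹' discSet

theorem discPair_subset : discPair ⊆ box := by
  rintro p (hp | hp) <;> obtain ⟨u, hu, h⟩ := mem_discSet.1 hp
  · exact h ▸ hornedDisc_mem_box hu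
  · rw [← flip3_flip3 p, ← h]
    exact flip3_mem_box (hornedDisc_mem_box hu)

theorem isClosed_discPair : IsClosed discPair := by
  have : IsClosed discSet :=
    ((isCompact_closedBall (0 : ℝ × ℝ) 1).image continuous_hornedDisc).isClosed
  exact this.union (this.preimage continuous_flip3)

theorem tipMap_mem_of_mem_discPair {p : V3} (hp : p ∈ discPair) : tipMap p ∈ discSet := by
  rcases hp with hp | hp
  · exact tipMap_mem_discSet hp
  · exact flip3_flip3 p ▸ tipMap_flip3_mem_discSet hp

theorem flip3_mem_discPair {p : V3} (hp : p ∈ discPair) : flip3 p ∈ discPair := by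
  rcases hp with hp | hp
  · exact .inr (by rwa [mem_preimage, flip3_flip3])
  · exact .inl hp

theorem exists_mem_discPair_near (n : ℕ) {p : V3} (hp : p ∈ limitSet) :
    LimitNear p ∨ ∃ q ∈ discPair, ‖p - q‖ ≤ 40 * (1 / 10) ^ n := by
  induction n generalizing p with
  | zero =>
    have hq : hornedDisc 0 ∈ discPair := .inl (mem_discSet.2 ⟨0, by simp, rfl⟩)
    refine .inr ⟨_, hq, ?_⟩
    have h1 := mem_box_iff_norm.1 (discPair_subset hq)
    have h2 := mem_box_iff_norm.1 (mem_iInter.1 hp 0 : p ∈ box)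
    linarith [norm_sub_le p (hornedDisc 0)]
  | succ n ih =>
    have key : ∀ p : V3, (p ∈ face ∨ p ∈ horns ∨ tipInv p ∈ limitSet) →
        LimitNear p ∨ ∃ q ∈ discPair, ‖p - q‖ ≤ 40 * (1 / 10) ^ (n + 1) := by
      intro p hp
      have hself : p ∈ discSet → ∃ q ∈ discPair, ‖p - q‖ ≤ 40 * (1 / 10) ^ (n + 1) := fun h =>
        ⟨p, .inl h, by rw [sub_self, norm_zero]; positivity⟩
      have htip : tipInv p ∈ limitSet →
          LimitNear p ∨ ∃ q ∈ discPair, ‖p - q‖ ≤ 40 * (1 / 10) ^ (n + 1) := fun h => by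
        rcases ih h with h' | ⟨q, hq, h'⟩
        · exact .inl (h'.of_tip h)
        · refine .inr ⟨tipMap q, .inl (tipMap_mem_of_mem_discPair hq), ?_⟩
          have e : p = tipMap q + tipLin (tipInv p - q) := by
            rw [← tipMap_add, add_sub_cancel, tipMap_tipInv]
          have := norm_tipLin_le (tipInv p - q)
          rw [← sub_eq_iff_eq_add'.2 e] at this
          rw [pow_succ]
          linarith
      rcases hp with hp | hp | hp
      · exact (hornNear_of_mem_face hp).symm.imp HornNear.limitNear hself
      · rcases hornNear_of_mem_horns hp with h | h | h
        · exact .inr (hself h)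
        · exact .inl h.limitNear
        · exact htip h
      · exact htip hp
    rcases mem_limitSet_iff.1 hp with hp | hp
    · exact key p hp
    · refine (key _ hp).imp LimitNear.of_flip3 ?_
      rintro ⟨q, hq, h⟩
      refine ⟨flip3 q, flip3_mem_discPair hq, ?_⟩
      rwa [← norm_flip3, flip3_sub, flip3_flip3]

theorem limitNear_or_mem_discPair {p : V3} (hp : p ∈ limitSet) : LimitNear p ∨ p ∈ discPair := by
  by_contra! hn
  refine hn.2 (isClosed_discPair.closure_subset (Metric.mem_closure_iff.2 fun ε hε => ?_))
  obtain ⟨n, hn'⟩ := exists_pow_lt_of_lt_one (by positivity : 0 < ε / 40)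
    (by norm_num : (1 / 10 : ℝ) < 1)
  obtain ⟨q, hq, h⟩ := (exists_mem_discPair_near n hp).resolve_left hn.1
  refine ⟨q, hq, ?_⟩
  rw [dist_eq_norm]
  linarith

theorem HornNear.hornedBall_mem {p : V3} (h : HornNear p) (hp : -40 < p.1) :
    hornedBall ∈ 𝓝 p := by
  obtain ⟨h, hy, hz⟩ := h
  rw [abs_lt] at hy hz
  have c1 : Continuous fun q : V3 => q.1 := by fun_prop
  have c2 : Continuous fun q : V3 => q.2.1 := by fun_prop
  have c3 : Continuous fun q : V3 => q.2.2 := by fun_prop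
  filter_upwards [h, c1.continuousAt.eventually_const_lt hp,
    c2.continuousAt.eventually_const_lt hy.1, c2.continuousAt.eventually_lt_const hy.2,
    c3.continuousAt.eventually_const_lt hz.1, c3.continuousAt.eventually_lt_const hz.2]
    with q hq q1 q2 q3 q4 q5
  rcases hq with hq | hq
  · exact .inl (.inr hq)
  · exact .inl (.inl ⟨q1.le, hq, q2.le, q3.le, q4.le, q5.le⟩)

theorem discSet_subset : discSet ⊆ hornedSphere := fun p hp => by
  obtain ⟨u, hu, rfl⟩ := mem_discSet.1 hp
  exact hornedDisc_mem_hornedSphere hu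

theorem mem_hornedSphere_or_of_tip {x : V3} (hx : tipInv x ∈ limitSet) :
    x ∈ hornedSphere ∨ hornedBall ∈ 𝓝 x := by
  rcases limitNear_or_mem_discPair hx with h | h
  · exact .inr ((h.tip hx).mono fun q hq => hq.elim (fun hq => .inl (.inr hq)) .inr)
  · exact .inl (discSet_subset (tipMap_tipInv x ▸ tipMap_mem_of_mem_discPair h))

theorem mem_hornedSphere_or {x : V3} (hx : x ∈ hornedBall) :
    x ∈ hornedSphere ∨ hornedBall ∈ 𝓝 x := by
  rcases hx with (hx | hx) | hx
  · obtain ⟨h1, h2, h3⟩ := hx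
    rcases h2.eq_or_lt with h2 | h2
    · exact (hornNear_of_mem_face ⟨h2, h3⟩).imp (fun h => discSet_subset h)
        fun h => h.hornedBall_mem (by linarith)
    · let p : V3 := ((x.1 + 30) / 10, x.2.1 / 20, x.2.2 / 20)
      have hp : ‖p‖ ≤ 1 := by
        simp only [p, norm_le_iff_abs, abs_le]
        refine ⟨⟨?_, ?_⟩, ⟨?_, ?_⟩, ⟨?_, ?_⟩⟩ <;> linarith
      rcases hp.eq_or_lt with hp | hp
      · refine .inl ⟨p, mem_sphere_zero_iff_norm.2 hp, ?_⟩
        rw [(sphereMap_of_ne_one hp (by simp only [p]; intro h; linarith)).2]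
        simp only [p]
        ext <;> dsimp only <;> ring
      · right
        simp only [p, Prod.norm_def, Real.norm_eq_abs, max_lt_iff, abs_lt] at hp
        have c1 : Continuous fun q : V3 => q.1 := by fun_prop
        refine HornNear.hornedBall_mem ⟨?_, ?_, ?_⟩ (by linarith)
        · exact (c1.continuousAt.eventually_lt_const h2).mono fun q hq => .inr hq.le
        · exact abs_lt.2 ⟨by linarith, by linarith⟩
        · exact abs_lt.2 ⟨by linarith, by linarith⟩
  · rcases hornNear_of_mem_horns hx with h | h | h
    · exact .inl (discSet_subset h)
    · refine .inr (h.hornedBall_mem ?_)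
      rcases hx with hx | hx <;> linarith [hx.1]
    · exact mem_hornedSphere_or_of_tip h
  · exact mem_hornedSphere_or_of_tip hx

end HornBoundary

/-- There is a sphere (a compact set homeomorphic to the unit sphere of `ℝ³`) in `ℝ³`,
e.g. the Alexander horned sphere, that is not an attractor for any discrete dynamical
system on any open subset of `ℝ³`. -/
theorem exists_sphere_not_attractor :
    ∃ S : Set R3, IsCompact S ∧ Nonempty (↥S ≃ₜ ↥(Metric.sphere (0 : R3) 1)) ∧
      ∀ U : Set R3, IsOpen U → S ⊆ U →
        ∀ f : ↥U → ↥U, Continuous f → Function.Injective f → ¬ IsAttractor f S := by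
  let e : R3 ≃L[ℝ] V3 := ContinuousLinearEquiv.ofFinrankEq (by simp [V3])
  have hc : IsCompact (e ⁻¹' hornedSphere) :=
    e.toHomeomorph.isClosedEmbedding.isCompact_preimage isCompact_hornedSphere
  refine ⟨e ⁻¹' hornedSphere, hc, nonempty_homeomorph_hornedSphere e, fun U hU _ f hf hfi => ?_⟩
  exact not_isAttractor_of_hornedBall (e := e.toHomeomorph) hornedSphere_subset
    (fun x hx hxS => (mem_hornedSphere_or hx).resolve_left hxS)
    (fun n w hw => iterate_meridian_mem (mem_square.1 hw) (n + 1)) hU hf hfi
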